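/- arXiv:2211.16371 — 4 statements merged into one kernel-verified Lean document; each statement's English description precedes it below -/
import Mathlib

section
/- Let p be a prime number, let C⁺ be a perfect valuation ring of characteristic p (i.e., an integral domain of characteristic p, with any two elements comparable under divisibility, whose Frobenius endomorphism x ↦ x^p is bijective), and let E⁺ be a valuation ring extension of C⁺. Then (i) the canonical E⁺-linear map Ω¹_{E⁺/𝔽p} → Ω¹_{E⁺/C⁺} between modules of Kähler differentials is an isomorphism, and (ii) Ω¹_{E⁺/C⁺} is a flat E⁺-module. -/
open Polynomial IntermediateField

section
variable {L K : Type*} [Field L] [Field K] [Algebra L K] {p : ℕ}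

theorem minpoly_eq_X_pow_sub_C (hp : p.Prime) {x : K} {a : L} (hx : x ∉ (algebraMap L K).range)
    (ha : algebraMap L K a = x ^ p) [CharP K p] : minpoly L x = X ^ p - C a := by
  refine (minpoly.eq_of_irreducible_of_monic ?_ ?_ (monic_X_pow_sub_C a hp.ne_zero)).symm
  · refine X_pow_sub_C_irreducible_of_prime hp fun b hb => hx ⟨b, ?_⟩
    have := Fact.mk hp
    apply frobenius_inj K p
    simp only [frobenius_def]
    rw [← map_pow, hb, ha]
  · simp [ha]

theorem mem_adjoin_simple_iff_exists_aeval {x : K} (hx : IsIntegral L x) {y : K} :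
    y ∈ L⟮x⟯ ↔ ∃ P : L[X], aeval x P = y := by
  rw [← IntermediateField.mem_toSubalgebra,
    IntermediateField.adjoin_simple_toSubalgebra_of_isAlgebraic hx.isAlgebraic,
    Algebra.adjoin_singleton_eq_range_aeval]
  rfl

section
variable (hp : p.Prime) (hL : ∀ x : K, x ^ p ∈ (algebraMap L K).range)
include hp hL

theorem isIntegral_of_pow_mem_range (x : K) : IsIntegral L x := by
  obtain ⟨a, ha⟩ := hL x
  exact .of_pow hp.pos (ha ▸ isIntegral_algebraMap)

theorem derivation_apply_mem (D : Derivation L K K) {x : K} (hD : D x = 1) {y : K}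
    (hy : y ∈ L⟮x⟯) : D y ∈ L⟮x⟯ := by
  have := @mem_adjoin_simple_iff_exists_aeval L K _ _ _ x (isIntegral_of_pow_mem_range hp hL x)
  obtain ⟨P, rfl⟩ := this.1 hy
  rw [Derivation.map_aeval, hD, smul_eq_mul, mul_one]
  exact this.2 ⟨_, rfl⟩

theorem derivation_iterate_mem (D : Derivation L K K) {x : K} (hD : D x = 1) {y : K}
    (hy : y ∈ L⟮x⟯) (k : ℕ) : D^[k] y ∈ L⟮x⟯ := by
  induction k with
  | zero => exact hy
  | succ k ih =>
    rw [Function.iterate_succ_apply']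
    exact derivation_apply_mem hp hL D hD ih

end

variable [CharP K p] (hp : p.Prime) (hL : ∀ x : K, x ^ p ∈ (algebraMap L K).range)
include hp hL

theorem finrank_adjoin_simple_eq {x : K} (hx : x ∉ (algebraMap L K).range) :
    Module.finrank L L⟮x⟯ = p := by
  obtain ⟨a, ha⟩ := hL x
  rw [IntermediateField.adjoin.finrank (isIntegral_of_pow_mem_range hp hL x),
    minpoly_eq_X_pow_sub_C hp hx ha, natDegree_X_pow_sub_C]

theorem mem_adjoin_simple_symm {x z : K} (hz : z ∈ L⟮x⟯) (hz' : z ∉ (algebraMap L K).range) :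
    x ∈ L⟮z⟯ := by
  have hx' : x ∉ (algebraMap L K).range := by
    intro hx
    have : L⟮x⟯ = ⊥ := IntermediateField.adjoin_simple_eq_bot_iff.2 hx
    exact hz' (by rw [this] at hz; exact hz)
  have hle : L⟮z⟯ ≤ L⟮x⟯ := by simpa using hz
  have : FiniteDimensional L L⟮x⟯ :=
    IntermediateField.adjoin.finiteDimensional (isIntegral_of_pow_mem_range hp hL x)
  rw [IntermediateField.eq_of_le_of_finrank_eq hle
    (by rw [finrank_adjoin_simple_eq hp hL hx', finrank_adjoin_simple_eq hp hL hz'])]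
  exact IntermediateField.mem_adjoin_simple_self L x

theorem eq_zero_of_derivation_apply_eq_zero (D : Derivation L K K) {x : K} (hD : D x = 1) {z : K}
    (hz : z ∈ L⟮x⟯) (h : D z = 0) : z ∈ (algebraMap L K).range := by
  by_contra hz'
  obtain ⟨P, hP⟩ := (mem_adjoin_simple_iff_exists_aeval (isIntegral_of_pow_mem_range hp hL z)).1
    (mem_adjoin_simple_symm hp hL hz hz')
  rw [← hP, Derivation.map_aeval, h, smul_zero] at hD
  exact zero_ne_one hD

theorem derivation_iterate_char_eq_zero (D : Derivation L K K) {x : K} (hD : D x = 1) {y : K}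
    (hy : y ∈ L⟮x⟯) : D^[p] y = 0 := by
  obtain ⟨P, rfl⟩ :=
    (mem_adjoin_simple_iff_exists_aeval (isIntegral_of_pow_mem_range hp hL x)).1 hy
  have key : ∀ k, D^[k] (aeval x P) = aeval x (derivative^[k] P) := by
    intro k
    induction k with
    | zero => rfl
    | succ k ih =>
      rw [Function.iterate_succ_apply', ih, Derivation.map_aeval, hD, smul_eq_mul, mul_one,
        Function.iterate_succ_apply']
  rw [key, ← Polynomial.factorial_smul_hasseDeriv, LinearMap.smul_apply, map_nsmul,
    ← Nat.cast_smul_eq_nsmul K, (CharP.cast_eq_zero_iff K p _).2 (hp.dvd_factorial.2 le_rfl),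
    zero_smul]

theorem exists_derivation_apply_eq_one {x : K} (hx : x ∉ (algebraMap L K).range) :
    ∃ D : Derivation L K K, D x = 1 := by
  obtain ⟨M, -, hM⟩ := zorn_le_nonempty₀ {M : IntermediateField L K | x ∉ M} (by
    intro c hc hcc y hy
    have hne : c.Nonempty := ⟨y, hy⟩
    refine ⟨sSup c, ?_, fun z hz => le_sSup hz⟩
    have hd : DirectedOn (· ≤ ·) c := hcc.directedOn
    intro hxc
    have := hne.to_subtype
    rw [sSup_eq_iSup', ← SetLike.mem_coe, IntermediateField.coe_iSup_of_directed
      hd.directed_val, Set.mem_iUnion] at hxc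
    obtain ⟨i, hi⟩ := hxc
    exact hc i.2 hi) ⊥ hx
  have hxM : x ∉ M := hM.prop
  have hML : ∀ y : K, y ^ p ∈ (algebraMap M K).range := by
    intro y
    obtain ⟨a, ha⟩ := hL y
    exact ⟨algebraMap L M a, ha⟩
  have hr : ∀ y : K, y ∈ (algebraMap M K).range ↔ y ∈ M := fun y =>
    ⟨by rintro ⟨z, rfl⟩; exact z.2, fun h => ⟨⟨y, h⟩, rfl⟩⟩
  have htop : (⊤ : IntermediateField M K) = M⟮x⟯ := by
    refine (eq_top_iff.2 fun y _ => ?_).symm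
    by_cases hy : y ∈ M
    · exact IntermediateField.algebraMap_mem M⟮x⟯ (⟨y, hy⟩ : M)
    · have : x ∈ M⟮y⟯ := by
        by_contra hxy
        refine hy (hM.le_of_ge (y := M⟮y⟯.restrictScalars L) hxy ?_ ?_)
        · intro z hz
          exact IntermediateField.algebraMap_mem M⟮y⟯ (⟨z, hz⟩ : M)
        · exact IntermediateField.mem_adjoin_simple_self M y
      exact mem_adjoin_simple_symm hp hML this (by rwa [hr])
  have hadj : Algebra.adjoin M {x} = ⊤ := by
    rw [← IntermediateField.adjoin_simple_toSubalgebra_of_isAlgebraic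
      (isIntegral_of_pow_mem_range hp hML x).isAlgebraic, ← htop]
    rfl
  have hdx : KaehlerDifferential.D M K x ≠ 0 := by
    intro h0
    have hD : KaehlerDifferential.D M K = 0 :=
      Derivation.ext_of_adjoin_eq_top _ hadj (by intro y hy; rw [Set.mem_singleton_iff.1 hy]; simpa using h0)
    have hsub : Subsingleton (Ω[K⁄M]) := by
      rw [← Submodule.subsingleton_iff K, ← subsingleton_iff_bot_eq_top,
        ← KaehlerDifferential.span_range_derivation, hD]
      symm
      rw [Submodule.span_eq_bot]
      rintro _ ⟨y, rfl⟩
      rfl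
    have : Algebra.FormallyUnramified M K := ⟨hsub⟩
    have : Algebra.FiniteType M K := ⟨⟨{x}, by simpa using hadj⟩⟩
    have : CharP M p := (Algebra.charP_iff M K p).2 inferInstance
    have : ExpChar M p := ExpChar.prime hp
    have : IsPurelyInseparable M K := by
      rw [isPurelyInseparable_iff_pow_mem M p]
      exact fun y => ⟨1, by simpa using hML y⟩
    have := Algebra.FormallyUnramified.range_eq_top_of_isPurelyInseparable M K
    exact hxM ((hr x).1 (this ▸ Subring.mem_top x))
  obtain ⟨f, hf⟩ := Module.Projective.exists_dual_ne_zero K hdx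
  refine ⟨((f (KaehlerDifferential.D M K x))⁻¹ • (f.compDer (KaehlerDifferential.D M K))).restrictScalars L, ?_⟩
  simp [hf]

theorem derivation_iterate_char_eq_self (E : Derivation L K K) {x y z : K} (hy : E y = y)
    (hy0 : y ≠ 0) (hyx : y ∈ L⟮x⟯) (hz : z ∈ L⟮x⟯) : E^[p] z = E z := by
  have hy' : y ∉ (algebraMap L K).range := by
    rintro ⟨a, rfl⟩
    exact hy0 (by rw [← hy, Derivation.map_algebraMap])
  have hle : L⟮x⟯ ≤ L⟮y⟯ := by simpa using mem_adjoin_simple_symm hp hL hyx hy'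
  obtain ⟨P, rfl⟩ :=
    (mem_adjoin_simple_iff_exists_aeval (isIntegral_of_pow_mem_range hp hL y)).1 (hle hz)
  have hpow : ∀ k : ℕ, E^[k] = ((E : K →ₗ[L] K) ^ k : K →ₗ[L] K) := by
    intro k
    rw [Module.End.coe_pow]
    rfl
  have hmon : ∀ (k n : ℕ) (a : L),
      ((E : K →ₗ[L] K) ^ k) (a • y ^ n) = (n : K) ^ k * (a • y ^ n) := by
    intro k n a
    induction k with
    | zero => simp
    | succ k ih =>
      rw [pow_succ', Module.End.mul_apply, ih]
      have h1 : E (a • y ^ n) = (n : K) * (a • y ^ n) := by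
        rw [Derivation.map_smul, Derivation.leibniz_pow, hy]
        rcases n with _ | n
        · simp
        · simp only [← Nat.cast_smul_eq_nsmul K, smul_eq_mul, Nat.add_sub_cancel, pow_succ,
            Algebra.smul_def]
          ring
      change E _ = _
      rw [Derivation.leibniz, h1, ← Nat.cast_pow, Derivation.map_natCast]
      simp only [smul_eq_mul, pow_succ, Nat.cast_pow]
      ring
  have : Fact p.Prime := ⟨hp⟩
  have hcast : ∀ n : ℕ, (n : K) ^ p = n := fun n => by
    rw [← frobenius_def, map_natCast]
  rw [hpow]
  clear hz
  induction P using Polynomial.induction_on' with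
  | add P Q hP hQ =>
    rw [map_add, map_add, map_add, hP, hQ]
  | monomial n a =>
    rw [aeval_monomial, ← Algebra.smul_def, hmon, hcast]
    have := hmon 1 n a
    rw [pow_one, pow_one] at this
    exact this.symm

open Function in
/-- The logarithmic derivative of `y` is a multiple, with coefficient of valuation at most one, of
the logarithmic derivative of `x - c` for some constant `c`. -/
theorem exists_valuation_sub_mul_derivation_le {Γ₀ : Type*} [LinearOrderedCommGroupWithZero Γ₀]
    (v : Valuation K Γ₀) (D : Derivation L K K) {x : K} (hD : D x = 1) (n : ℕ) :
    ∀ y ∈ L⟮x⟯, D^[n] y = 0 → ∃ c : L, v (x - algebraMap L K c) * v (D y) ≤ v y := by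
  induction n with
  | zero =>
    intro y _ hy
    exact ⟨0, by simp [show y = 0 from hy]⟩
  | succ n ih =>
    intro y hyx hy
    by_contra! hcon
    have hDy : D y ≠ 0 := by
      intro h0
      have := hcon 0
      simp [h0] at this
    have hy0 : y ≠ 0 := by
      rintro rfl
      exact hDy (map_zero D)
    set h := y / D y with hh
    have hh0 : h ≠ 0 := div_ne_zero hy0 hDy
    have hvD : 0 < v (D y) := by simpa [zero_lt_iff] using hDy
    have hvh : ∀ c : L, v h < v (x - algebraMap L K c) := fun c => by
      rw [hh, map_div₀, div_lt_iff₀ hvD]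
      exact hcon c
    set q : ℕ → K := fun j => h ^ j * D^[j + 1] y / D y with hq
    have hqv : ∀ j, v (q j) ≤ 1 := by
      intro j
      induction j with
      | zero => simp [hq, hDy]
      | succ j ihj =>
        obtain ⟨c, hc⟩ := ih (D^[j + 1] y) (derivation_iterate_mem hp hL D hD hyx _) (by
          rw [← iterate_add_apply, add_comm j 1, ← add_assoc, add_comm, iterate_add_apply, hy,
            iterate_map_zero])
        refine le_trans ?_ ihj
        simp only [hq, map_div₀, map_mul, map_pow]
        refine div_le_div_of_nonneg_right ?_ hvD.le
        rw [pow_succ, mul_assoc]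
        refine mul_le_mul_right ?_ _
        rw [iterate_succ_apply' _ (j + 1)]
        exact (mul_le_mul_left (hvh c).le _).trans hc
    set E : Derivation L K K := h • D with hE
    have hEapp : ∀ u, E u = h * D u := fun u => rfl
    have hEy : E y = y := by rw [hEapp, hh, div_mul_cancel₀ _ hDy]
    have hEx : E x = h := by rw [hEapp, hD, mul_one]
    have hEh : E h = h * (1 - q 1) := by
      rw [hEapp]
      congr 1
      rw [hh, Derivation.leibniz_div]
      simp only [hq, smul_eq_mul, pow_one, iterate_succ_apply', iterate_zero, id, hh]
      field_simp
    have hEq : ∀ j, E (q j) = q (j + 1) + j * q j - (j + 1) * q j * q 1 := by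
      intro j
      have hEhj : E (h ^ j) = j * h ^ j * (1 - q 1) := by
        rw [Derivation.leibniz_pow, hEh, ← Nat.cast_smul_eq_nsmul K]
        rcases j with _ | j
        · simp
        · simp only [smul_eq_mul, Nat.add_sub_cancel, pow_succ]
          ring
      have hE1 : E (D y) = q 1 * D y := by
        rw [hEapp]
        simp only [hq, pow_one, iterate_succ_apply', iterate_zero, id]
        field_simp
      have hEj : h ^ j * E (D^[j + 1] y) = q (j + 1) * D y := by
        rw [hEapp]
        simp only [hq, iterate_succ_apply' _ (j + 1), pow_succ]
        field_simp
      have hqj : h ^ j * D^[j + 1] y = q j * D y := by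
        simp only [hq]
        field_simp
      have key : E (q j * D y) = E (h ^ j * D^[j + 1] y) := by rw [hqj]
      simp only [Derivation.leibniz, smul_eq_mul, hEhj, hEj, hE1] at key
      refine mul_left_cancel₀ hDy ?_
      linear_combination key + j * (1 - q 1) * hqj
    set A := Subring.closure (Set.range q) with hA
    have hAq : ∀ j, q j ∈ A := fun j => Subring.subset_closure ⟨j, rfl⟩
    have hAv : ∀ a ∈ A, v a ≤ 1 := by
      have : A ≤ v.integer := Subring.closure_le.2 (by rintro _ ⟨j, rfl⟩; exact hqv j)
      exact this
    have hAE : ∀ a ∈ A, E a ∈ A := by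
      intro a ha
      induction ha using Subring.closure_induction with
      | mem a ha =>
        obtain ⟨j, rfl⟩ := ha
        rw [hEq]
        exact sub_mem (add_mem (hAq _) (mul_mem (natCast_mem A j) (hAq _)))
          (mul_mem (mul_mem (add_mem (natCast_mem A j) (one_mem A)) (hAq _)) (hAq _))
      | zero => rw [map_zero]; exact zero_mem A
      | one => rw [Derivation.map_one_eq_zero]; exact zero_mem A
      | add a b _ _ ha hb => rw [map_add]; exact add_mem ha hb
      | neg a _ ha => rw [map_neg]; exact neg_mem ha
      | mul a b ha' hb' ha hb =>
        rw [Derivation.leibniz]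
        exact add_mem (mul_mem ha' hb) (mul_mem hb' ha)
    have hit : ∀ k, ∃ a ∈ A, E^[k + 1] x = h * a := by
      intro k
      induction k with
      | zero => exact ⟨1, one_mem A, by simp [hEx]⟩
      | succ k ihk =>
        obtain ⟨a, ha, hk⟩ := ihk
        refine ⟨(1 - q 1) * a + E a,
          add_mem (mul_mem (sub_mem (one_mem A) (hAq 1)) ha) (hAE a ha), ?_⟩
        rw [iterate_succ_apply', hk, Derivation.leibniz, hEh]
        simp only [smul_eq_mul]
        ring
    obtain ⟨a, ha, hk⟩ := hit (p - 2)
    have hp2 := hp.two_le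
    rw [show p - 2 + 1 = p - 1 by omega] at hk
    have hxx : x ∈ L⟮x⟯ := IntermediateField.mem_adjoin_simple_self L x
    have hhx : h ∈ L⟮x⟯ := div_mem hyx (derivation_apply_mem hp hL D hD hyx)
    have hEmem : ∀ k, E^[k] x ∈ L⟮x⟯ := by
      intro k
      induction k with
      | zero => exact hxx
      | succ k ihk =>
        rw [iterate_succ_apply']
        exact mul_mem hhx (derivation_apply_mem hp hL D hD ihk)
    have hE0 : E (x - E^[p - 1] x) = 0 := by
      rw [map_sub, ← iterate_succ_apply' E, show (p - 1).succ = p by omega,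
        derivation_iterate_char_eq_self hp hL E hEy hy0 hyx hxx, sub_self]
    obtain ⟨c, hc⟩ := eq_zero_of_derivation_apply_eq_zero hp hL D hD (sub_mem hxx (hEmem (p - 1)))
      ((mul_eq_zero.1 hE0).resolve_left hh0)
    have := hvh c
    rw [hc, sub_sub_cancel, hk, map_mul] at this
    exact absurd (mul_le_of_le_one_right' (hAv a ha)) this.not_ge

open Function in
theorem exists_forall_valuation_sub_pow_mul_iterate_le_one {Γ₀ : Type*}
    [LinearOrderedCommGroupWithZero Γ₀] (v : Valuation K Γ₀) (D : Derivation L K K) {x : K}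
    (hD : D x = 1) (S : Finset K) (hS : ∀ y ∈ S, y ∈ L⟮x⟯ ∧ v y ≤ 1) :
    ∃ c : L, ∀ y ∈ S, ∀ j, v ((x - algebraMap L K c) ^ j * D^[j] y) ≤ 1 := by
  have hex : ∀ (y : K) (j : ℕ), ∃ c : L, y ∈ S →
      v (x - algebraMap L K c) * v (D^[j + 1] y) ≤ v (D^[j] y) := by
    intro y j
    by_cases hy : y ∈ S
    · obtain ⟨c, hc⟩ := exists_valuation_sub_mul_derivation_le hp hL v D hD p (D^[j] y)
        (derivation_iterate_mem hp hL D hD (hS y hy).1 j)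
        (derivation_iterate_char_eq_zero hp hL D hD
          (derivation_iterate_mem hp hL D hD (hS y hy).1 j))
      exact ⟨c, fun _ => by rwa [iterate_succ_apply']⟩
    · exact ⟨0, fun h => absurd h hy⟩
  choose c hc using hex
  classical
  obtain ⟨c₀, -, hc₀⟩ := Finset.exists_min_image
    (insert 0 ((S ×ˢ Finset.range p).image fun q => c q.1 q.2))
    (fun a => v (x - algebraMap L K a)) ⟨0, Finset.mem_insert_self _ _⟩
  refine ⟨c₀, fun y hy j => ?_⟩
  induction j with
  | zero => simpa using (hS y hy).2
  | succ j ih =>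
    by_cases hj : j < p
    · refine le_trans ?_ ih
      have h1 : v (x - algebraMap L K c₀) ≤ v (x - algebraMap L K (c y j)) :=
        hc₀ _ (Finset.mem_insert_of_mem (Finset.mem_image.2
          ⟨(y, j), Finset.mem_product.2 ⟨hy, Finset.mem_range.2 hj⟩, rfl⟩))
      simp only [map_mul, map_pow]
      rw [pow_succ, mul_assoc]
      exact mul_le_mul_right ((mul_le_mul_left h1 _).trans (hc y j hy)) _
    · obtain ⟨k, rfl⟩ := Nat.exists_eq_add_of_le (not_lt.1 hj)
      rw [show p + k + 1 = (k + 1) + p by ring, iterate_add_apply _ (k + 1) p,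
        derivation_iterate_char_eq_zero hp hL D hD (hS y hy).1, iterate_map_zero, mul_zero,
        map_zero]
      exact zero_le_one

omit [CharP K p] hp hL in
open Function in
theorem derivation_iterate_algebraMap_mul_pow (D : Derivation L K K) {x : K} (hD : D x = 1)
    (a : L) (n j : ℕ) : D^[j] (algebraMap L K a * x ^ n) =
      n.descFactorial j * (algebraMap L K a * x ^ (n - j)) := by
  induction j with
  | zero => simp
  | succ j ih =>
    rw [iterate_succ_apply', ih, Nat.descFactorial_succ, Derivation.leibniz, Derivation.leibniz,
      Derivation.leibniz_pow, hD, Derivation.map_algebraMap, Derivation.map_natCast,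
      ← Nat.cast_smul_eq_nsmul K, Nat.sub_sub]
    simp only [smul_eq_mul, Nat.cast_mul]
    ring

omit hL in
theorem exists_natCast_mul_factorial_eq_one {n : ℕ} (hn : n < p) :
    ∃ m : ℕ, (m : K) * n.factorial = 1 := by
  have : Fact p.Prime := ⟨hp⟩
  have h0 : (n.factorial : K) ≠ 0 := by
    rw [Ne, CharP.cast_eq_zero_iff K p, hp.dvd_factorial]
    omega
  have h1 : (n.factorial : K) ^ p = n.factorial := by
    rw [← frobenius_def, map_natCast]
  refine ⟨n.factorial ^ (p - 2), mul_right_cancel₀ h0 ?_⟩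
  rw [Nat.cast_pow, ← pow_succ, ← pow_succ, one_mul]
  have := hp.two_le
  rwa [show p - 2 + 1 + 1 = p by omega]

open Function in
theorem mem_closure_monomials {Γ₀ : Type*} [LinearOrderedCommGroupWithZero Γ₀]
    (v : Valuation K Γ₀) (D : Derivation L K K) {x : K} (hD : D x = 1) (n : ℕ) (hn : n ≤ p) :
    ∀ y ∈ L⟮x⟯, (∀ j, v (x ^ j * D^[j] y) ≤ 1) → D^[n] y = 0 →
      y ∈ AddSubmonoid.closure {m | v m ≤ 1 ∧ ∃ (a : L) (i : ℕ), m = algebraMap L K a * x ^ i} := by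
  have hnat : ∀ m : ℕ, v (m : K) ≤ 1 := natCast_mem v.integer
  induction n with
  | zero =>
    intro y _ _ hy
    rw [show y = 0 from hy]
    exact zero_mem _
  | succ n ih =>
    intro y hyx hyv hy
    obtain ⟨m, hm⟩ := exists_natCast_mul_factorial_eq_one (K := K) hp (n := n) (by omega)
    obtain ⟨a, ha⟩ := eq_zero_of_derivation_apply_eq_zero hp hL D hD
      (derivation_iterate_mem hp hL D hD hyx n) (by rwa [iterate_succ_apply'] at hy)
    have hmon := derivation_iterate_algebraMap_mul_pow D hD (m * a) n
    have hv : v (algebraMap L K (m * a) * x ^ n) ≤ 1 := by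
      rw [map_mul (algebraMap L K), map_natCast, ha, mul_assoc, mul_comm _ (x ^ n), map_mul v]
      exact mul_le_one' (hnat m) (hyv n)
    have hsplit : y = (y - algebraMap L K (m * a) * x ^ n) + algebraMap L K (m * a) * x ^ n := by
      ring
    rw [hsplit]
    refine add_mem (ih (by omega) _ ?_ ?_ ?_) (AddSubmonoid.subset_closure ⟨hv, _, _, rfl⟩)
    · exact sub_mem hyx (mul_mem (IntermediateField.algebraMap_mem _ _)
        (pow_mem (IntermediateField.mem_adjoin_simple_self L x) n))
    · intro j
      rw [iterate_map_sub, hmon, mul_sub]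
      refine v.map_sub_le (hyv j) ?_
      by_cases hj : j ≤ n
      · have : x ^ j * (n.descFactorial j * (algebraMap L K (m * a) * x ^ (n - j))) =
            n.descFactorial j * (algebraMap L K (m * a) * x ^ n) := by
          rw [← Nat.add_sub_cancel' hj, pow_add, Nat.add_sub_cancel' hj]
          ring
        rw [this, map_mul]
        exact mul_le_one' (hnat _) hv
      · rw [Nat.descFactorial_eq_zero_iff_lt.2 (by omega)]
        simp
    · rw [iterate_map_sub, hmon, Nat.descFactorial_self, Nat.sub_self, map_mul, map_natCast, ha,
        pow_zero, mul_one, ← mul_assoc, mul_comm _ (m : K), hm, one_mul, sub_self]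

section
variable {Γ₀ : Type*} [LinearOrderedCommGroupWithZero Γ₀] (v : Valuation K Γ₀)

/-- The subring generated by `z` and the valuation ring of `v` on the base field `L`. -/
def integersAdjoin (L : Type*) [Field L] [Algebra L K] (z : K) : Subring K :=
  Subring.closure (insert z {y | y ∈ (algebraMap L K).range ∧ v y ≤ 1})

/-- The integral monomials in `x` over `L` whose exponent is prime to `p`. -/
def integralMonomials (L : Type*) [Field L] [Algebra L K] (p : ℕ) (x : K) : Set K :=
  {m | v m ≤ 1 ∧ ∃ (a : L) (i : ℕ), a ≠ 0 ∧ ¬ p ∣ i ∧ m = algebraMap L K a * x ^ i}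

omit [CharP K p] hp hL in
theorem self_mem_integersAdjoin (z : K) : z ∈ integersAdjoin v L z :=
  Subring.subset_closure (Set.mem_insert _ _)

omit [CharP K p] hp hL in
theorem algebraMap_mem_integersAdjoin (z : K) {b : L} (hb : v (algebraMap L K b) ≤ 1) :
    algebraMap L K b ∈ integersAdjoin v L z :=
  Subring.subset_closure (Set.mem_insert_of_mem _ ⟨⟨b, rfl⟩, hb⟩)

omit [CharP K p] hp hL in
theorem integersAdjoin_le {z z' : K} (h : z ∈ integersAdjoin v L z') :
    integersAdjoin v L z ≤ integersAdjoin v L z' :=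
  Subring.closure_le.2 (Set.insert_subset h fun _ hy =>
    Subring.subset_closure (Set.mem_insert_of_mem _ hy))

omit [CharP K p] in
theorem exists_eq_mul_pow_of_mem_integralMonomials {x : K} (hx : x ≠ 0) {m m' : K}
    (hm : m ∈ integralMonomials v L p x) (hm' : m' ∈ integralMonomials v L p x) :
    ∃ (s : ℕ) (b : L), s < p ∧ b ≠ 0 ∧ m = algebraMap L K b * m' ^ s := by
  obtain ⟨-, a, i, ha, hi, rfl⟩ := hm
  obtain ⟨-, a', i', ha', hi', rfl⟩ := hm'
  have : Fact p.Prime := ⟨hp⟩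
  obtain ⟨e, he⟩ := hL x
  have he0 : e ≠ 0 := by
    rintro rfl
    rw [map_zero] at he
    exact pow_ne_zero p hx he.symm
  set s := ((i : ZMod p) / (i' : ZMod p)).val with hs
  have hmod : ((i : ℤ) : ZMod p) = ((i' * s : ℤ) : ZMod p) := by
    have : (i' : ZMod p) ≠ 0 := by rwa [Ne, ZMod.natCast_eq_zero_iff]
    push_cast
    rw [hs, ZMod.natCast_zmod_val]
    field_simp
  obtain ⟨k, hk⟩ := ((ZMod.intCast_eq_intCast_iff_dvd_sub _ _ p).1 hmod.symm)
  refine ⟨s, a / a' ^ s * e ^ k, ZMod.val_lt _,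
    mul_ne_zero (div_ne_zero ha (pow_ne_zero _ ha')) (zpow_ne_zero _ he0), ?_⟩
  have ha'K : algebraMap L K a' ≠ 0 := by simpa using ha'
  rw [map_mul, map_div₀, map_pow, map_zpow₀, he, mul_pow, ← zpow_natCast x p, ← zpow_mul, ← hk,
    ← pow_mul, ← zpow_natCast x (i' * s), ← zpow_natCast x i]
  have : x ^ (i : ℤ) = x ^ ((i : ℤ) - i' * s) * x ^ ((i' * s : ℕ) : ℤ) := by
    rw [← zpow_add₀ hx]
    congr 1
    push_cast
    ring
  rw [this]
  field_simp

omit [CharP K p] in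
theorem mem_integersAdjoin_of_le_pow {x : K} (hx : x ≠ 0) {m z : K}
    (hm : m ∈ integralMonomials v L p x) (hz : z ∈ integralMonomials v L p x)
    (h : v m ≤ v z ^ p) : m ∈ integersAdjoin v L z := by
  obtain ⟨s, b, hs, hb, rfl⟩ := exists_eq_mul_pow_of_mem_integralMonomials hp hL v hx hm hz
  have hz0 : z ≠ 0 := by
    obtain ⟨-, a, i, ha, -, rfl⟩ := hz
    exact mul_ne_zero (by simpa using ha) (pow_ne_zero _ hx)
  have hvz : 0 < v z ^ s := by simpa [zero_lt_iff] using fun h => absurd h hz0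
  refine mul_mem (algebraMap_mem_integersAdjoin v z ?_) (pow_mem (self_mem_integersAdjoin v z) s)
  rw [map_mul, map_pow] at h
  refine le_of_mul_le_mul_right ?_ hvz
  rw [one_mul]
  exact h.trans (pow_le_pow_right_of_le_one' hz.1 hs.le)

omit [CharP K p] in
/-- A step of the Euclidean algorithm on the values of monomials. -/
theorem mem_integersAdjoin_or_exists_eq_mul_pow {x : K} (hx : x ≠ 0) {m m' : K}
    (hm : m ∈ integralMonomials v L p x) (hm' : m' ∈ integralMonomials v L p x)
    (h : v m ≤ v m') : m ∈ integersAdjoin v L m' ∨ ∃ u ∈ integralMonomials v L p x,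
      v m' ≤ v u ∧ v m ≤ v m' * v u ∧ ∃ k : ℕ, m = u * m' ^ k := by
  obtain ⟨s, b, hs, hb, hmb⟩ := exists_eq_mul_pow_of_mem_integralMonomials hp hL v hx hm hm'
  have hm0 : m' ≠ 0 := by
    obtain ⟨-, a, i, ha, -, rfl⟩ := hm'
    exact mul_ne_zero (by simpa using ha) (pow_ne_zero _ hx)
  have hvm : ∀ s, 0 < v m' ^ s := fun s => by simpa [zero_lt_iff] using fun h => absurd h hm0
  by_cases hle : v m ≤ v m' ^ s
  · left
    rw [hmb]
    refine mul_mem (algebraMap_mem_integersAdjoin v m' ?_)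
      (pow_mem (self_mem_integersAdjoin v m') s)
    rw [hmb, map_mul, map_pow] at hle
    exact le_of_mul_le_mul_right (by rwa [one_mul]) (hvm s)
  · right
    classical
    have hex : ∃ k, ¬ v m ≤ v m' ^ k := ⟨s, hle⟩
    obtain ⟨k, hk⟩ : ∃ k, Nat.find hex = k + 1 + 1 := by
      have h0 : Nat.find hex ≠ 0 := fun h0 => by
        have := Nat.find_spec hex
        rw [h0] at this
        exact this (by simpa using hm.1)
      have h1 : Nat.find hex ≠ 1 := fun h0 => by
        have := Nat.find_spec hex
        rw [h0] at this
        exact this (by simpa using h)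
      exact ⟨Nat.find hex - 2, by omega⟩
    have hks : k + 1 < s := by
      have := Nat.find_min' hex hle
      omega
    have hk1 : v m ≤ v m' ^ (k + 1) := not_not.1 (Nat.find_min hex (m := k + 1) (by omega))
    have hk2 : v m' ^ (k + 1 + 1) < v m := not_le.1 (hk ▸ Nat.find_spec hex)
    have hmu : m = (algebraMap L K b * m' ^ (s - (k + 1))) * m' ^ (k + 1) := by
      rw [mul_assoc, ← pow_add, Nat.sub_add_cancel hks.le]
      exact hmb
    set u := algebraMap L K b * m' ^ (s - (k + 1)) with hu
    have hvu : v m = v u * v m' ^ (k + 1) := by rw [hmu, map_mul, map_pow]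
    have hvu1 : v u ≤ 1 := by
      rw [hvu] at hk1
      exact le_of_mul_le_mul_right (by rwa [one_mul]) (hvm (k + 1))
    have hvu2 : v m' ≤ v u := by
      rw [hvu, pow_succ' _ (k + 1)] at hk2
      exact (lt_of_mul_lt_mul_right hk2 (hvm _).le).le
    refine ⟨u, ⟨hvu1, ?_⟩, hvu2, ?_, k + 1, hmu⟩
    · obtain ⟨-, a, i, ha, hi, rfl⟩ := hm'
      refine ⟨b * a ^ (s - (k + 1)), i * (s - (k + 1)), mul_ne_zero hb (pow_ne_zero _ ha),
        fun hd => ?_, ?_⟩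
      · rcases hp.dvd_mul.1 hd with hd | hd
        · exact hi hd
        · exact absurd (Nat.le_of_dvd (by omega) hd) (by omega)
      · rw [hu, mul_pow, map_mul, map_pow, pow_mul, mul_assoc]
    · rw [hvu, mul_comm, pow_succ']
      refine mul_le_mul_left ?_ _
      exact mul_le_of_le_one_right' (pow_le_one' hm'.1 k)

omit [CharP K p] in
theorem exists_mem_integersAdjoin_or_le_pow {x : K} (hx : x ≠ 0) (w : Γ₀) (n : ℕ) :
    ∀ a b : ℕ, 1 ≤ a → p ≤ n + (a + b) → ∀ m ∈ integralMonomials v L p x,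
      ∀ m' ∈ integralMonomials v L p x, v m ≤ v m' → w ≤ v m ^ a * v m' ^ b →
      ∃ z ∈ integralMonomials v L p x,
        (m ∈ integersAdjoin v L z ∧ m' ∈ integersAdjoin v L z) ∨ w ≤ v z ^ p := by
  induction n with
  | zero =>
    intro a b ha hab m hm m' hm' hmm hw
    refine ⟨m', hm', Or.inr (hw.trans ?_)⟩
    calc v m ^ a * v m' ^ b ≤ v m' ^ a * v m' ^ b :=
          mul_le_mul_left (pow_le_pow_left' hmm a) _
      _ = v m' ^ (a + b) := (pow_add _ _ _).symm
      _ ≤ v m' ^ p := pow_le_pow_right_of_le_one' hm'.1 (by omega)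
  | succ n ih =>
    intro a b ha hab m hm m' hm' hmm hw
    rcases mem_integersAdjoin_or_exists_eq_mul_pow hp hL v hx hm hm' hmm with h | h
    · exact ⟨m', hm', Or.inl ⟨h, self_mem_integersAdjoin v m'⟩⟩
    · obtain ⟨u, hu, hmu, hvu, k, hk⟩ := h
      obtain ⟨z, hz, h⟩ := ih (a + b) a (by omega) (by omega) m' hm' u hu hmu (hw.trans (by
        calc v m ^ a * v m' ^ b ≤ (v m' * v u) ^ a * v m' ^ b :=
              mul_le_mul_left (pow_le_pow_left' hvu a) _
          _ = v m' ^ (a + b) * v u ^ a := by rw [mul_pow, pow_add, mul_right_comm]))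
      refine ⟨z, hz, h.imp_left fun h => ⟨?_, h.1⟩⟩
      rw [hk]
      exact mul_mem h.2 (pow_mem h.1 k)

omit [CharP K p] in
theorem exists_mem_integersAdjoin_of_le {x : K} (hx : x ≠ 0) {m m' : K}
    (hm : m ∈ integralMonomials v L p x) (hm' : m' ∈ integralMonomials v L p x)
    (h : v m ≤ v m') : ∃ z ∈ integralMonomials v L p x,
      m ∈ integersAdjoin v L z ∧ m' ∈ integersAdjoin v L z := by
  rcases mem_integersAdjoin_or_exists_eq_mul_pow hp hL v hx hm hm' h with h' | h'
  · exact ⟨m', hm', h', self_mem_integersAdjoin v m'⟩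
  · obtain ⟨u, hu, hmu, -, k, hk⟩ := h'
    obtain ⟨z, hz, h'⟩ := exists_mem_integersAdjoin_or_le_pow hp hL v hx (v m') p 1 0 le_rfl
      (by omega) m' hm' u hu hmu (by simp)
    refine ⟨z, hz, ?_⟩
    rcases h' with h' | h'
    · refine ⟨?_, h'.1⟩
      rw [hk]
      exact mul_mem h'.2 (pow_mem h'.1 k)
    · exact ⟨mem_integersAdjoin_of_le_pow hp hL v hx hm hz (h.trans h'),
        mem_integersAdjoin_of_le_pow hp hL v hx hm' hz h'⟩

omit [CharP K p] in
theorem exists_forall_mem_integersAdjoin {x : K} (hx : x ≠ 0) (S : Finset K)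
    (hS : ∀ m ∈ S, m ∈ integralMonomials v L p x) :
    ∃ z ∈ integralMonomials v L p x, ∀ m ∈ S, m ∈ integersAdjoin v L z := by
  classical
  induction S using Finset.induction_on with
  | empty =>
    have hp2 := hp.two_le
    rcases le_total (v x) 1 with h | h
    · exact ⟨x, ⟨h, 1, 1, one_ne_zero, fun h => by have := Nat.le_of_dvd one_pos h; omega, by simp⟩,
        by simp⟩
    · obtain ⟨e, he⟩ := hL x
      have he0 : e ≠ 0 := by
        rintro rfl
        rw [map_zero] at he
        exact pow_ne_zero p hx he.symm
      refine ⟨x⁻¹, ⟨?_, e⁻¹, p - 1, inv_ne_zero he0,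
        fun h => by have := Nat.le_of_dvd (by omega) h; omega, ?_⟩, by simp⟩
      · rw [map_inv₀]
        exact inv_le_one_of_one_le₀ h
      · rw [map_inv₀, he, eq_inv_mul_iff_mul_eq₀ (pow_ne_zero _ hx), mul_inv_eq_iff_eq_mul₀ hx,
          ← pow_succ]
        congr 1
        omega
  | insert m S hmS ih =>
    obtain ⟨z, hz, hzS⟩ := ih fun m hm => hS m (Finset.mem_insert_of_mem hm)
    have hm := hS m (Finset.mem_insert_self _ _)
    obtain ⟨z', hz', h1, h2⟩ : ∃ z' ∈ integralMonomials v L p x,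
        m ∈ integersAdjoin v L z' ∧ z ∈ integersAdjoin v L z' := by
      rcases le_total (v m) (v z) with h | h
      · exact exists_mem_integersAdjoin_of_le hp hL v hx hm hz h
      · obtain ⟨z', hz', h1, h2⟩ := exists_mem_integersAdjoin_of_le hp hL v hx hz hm h
        exact ⟨z', hz', h2, h1⟩
    refine ⟨z', hz', fun y hy => ?_⟩
    rcases Finset.mem_insert.1 hy with rfl | hy
    · exact h1
    · exact integersAdjoin_le v h2 (hzS y hy)

theorem exists_finset_forall_mem_integersAdjoin {x : K} (hx : x ∉ (algebraMap L K).range)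
    (S : Finset K) (hS : ∀ y ∈ S, y ∈ L⟮x⟯ ∧ v y ≤ 1) :
    ∃ z ∈ L⟮x⟯, z ∉ (algebraMap L K).range ∧ v z ≤ 1 ∧ ∀ y ∈ S, y ∈ integersAdjoin v L z := by
  classical
  obtain ⟨D, hD⟩ := exists_derivation_apply_eq_one hp hL hx
  obtain ⟨c, hc⟩ := exists_forall_valuation_sub_pow_mul_iterate_le_one hp hL v D hD S hS
  set t := x - algebraMap L K c with ht
  have hDt : D t = 1 := by rw [ht, map_sub, hD, Derivation.map_algebraMap, sub_zero]
  have ht0 : t ≠ 0 := by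
    intro h
    rw [h, map_zero] at hDt
    exact zero_ne_one hDt
  have htx : t ∈ L⟮x⟯ :=
    sub_mem (IntermediateField.mem_adjoin_simple_self L x) (IntermediateField.algebraMap_mem _ c)
  have hxt : L⟮x⟯ ≤ L⟮t⟯ := by
    rw [IntermediateField.adjoin_simple_le_iff]
    have := add_mem (IntermediateField.mem_adjoin_simple_self L t)
      (IntermediateField.algebraMap_mem L⟮t⟯ c)
    rwa [ht, sub_add_cancel] at this
  have hfin : ∀ y, ∃ T : Finset K, y ∈ S → (∀ m ∈ T, m ∈ integralMonomials v L p t) ∧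
      ∀ z, (∀ m ∈ T, m ∈ integersAdjoin v L z) → y ∈ integersAdjoin v L z := by
    intro y
    by_cases hy : y ∈ S
    swap
    · exact ⟨∅, fun h => absurd h hy⟩
    suffices h : ∃ T : Finset K, (∀ m ∈ T, m ∈ integralMonomials v L p t) ∧
        ∀ z, (∀ m ∈ T, m ∈ integersAdjoin v L z) → y ∈ integersAdjoin v L z from
      h.imp fun _ h _ => h
    have hcl := mem_closure_monomials hp hL v D hDt p le_rfl y (hxt (hS y hy).1) (hc y hy)
      (derivation_iterate_char_eq_zero hp hL D hD (hS y hy).1)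
    clear hy
    induction hcl using AddSubmonoid.closure_induction with
    | mem m hm =>
      obtain ⟨hv, a, i, rfl⟩ := hm
      by_cases ha : a = 0
      · exact ⟨∅, by simp, fun z _ => by simp [ha, zero_mem]⟩
      by_cases hi : p ∣ i
      · obtain ⟨k, rfl⟩ := hi
        obtain ⟨e, he⟩ := hL t
        rw [pow_mul, ← he, ← map_pow, ← map_mul] at hv ⊢
        exact ⟨∅, by simp, fun z _ => algebraMap_mem_integersAdjoin v z hv⟩
      · exact ⟨{algebraMap L K a * t ^ i}, by simpa using ⟨hv, a, i, ha, hi, rfl⟩, by simp⟩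
    | zero => exact ⟨∅, by simp, fun z _ => zero_mem _⟩
    | add y y' _ _ h h' =>
      obtain ⟨T, hT, hT'⟩ := h
      obtain ⟨U, hU, hU'⟩ := h'
      refine ⟨T ∪ U, fun m hm => (Finset.mem_union.1 hm).elim (hT m) (hU m), fun z hz => ?_⟩
      exact add_mem (hT' z fun m hm => hz m (Finset.mem_union_left _ hm))
        (hU' z fun m hm => hz m (Finset.mem_union_right _ hm))
  choose T hT using hfin
  obtain ⟨z, hz, hzT⟩ := exists_forall_mem_integersAdjoin hp hL v ht0 (S.biUnion T) (by
    intro m hm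
    obtain ⟨y, hy, hm⟩ := Finset.mem_biUnion.1 hm
    exact (hT y hy).1 m hm)
  refine ⟨z, ?_, ?_, hz.1, fun y hy => (hT y hy).2 z fun m hm =>
    hzT m (Finset.mem_biUnion.2 ⟨y, hy, hm⟩)⟩
  · obtain ⟨-, a, i, -, -, rfl⟩ := hz
    exact mul_mem (IntermediateField.algebraMap_mem _ a) (pow_mem htx i)
  · rintro ⟨b, rfl⟩
    obtain ⟨-, a, i, ha, hi, hb⟩ := hz
    have h0 := derivation_iterate_algebraMap_mul_pow D hDt a i 1
    rw [Function.iterate_one, ← hb, Derivation.map_algebraMap, Nat.descFactorial_one] at h0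
    refine mul_ne_zero ?_ (mul_ne_zero (by simpa using ha) (pow_ne_zero _ ht0)) h0.symm
    rwa [Ne, CharP.cast_eq_zero_iff K p]

end

end

section Kaehler

open KaehlerDifferential

theorem KaehlerDifferential.D_pow_char_eq_zero {p : ℕ} (R A : Type*) [CommRing R] [CommRing A]
    [Algebra R A] [CharP A p] (a : A) : D R A (a ^ p) = 0 := by
  rw [Derivation.leibniz_pow, ← Nat.cast_smul_eq_nsmul A, CharP.cast_eq_zero, zero_smul]

variable {p : ℕ} (hp : p.Prime) {E K : Type*} [CommRing E] [IsDomain E] [ValuationRing E]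
  [CharP E p] [Algebra (ZMod p) E] [Field K] [Algebra E K] [IsFractionRing E K]

/-- The submodule of differentials generated by the elements of `E` lying in a subfield. -/
noncomputable def differentialsOf (p : ℕ) (E : Type*) {K : Type*} [CommRing E] [Algebra (ZMod p) E]
    [Field K] [Algebra E K] {k : Type*} [Field k] [Algebra k K] (L : IntermediateField k K) :
    Submodule E (Ω[E⁄ZMod p]) :=
  Submodule.span E (D (ZMod p) E '' {a | algebraMap E K a ∈ L})

omit [IsDomain E] [ValuationRing E] [CharP E p] [IsFractionRing E K] in
/-- A derivation of the fraction field induces a linear map on the differentials of `E`. -/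
theorem exists_linearMap_apply_D {L : Type*} [Field L] [Algebra L K] (d : Derivation L K K) :
    ∃ φ : Ω[E⁄ZMod p] →ₗ[E] K, ∀ a, φ (D (ZMod p) E a) = d (algebraMap E K a) := by
  let : Algebra (ZMod p) K := ((algebraMap E K).comp (algebraMap (ZMod p) E)).toAlgebra
  have : IsScalarTower (ZMod p) E K := IsScalarTower.of_algebraMap_eq fun _ => rfl
  let f : E →+ K := (d : K →+ K).comp (algebraMap E K : E →+ K)
  let d' : Derivation (ZMod p) E K := Derivation.mk' (f.toZModLinearMap p) (by
    intro a b
    change d (algebraMap E K (a * b)) = a • d (algebraMap E K b) + b • d (algebraMap E K a)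
    rw [map_mul, Derivation.leibniz, smul_eq_mul, smul_eq_mul, Algebra.smul_def,
      Algebra.smul_def])
  exact ⟨d'.liftKaehlerDifferential, fun a => d'.liftKaehlerDifferential_comp_D a⟩

include hp

theorem eq_zero_of_smul_eq_zero_of_mem_adjoin {k : Type*} [Field k] [Algebra k K]
    (hk : ∀ y : K, y ^ p ∈ (algebraMap k K).range) {a : E} (ha : a ≠ 0)
    (L : IntermediateField k K) (x : K)
    (ih : ∀ ω ∈ differentialsOf p E L, a • ω = 0 → ω = 0) :
    ∀ ω ∈ differentialsOf p E (L⟮x⟯.restrictScalars k), a • ω = 0 → ω = 0 := by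
  classical
  intro ω hω haω
  have : CharP K p := charP_of_injective_algebraMap (IsFractionRing.injective E K) p
  have hL : ∀ y : K, y ^ p ∈ (algebraMap L K).range := by
    intro y
    obtain ⟨b, hb⟩ := hk y
    exact ⟨algebraMap k L b, hb⟩
  have hr : ∀ y : K, y ∈ (algebraMap L K).range ↔ y ∈ L := fun y =>
    ⟨by rintro ⟨z, rfl⟩; exact z.2, fun h => ⟨⟨y, h⟩, rfl⟩⟩
  by_cases hx : x ∈ (algebraMap L K).range
  · refine ih ω ?_ haω
    have hbot : L⟮x⟯ = ⊥ := IntermediateField.adjoin_simple_eq_bot_iff.2 hx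
    refine Submodule.span_mono (Set.image_mono fun b hb => ?_) hω
    have hb' : algebraMap E K b ∈ L⟮x⟯ := hb
    rw [hbot] at hb'
    exact (hr _).1 hb'
  let v := ValuationRing.valuation E K
  have hv : ∀ y, v y ≤ 1 ↔ ∃ b : E, algebraMap E K b = y := fun y =>
    ValuationRing.mem_integer_iff E K y
  obtain ⟨T, hT, hωT⟩ := Submodule.mem_span_finite_of_mem_span hω
  obtain ⟨S, hS, rfl⟩ := Finset.subset_set_image_iff.1 hT
  obtain ⟨z, -, hz, hvz, hzS⟩ := exists_finset_forall_mem_integersAdjoin hp hL v hx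
    (S.image (algebraMap E K)) (by
      intro y hy
      obtain ⟨b, hb, rfl⟩ := Finset.mem_image.1 hy
      exact ⟨hS hb, (hv _).2 ⟨b, rfl⟩⟩)
  obtain ⟨z, rfl⟩ := (hv _).1 hvz
  set W := differentialsOf p E L ⊔ Submodule.span E {D (ZMod p) E z} with hW
  have hmem : ∀ y ∈ integersAdjoin v L (algebraMap E K z),
      ∃ b : E, algebraMap E K b = y ∧ D (ZMod p) E b ∈ W := by
    intro y hy
    induction hy using Subring.closure_induction with
    | mem y hy =>
      rcases hy with rfl | ⟨hy, hvy⟩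
      · exact ⟨z, rfl, Submodule.mem_sup_right (Submodule.mem_span_singleton_self _)⟩
      · obtain ⟨b, rfl⟩ := (hv _).1 hvy
        exact ⟨b, rfl, Submodule.mem_sup_left (Submodule.subset_span ⟨b, (hr _).1 hy, rfl⟩)⟩
    | zero => exact ⟨0, map_zero _, by rw [map_zero]; exact zero_mem W⟩
    | one => exact ⟨1, map_one _, by rw [Derivation.map_one_eq_zero]; exact zero_mem W⟩
    | add y y' _ _ h h' =>
      obtain ⟨b, rfl, hb⟩ := h
      obtain ⟨b', rfl, hb'⟩ := h'
      exact ⟨b + b', map_add _ _ _, by rw [map_add]; exact add_mem hb hb'⟩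
    | neg y _ h =>
      obtain ⟨b, rfl, hb⟩ := h
      exact ⟨-b, map_neg _ _, by rw [map_neg]; exact neg_mem hb⟩
    | mul y y' _ _ h h' =>
      obtain ⟨b, rfl, hb⟩ := h
      obtain ⟨b', rfl, hb'⟩ := h'
      refine ⟨b * b', map_mul _ _ _, ?_⟩
      rw [Derivation.leibniz]
      exact add_mem (W.smul_mem _ hb') (W.smul_mem _ hb)
  have hωW : ω ∈ W := by
    refine Submodule.span_le.2 ?_ hωT
    intro η hη
    obtain ⟨b, hb, rfl⟩ := Finset.mem_image.1 (Finset.mem_coe.1 hη)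
    obtain ⟨b', hb', hW'⟩ := hmem _ (hzS _ (Finset.mem_image_of_mem _ hb))
    rwa [← IsFractionRing.injective E K hb']
  obtain ⟨ω', hω', η, hη, rfl⟩ := Submodule.mem_sup.1 hωW
  obtain ⟨b, rfl⟩ := Submodule.mem_span_singleton.1 hη
  obtain ⟨d, hd⟩ := exists_derivation_apply_eq_one hp hL hz
  obtain ⟨φ, hφ⟩ := exists_linearMap_apply_D (p := p) (E := E) d
  have hφ' : φ ω' = 0 := by
    have hle : differentialsOf p E L ≤ LinearMap.ker φ := by
      refine Submodule.span_le.2 ?_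
      rintro _ ⟨c, hc, rfl⟩
      change φ _ = 0
      rw [hφ]
      exact d.map_algebraMap (⟨_, hc⟩ : L)
    exact hle hω'
  have hb : b = 0 := by
    have := congrArg φ haω
    rw [map_smul, map_add, hφ', map_smul, hφ, hd, zero_add, map_zero, Algebra.smul_def,
      Algebra.smul_def, mul_one, ← map_mul, map_eq_zero_iff _ (IsFractionRing.injective E K)] at this
    exact (mul_eq_zero.1 this).resolve_left ha
  rw [hb, zero_smul, add_zero] at haω ⊢
  exact ih _ hω' haω

/-- Kähler differentials of a valuation ring of characteristic `p` are torsion-free. -/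
theorem KaehlerDifferential.eq_zero_of_smul_eq_zero {a : E} (ha : a ≠ 0) {ω : Ω[E⁄ZMod p]}
    (h : a • ω = 0) : ω = 0 := by
  classical
  let K := FractionRing E
  have : CharP K p := charP_of_injective_algebraMap (IsFractionRing.injective E K) p
  have : Fact p.Prime := ⟨hp⟩
  let k : Subfield K := (frobenius K p).fieldRange
  have hk : ∀ y : K, y ^ p ∈ (algebraMap k K).range := fun y => ⟨⟨y ^ p, y, rfl⟩, rfl⟩
  have hω : ω ∈ Submodule.span E (Set.range (D (ZMod p) E)) := by
    rw [span_range_derivation]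
    trivial
  obtain ⟨T, hT, hωT⟩ := Submodule.mem_span_finite_of_mem_span hω
  rw [← Set.image_univ] at hT
  obtain ⟨S, -, rfl⟩ := Finset.subset_set_image_iff.1 hT
  have key : ∀ ω ∈ differentialsOf p E
      (IntermediateField.adjoin k (S.image (algebraMap E K) : Set K)), a • ω = 0 → ω = 0 := by
    refine IntermediateField.induction_on_adjoin_finset (S.image (algebraMap E K))
      (fun L => ∀ ω ∈ differentialsOf p E L, a • ω = 0 → ω = 0) ?_
      fun L x _ ih => eq_zero_of_smul_eq_zero_of_mem_adjoin hp hk ha L x ih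
    intro η hη _
    suffices hle : differentialsOf p E (⊥ : IntermediateField k K) ≤ ⊥ from
      (Submodule.mem_bot E).1 (hle hη)
    refine Submodule.span_le.2 ?_
    rintro _ ⟨b, hb, rfl⟩
    obtain ⟨⟨_, y, rfl⟩, hy⟩ := IntermediateField.mem_bot.1 hb
    have hy' : y ^ p = algebraMap E K b := hy
    obtain ⟨c, rfl⟩ : ∃ c : E, algebraMap E K c = y :=
      IsIntegrallyClosed.exists_algebraMap_eq_of_isIntegral_pow hp.pos
        (hy' ▸ isIntegral_algebraMap)
    rw [← map_pow] at hy'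
    rw [← IsFractionRing.injective E K hy']
    exact D_pow_char_eq_zero (ZMod p) E c
  refine key ω (Submodule.span_mono ?_ hωT) h
  intro η hη
  obtain ⟨b, hb, rfl⟩ := Finset.mem_image.1 (Finset.mem_coe.1 hη)
  exact ⟨b, IntermediateField.subset_adjoin _ _ (Finset.mem_coe.2 (Finset.mem_image_of_mem _ hb)),
    rfl⟩

end Kaehler

/-- **Theorem 3.3(1)** (Gabber–Ramero): if `C` is a perfect valuation ring of characteristic
`p` and `E` is a valuation ring extension of `C`, then the canonical `E`-linear map
`Ω¹_{E/𝔽p} → Ω¹_{E/C}` is an isomorphism and `Ω¹_{E/C}` is a flat `E`-module. -/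
theorem cartier_smooth_char_p_valuation_rings_differentials
    (p : ℕ) (hp : p.Prime) (C E : Type) [CommRing C] [IsDomain C] [ValuationRing C]
    [CommRing E] [IsDomain E] [ValuationRing E]
    [CharP C p] (hperf : Function.Bijective (fun x : C => x ^ p))
    [Algebra C E] (hinj : Function.Injective (algebraMap C E))
    [Algebra (ZMod p) C] [Algebra (ZMod p) E] [IsScalarTower (ZMod p) C E] :
    Function.Bijective (KaehlerDifferential.map (ZMod p) C E E) ∧
      Module.Flat E (KaehlerDifferential C E) := by
  have : CharP E p := charP_of_injective_algebraMap hinj p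
  have hbij : Function.Bijective (KaehlerDifferential.map (ZMod p) C E E) := by
    refine ⟨?_, KaehlerDifferential.map_surjective (ZMod p) C E⟩
    have hC : ∀ ω : Ω[C⁄ZMod p], ω = 0 := by
      intro ω
      have hω : ω ∈ Submodule.span C (Set.range (KaehlerDifferential.D (ZMod p) C)) := by
        rw [KaehlerDifferential.span_range_derivation]
        trivial
      refine (Submodule.mem_bot C).1 (Submodule.span_le.2 ?_ hω)
      rintro _ ⟨c, rfl⟩
      obtain ⟨b, rfl⟩ := hperf.2 c
      exact KaehlerDifferential.D_pow_char_eq_zero (ZMod p) C b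
    rw [injective_iff_map_eq_zero]
    intro ω hω
    obtain ⟨η, rfl⟩ := (KaehlerDifferential.exact_mapBaseChange_map (ZMod p) C E ω).1 hω
    clear hω
    induction η using TensorProduct.induction_on with
    | zero => rw [map_zero]
    | tmul e ω => rw [hC ω, TensorProduct.tmul_zero, map_zero]
    | add η η' h h' => rw [map_add, h, h', add_zero]
  refine ⟨hbij, ?_⟩
  have : Module.Flat E (Ω[E⁄ZMod p]) := by
    rw [Module.Flat.flat_iff_torsion_eq_bot_of_isBezout, eq_bot_iff]
    rintro ω ⟨a, ha⟩
    exact KaehlerDifferential.eq_zero_of_smul_eq_zero hp (nonZeroDivisors.ne_zero a.2) ha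
  exact Module.Flat.of_linearEquiv (LinearEquiv.ofBijective _ hbij).symm
end

section
/- Let p be a prime number, let E⁺ be a valuation ring of finite rank (only finitely many nonzero prime ideals) with fraction field E, and let M be a torsionfree E⁺-module such that M ⊗_{E⁺} E is a finite-dimensional E-vector space. Then the E⁺/pE⁺-module M/pM has projective dimension at most 1: for every E⁺/pE⁺-module Q and every integer i ≥ 2, Ext^i_{E⁺/pE⁺}(M/pM, Q) = 0. -/
open CategoryTheory

/-- Extensions of countably generated modules are countably generated. -/
theorem Submodule.exists_countable_span_eq_top_of_ker_range {E M N : Type*} [CommRing E]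
    [AddCommGroup M] [Module E M] [AddCommGroup N] [Module E N] (f : M →ₗ[E] N)
    (hker : ∃ s : Set (LinearMap.ker f), s.Countable ∧ Submodule.span E s = ⊤)
    (hrange : ∃ s : Set (LinearMap.range f), s.Countable ∧ Submodule.span E s = ⊤) :
    ∃ s : Set M, s.Countable ∧ Submodule.span E s = ⊤ := by
  obtain ⟨s, hs, hs'⟩ := hker
  obtain ⟨t, ht, ht'⟩ := hrange
  obtain ⟨σ, hσ⟩ := f.surjective_rangeRestrict.hasRightInverse
  refine ⟨Subtype.val '' s ∪ σ '' t, (hs.image _).union (ht.image _), ?_⟩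
  set S := Submodule.span E (Subtype.val '' s ∪ σ '' t)
  have hk : LinearMap.ker f ≤ S := by
    rw [← Submodule.map_subtype_top (LinearMap.ker f), ← hs', Submodule.map_span]
    exact Submodule.span_mono Set.subset_union_left
  have hr : S.map f.rangeRestrict = ⊤ := by
    rw [eq_top_iff, ← ht', Submodule.span_le]
    intro y hy
    exact ⟨σ y, Submodule.subset_span (Or.inr ⟨y, hy, rfl⟩), hσ y⟩
  refine eq_top_iff.2 fun m _ => ?_
  obtain ⟨m', hm', h⟩ := hr.ge (Submodule.mem_top (x := f.rangeRestrict m))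
  have h' : f m' = f m := congrArg Subtype.val h
  have : m - m' ∈ S := hk (by simp [h'])
  simpa using S.add_mem this hm'

/-- If a ring has finitely many nonzero primes, every ideal has an element lying in no strictly
smaller prime. -/
theorem Ideal.exists_mem_forall_lt_notMem {E : Type*} [CommRing E]
    (hrank : {P : Ideal E | P.IsPrime ∧ P ≠ ⊥}.Finite) (P : Ideal E) :
    ∃ a ∈ P, ∀ Q : Ideal E, Q.IsPrime → Q < P → a ∉ Q := by
  have hfin : {Q : Ideal E | Q.IsPrime ∧ Q < P}.Finite :=
    (hrank.insert ⊥).subset fun Q hQ => by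
      by_cases h : Q = ⊥
      · exact Or.inl h
      · exact Or.inr ⟨hQ.1, h⟩
  by_contra! h
  have hsub : (P : Set E) ⊆ ⋃ Q ∈ {Q : Ideal E | Q.IsPrime ∧ Q < P}, (Q : Set E) := by
    intro a ha
    obtain ⟨Q, hQ, hlt, haQ⟩ := h a ha
    exact Set.mem_biUnion (show Q ∈ {Q : Ideal E | Q.IsPrime ∧ Q < P} from ⟨hQ, hlt⟩) haQ
  obtain ⟨Q, hQ, hPQ⟩ :=
    (Ideal.subset_union_prime_finite hfin (f := id) ⊥ ⊥ fun Q hQ _ _ => hQ.1).1 hsub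
  exact (hQ.2.trans_le hPQ).false

namespace ValuationRing

variable {E : Type*} [CommRing E] [IsDomain E] [ValuationRing E]

/-- The elements divisible by all powers of `b` form a prime ideal strictly below any proper ideal
containing `b`. -/
theorem exists_isPrime_lt_of_mem {P : Ideal E} (hP : P ≠ ⊤) {b : E} (hb : b ∈ P) (hb0 : b ≠ 0) :
    ∃ Q : Ideal E, Q.IsPrime ∧ Q < P ∧ ∀ a, (∀ n : ℕ, b ^ n ∣ a) → a ∈ Q := by
  have hu : ¬ IsUnit b := fun h => hP (P.eq_top_of_isUnit_mem hb h)
  have key (m : ℕ) : ¬ b ^ (m + 1) ∣ b ^ m := fun h => by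
    have := (pow_dvd_pow_iff hb0 hu).1 h
    omega
  have hmem (a : E) : a ∈ (⨅ n : ℕ, Ideal.span {b ^ n}) ↔ ∀ n : ℕ, b ^ n ∣ a := by
    simp [Ideal.mem_span_singleton]
  have hbQ : b ∉ (⨅ n : ℕ, Ideal.span {b ^ n}) := fun h => by
    have := (hmem b).1 h 2
    exact key 1 (by simpa using this)
  refine ⟨⨅ n : ℕ, Ideal.span {b ^ n}, ⟨fun h => hbQ (h ▸ Submodule.mem_top), ?_⟩, ?_,
    fun a => (hmem a).2⟩
  · intro x y hxy
    by_contra! hc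
    rw [hmem, hmem] at hc
    push Not at hc
    obtain ⟨⟨n, hn⟩, m, hm⟩ := hc
    have hx := (dvd_total (b ^ n) x).resolve_left hn
    have hy := (dvd_total (b ^ m) y).resolve_left hm
    refine key (n + m) (((hmem _).1 hxy _).trans ?_)
    rw [pow_add]
    exact mul_dvd_mul hx hy
  · refine lt_of_le_of_ne (fun a ha => ?_) fun h => hbQ (h ▸ hb)
    obtain ⟨c, rfl⟩ := (hmem a).1 ha 1
    simpa using P.mul_mem_right c hb

/-- Outside a prime `P` of a finite rank valuation ring there is an element some power of which is
divisible by any given element outside `P`. -/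
theorem exists_notMem_forall_dvd_pow (hrank : {P : Ideal E | P.IsPrime ∧ P ≠ ⊥}.Finite)
    (P : Ideal E) [P.IsPrime] : ∃ t ∉ P, ∀ c ∉ P, ∃ n : ℕ, c ∣ t ^ n := by
  have hfin : {Q : Ideal E | Q.IsPrime ∧ P < Q}.Finite :=
    hrank.subset fun Q hQ => ⟨hQ.1, (bot_le.trans_lt hQ.2).ne'⟩
  have hle : ¬ hfin.toFinset.inf id ≤ P := fun h => by
    obtain ⟨Q, hQ, hQP⟩ := (Ideal.IsPrime.inf_le' ‹_›).1 h
    exact ((hfin.mem_toFinset.1 hQ).2.trans_le hQP).false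
  obtain ⟨t, ht, htP⟩ := SetLike.not_le_iff_exists.1 hle
  refine ⟨t, htP, fun c hc => ?_⟩
  have hrad : t ∈ (Ideal.span {c}).radical := by
    rw [Ideal.radical_eq_sInf, Submodule.mem_sInf]
    rintro Q ⟨hcQ, hQ⟩
    have hlt : P < Q := by
      refine lt_of_le_not_ge (((ValuationRing.iff_ideal_total.1 ‹_›).total P Q).resolve_right ?_) ?_ <;>
      exact fun h => hc (h (hcQ (Ideal.mem_span_singleton_self c)))
    exact (Finset.inf_le (f := id) (hfin.mem_toFinset.2 ⟨hQ, hlt⟩)) ht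
  obtain ⟨n, hn⟩ := hrad
  exact ⟨n, Ideal.mem_span_singleton.1 hn⟩

variable {N : Type*} [AddCommGroup N] [Module E N]

/-- The scalars which do not act surjectively on a nontrivial module over a valuation ring. -/
def nonSurjectiveIdeal (E N : Type*) [CommRing E] [IsDomain E] [ValuationRing E]
    [AddCommGroup N] [Module E N] [Nontrivial N] : Ideal E where
  carrier := {a | ∃ y : N, ∀ x : N, a • x ≠ y}
  zero_mem' := (exists_ne (0 : N)).imp fun y hy x => by simpa using hy.symm
  smul_mem' := by
    rintro c a ⟨y, hy⟩
    exact ⟨y, fun x hx => hy (c • x) (by rw [← hx, smul_eq_mul, mul_comm, mul_smul])⟩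
  add_mem' := by
    rintro a b ⟨y, hy⟩ ⟨z, hz⟩
    rcases dvd_total a b with ⟨c, rfl⟩ | ⟨c, rfl⟩
    · exact ⟨y, fun x hx => hy ((1 + c) • x) (by rw [← hx, smul_smul]; congr 1; ring)⟩
    · exact ⟨z, fun x hx => hz ((c + 1) • x) (by rw [← hx, smul_smul]; congr 1; ring)⟩

theorem mem_nonSurjectiveIdeal [Nontrivial N] {a : E} :
    a ∈ nonSurjectiveIdeal E N ↔ ∃ y : N, ∀ x : N, a • x ≠ y := Iff.rfl

instance [Nontrivial N] : (nonSurjectiveIdeal E N).IsPrime where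
  ne_top' h := by
    obtain ⟨y, hy⟩ := mem_nonSurjectiveIdeal.1 ((Ideal.eq_top_iff_one _).1 h)
    exact hy y (one_smul E y)
  mem_or_mem' {a b} hab := by
    by_contra! hc
    simp only [mem_nonSurjectiveIdeal, not_exists, not_forall, not_not] at hc
    obtain ⟨y, hy⟩ := hab
    obtain ⟨x, hx⟩ := hc.1 y
    obtain ⟨z, hz⟩ := hc.2 x
    exact hy z (by rw [mul_smul, hz, hx])

/-- A uniserial torsionfree module over a valuation ring of finite rank is countably generated. -/
theorem exists_countable_span_eq_top_of_uniserial
    (hrank : {P : Ideal E | P.IsPrime ∧ P ≠ ⊥}.Finite) [Module.IsTorsionFree E N]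
    (huni : ∀ x y : N, (∃ c : E, x = c • y) ∨ ∃ c : E, y = c • x) :
    ∃ s : Set N, s.Countable ∧ Submodule.span E s = ⊤ := by
  cases subsingleton_or_nontrivial N
  · exact ⟨∅, Set.countable_empty, Subsingleton.elim _ _⟩
  by_contra! hN
  have hdir (y : ℕ → N) : ∃ x, ∀ n, ∃ c : E, y n = c • x := by
    obtain ⟨x, -, hx⟩ := SetLike.exists_of_lt
      (lt_top_iff_ne_top.2 (hN (Set.range y) (Set.countable_range y)))
    refine ⟨x, fun n => (huni _ _).resolve_right ?_⟩
    rintro ⟨c, hc⟩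
    exact hx (hc ▸ Submodule.smul_mem _ c (Submodule.subset_span ⟨n, rfl⟩))
  set P := nonSurjectiveIdeal E N with hPdef
  have hsurj {c : E} (hc : c ∉ P) (y : N) : ∃ x, c • x = y := by
    simpa [hPdef, mem_nonSurjectiveIdeal] using fun h => hc ⟨y, h⟩
  by_cases h : ∃ y : N, ∀ (c : E) (x : N), c • x = y → c ∉ P
  · obtain ⟨y, hy⟩ := h
    obtain ⟨t, htP, ht⟩ := exists_notMem_forall_dvd_pow hrank P
    choose z hz using fun n : ℕ =>
      hsurj (fun h => htP (Ideal.IsPrime.mem_of_pow_mem inferInstance n h) : t ^ n ∉ P) y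
    refine hN (Set.range z) (Set.countable_range z) (eq_top_iff.2 fun x _ => ?_)
    have hzmem (n : ℕ) : z n ∈ Submodule.span E (Set.range z) := Submodule.subset_span ⟨n, rfl⟩
    rcases huni x y with ⟨c, rfl⟩ | ⟨c, hc⟩
    · have := hz 0
      rw [pow_zero, one_smul] at this
      exact Submodule.smul_mem _ _ (this ▸ hzmem 0)
    · have hcP := hy c x hc.symm
      obtain ⟨n, d, hd⟩ := ht c hcP
      have : x = d • z n := by
        have hc0 : c ≠ 0 := fun h => hcP (by rw [h]; exact P.zero_mem)
        refine smul_right_injective N hc0 ?_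
        simp only [smul_smul, ← hd, hz n, hc]
      exact this ▸ Submodule.smul_mem _ _ (hzmem n)
  · push Not at h
    obtain ⟨a, haP, ha⟩ := Ideal.exists_mem_forall_lt_notMem hrank P
    obtain ⟨y₀, hy₀⟩ := mem_nonSurjectiveIdeal.1 haP
    have step (y : N) : ∃ (b : E) (e : E) (y' : N), y = (b * e) • y' ∧ ∀ z, b • z ≠ y' := by
      obtain ⟨b, x, hx, hbP⟩ := h y
      obtain ⟨w, hw⟩ := mem_nonSurjectiveIdeal.1 hbP
      rcases huni x w with ⟨c, rfl⟩ | ⟨c, rfl⟩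
      · exact ⟨b, c, w, by rw [← hx, mul_smul], hw⟩
      · refine ⟨b, 1, x, by rw [← hx, mul_one], fun z hz => hw (c • z) ?_⟩
        rw [← hz, smul_comm]
    choose b e next hnext hb using step
    let Y : ℕ → N := fun n => next^[n] y₀
    have hY (n : ℕ) : Y (n + 1) = next (Y n) := Function.iterate_succ_apply' _ _ _
    obtain ⟨y, hy⟩ := hdir Y
    obtain ⟨β, x, hx, hβP⟩ := h y
    have hdvd (n : ℕ) : β ∣ b (Y n) := by
      refine (dvd_total _ _).resolve_right ?_
      rintro ⟨d, hd⟩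
      obtain ⟨f, hf⟩ := hy (n + 1)
      refine hb (Y n) (d • f • x) ?_
      rw [← hY, hf, ← hx, hd, mul_smul, smul_comm f, smul_comm f]
    have hpow (n : ℕ) : ∃ c : E, y₀ = (β ^ n * c) • Y n := by
      induction n with
      | zero => exact ⟨1, by simp [Y]⟩
      | succ n ih =>
        obtain ⟨c, hc⟩ := ih
        obtain ⟨d, hd⟩ := hdvd n
        refine ⟨c * d * e (Y n), ?_⟩
        rw [hY, hc]
        conv_lhs => rw [hnext (Y n), smul_smul, hd]
        congr 1
        ring
    have hβ0 : β ≠ 0 := by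
      rintro rfl
      obtain ⟨c, hc⟩ := hpow 1
      exact hy₀ 0 (by simp [hc])
    obtain ⟨Q, hQ, hQP, hmem⟩ := exists_isPrime_lt_of_mem (Ideal.IsPrime.ne_top') hβP hβ0
    refine ha Q hQ hQP (hmem a fun n => (dvd_total _ _).resolve_right ?_)
    rintro ⟨d, hd⟩
    obtain ⟨c, hc⟩ := hpow n
    exact hy₀ ((d * c) • Y n) (by rw [hc, hd, smul_smul, mul_assoc])

/-- The fraction field of a valuation ring is a uniserial module. -/
theorem exists_eq_smul_or (K : Type*) [Field K] [Algebra E K] [IsFractionRing E K]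
    (x y : K) : (∃ c : E, x = c • y) ∨ ∃ c : E, y = c • x := by
  by_cases hx : x = 0
  · exact Or.inl ⟨0, by simp [hx]⟩
  by_cases hy : y = 0
  · exact Or.inr ⟨0, by simp [hy]⟩
  rcases ValuationRing.isInteger_or_isInteger E (x / y) with ⟨c, hc⟩ | ⟨c, hc⟩
  · exact Or.inl ⟨c, by rw [Algebra.smul_def, hc, div_mul_cancel₀ x hy]⟩
  · exact Or.inr ⟨c, by rw [Algebra.smul_def, hc, inv_div, div_mul_cancel₀ y hx]⟩

theorem exists_countable_span_eq_top_of_injective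
    (hrank : {P : Ideal E | P.IsPrime ∧ P ≠ ⊥}.Finite)
    {K : Type*} [Field K] [Algebra E K] [IsFractionRing E K] {n : ℕ}
    {M : Type*} [AddCommGroup M] [Module E M] (φ : M →ₗ[E] Fin n → K)
    (hφ : Function.Injective φ) :
    ∃ s : Set M, s.Countable ∧ Submodule.span E s = ⊤ := by
  induction n generalizing M with
  | zero =>
    have := hφ.subsingleton
    exact ⟨∅, Set.countable_empty, Subsingleton.elim _ _⟩
  | succ n ih =>
    refine Submodule.exists_countable_span_eq_top_of_ker_range (LinearMap.proj 0 ∘ₗ φ) ?_ ?_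
    · refine ih (LinearMap.funLeft E K Fin.succ ∘ₗ φ ∘ₗ Submodule.subtype _) ?_
      rintro ⟨x, hx⟩ ⟨y, hy⟩ h
      refine Subtype.ext (hφ (funext fun i => ?_))
      refine Fin.cases ?_ (fun j => congrFun h j) i
      exact (LinearMap.mem_ker.1 hx).trans (LinearMap.mem_ker.1 hy).symm
    · refine exists_countable_span_eq_top_of_uniserial hrank fun x y => ?_
      refine (exists_eq_smul_or (E := E) K (x : K) y).imp ?_ ?_ <;>
      exact fun ⟨c, hc⟩ => ⟨c, Subtype.ext hc⟩

theorem flat_of_isTorsionFree {M : Type*} [AddCommGroup M] [Module E M]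
    [Module.IsTorsionFree E M] : Module.Flat E M := by
  rw [Module.Flat.flat_iff_torsion_eq_bot_of_isBezout, ← Submodule.isTorsionFree_iff_torsion_eq_bot]
  infer_instance

/-- Over a valuation ring of finite rank, torsionfree modules with finite-dimensional generic fibre
are countably generated. -/
theorem exists_countable_span_eq_top
    (hrank : {P : Ideal E | P.IsPrime ∧ P ≠ ⊥}.Finite)
    (K : Type*) [Field K] [Algebra E K] [IsFractionRing E K]
    (M : Type*) [AddCommGroup M] [Module E M] [Module.IsTorsionFree E M]
    [FiniteDimensional K (TensorProduct E K M)] :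
    ∃ s : Set M, s.Countable ∧ Submodule.span E s = ⊤ := by
  have : Module.Flat E M := flat_of_isTorsionFree
  let e := (Module.finBasis K (TensorProduct E K M)).equivFun
  refine exists_countable_span_eq_top_of_injective hrank
    ((e.toLinearMap.restrictScalars E) ∘ₗ TensorProduct.mk E K M 1) ?_
  exact e.injective.comp (Module.Flat.tensorProduct_mk_injective (R := E) (S := K) (M := M))

end ValuationRing

/-- A countably generated module is the union of an increasing sequence of finitely generated
submodules. -/
theorem Submodule.exists_monotone_fg_of_countable_span {R M : Type*} [CommRing R] [AddCommGroup M]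
    [Module R M] {s : Set M} (hs : s.Countable) (hs' : span R s = ⊤) :
    ∃ F : ℕ →o Submodule R M, (∀ n, (F n).FG) ∧ ∀ m, ∃ n, m ∈ F n := by
  obtain ⟨u, hu⟩ := (hs.insert 0).exists_eq_range (Set.insert_nonempty 0 s)
  let F : ℕ →o Submodule R M :=
    ⟨fun n => span R (u '' Set.Iic n), fun i j hij =>
      span_mono (Set.image_mono (Set.Iic_subset_Iic.2 hij))⟩
  refine ⟨F, fun n => fg_span ((Set.finite_Iic n).image u), fun m => ?_⟩
  have hsup : ⨆ n, F n = ⊤ := by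
    rw [eq_top_iff, ← hs', span_le]
    intro x hx
    obtain ⟨n, rfl⟩ : x ∈ Set.range u := hu ▸ Set.mem_insert_of_mem 0 hx
    exact mem_iSup_of_mem n (subset_span ⟨n, Set.mem_Iic.2 le_rfl, rfl⟩)
  exact (mem_iSup_of_directed _ F.monotone.directed_le).1 (hsup ▸ mem_top)

namespace DirectSum

variable {R M : Type*} [CommRing R] [AddCommGroup M] [Module R M] (F : ℕ →o Submodule R M)

/-- The difference of the identity and the shift on the direct sum of an increasing sequence of
submodules. -/
noncomputable def telescope : (⨁ n, F n) →ₗ[R] ⨁ n, F n :=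
  LinearMap.id - toModule R ℕ _ fun n =>
    lof R ℕ (fun n => F n) (n + 1) ∘ₗ Submodule.inclusion (F.monotone n.le_succ)

theorem telescope_lof (n : ℕ) (x : F n) :
    telescope F (lof R ℕ (fun n => F n) n x) = lof R ℕ (fun n => F n) n x -
      lof R ℕ (fun n => F n) (n + 1) (Submodule.inclusion (F.monotone n.le_succ) x) := by
  simp [telescope]

theorem telescope_apply_zero (z : ⨁ n, F n) : telescope F z 0 = z 0 := by
  induction z using DirectSum.induction_on with
  | zero => simp
  | of i y =>
    rw [← lof_eq_of R, telescope_lof, DirectSum.sub_apply, lof_eq_of, lof_eq_of,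
      of_eq_of_ne (i + 1) 0 _ (by omega), sub_zero]
  | add a b ha hb => simp only [map_add, DirectSum.add_apply, ha, hb]

theorem telescope_apply_succ (z : ⨁ n, F n) (n : ℕ) : telescope F z (n + 1) =
    z (n + 1) - Submodule.inclusion (F.monotone n.le_succ) (z n) := by
  induction z using DirectSum.induction_on with
  | zero => simp
  | of i y =>
    rw [← lof_eq_of R, telescope_lof, DirectSum.sub_apply, lof_eq_of, lof_eq_of]
    by_cases h : n = i
    · subst h
      simp
    · rw [of_eq_of_ne (i + 1) (n + 1) _ (by omega), of_eq_of_ne i n _ (by omega), map_zero]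
  | add a b ha hb =>
    simp only [map_add, DirectSum.add_apply, ha, hb]
    abel

theorem telescope_injective : Function.Injective (telescope F) := by
  rw [injective_iff_map_eq_zero]
  intro x hx
  ext n
  induction n with
  | zero => simpa [hx] using (telescope_apply_zero F x).symm
  | succ n ih =>
    have := telescope_apply_succ F x n
    rw [hx, show x n = 0 from Subtype.ext ih] at this
    simpa using this.symm

theorem exists_sub_lof_mem_range_telescope (z : ⨁ n, F n) :
    ∃ N, ∀ n ≥ N, ∃ y : F n, (y : M) = coeLinearMap (fun n => F n) z ∧
      z - lof R ℕ (fun n => F n) n y ∈ LinearMap.range (telescope F) := by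
  induction z using DirectSum.induction_on with
  | zero => exact ⟨0, fun n _ => ⟨0, by simp, by simp⟩⟩
  | of i y =>
    refine ⟨i, fun n hn => ?_⟩
    simp only [← lof_eq_of R, coeLinearMap_lof]
    induction n, hn using Nat.le_induction with
    | base => exact ⟨y, rfl, by simp⟩
    | succ n hn ih =>
      obtain ⟨x, hx, w, hw⟩ := ih
      refine ⟨Submodule.inclusion (F.monotone n.le_succ) x, hx,
        w + lof R ℕ (fun n => F n) n x, ?_⟩
      rw [map_add, hw, telescope_lof]
      abel
  | add a b ha hb =>
    obtain ⟨A, hA⟩ := ha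
    obtain ⟨B, hB⟩ := hb
    refine ⟨max A B, fun n hn => ?_⟩
    obtain ⟨x, hx, hA⟩ := hA n (le_of_max_le_left hn)
    obtain ⟨y, hy, hB⟩ := hB n (le_of_max_le_right hn)
    refine ⟨x + y, by rw [map_add, ← hx, ← hy, Submodule.coe_add], ?_⟩
    rw [map_add, add_sub_add_comm]
    exact add_mem hA hB

theorem telescope_exact : Function.Exact (telescope F) (coeLinearMap fun n => F n) := by
  rw [LinearMap.exact_iff]
  apply le_antisymm
  · intro z hz
    obtain ⟨N, hN⟩ := exists_sub_lof_mem_range_telescope F z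
    obtain ⟨y, hy, hN⟩ := hN N le_rfl
    obtain rfl : y = 0 := Subtype.ext (hy.trans hz)
    simpa using hN
  · rw [LinearMap.range_le_ker_iff]
    ext n x
    simp [telescope]

theorem coeLinearMap_surjective_of_exists_mem (hF : ∀ m, ∃ n, m ∈ F n) :
    Function.Surjective (coeLinearMap fun n => F n) := fun m => by
  obtain ⟨n, hn⟩ := hF m
  exact ⟨lof R ℕ (fun n => F n) n ⟨m, hn⟩, coeLinearMap_lof ..⟩

end DirectSum

/-- The `Ext` functors vanish above the projective dimension. -/
theorem CategoryTheory.HasProjectiveDimensionLT.isZero_Ext {R : Type*} [Ring R]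
    {C : Type*} [Category* C] [Abelian C] [Linear R C] [EnoughProjectives C] (X Y : C) (n : ℕ)
    [HasProjectiveDimensionLT X n] (i : ℕ) (hi : n ≤ i) (hi0 : 0 < i) :
    Limits.IsZero (((_root_.Ext R C i).obj (Opposite.op X)).obj Y) := by
  let P := projectiveResolution X
  refine Limits.IsZero.of_iso ?_ (P.isoExt (R := R) i Y)
  obtain ⟨j, rfl⟩ : ∃ j, i = j + 1 := ⟨i - 1, by omega⟩
  rw [← HomologicalComplex.exactAt_iff_isZero_homology,
    HomologicalComplex.exactAt_iff' _ j (j + 1) (j + 2) (by simp) (by simp),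
    ShortComplex.moduleCat_exact_iff]
  intro (f : P.complex.X (j + 1) ⟶ Y) hf
  let := HasExt.standard C
  have hf' : P.complex.d (j + 2) (j + 1) ≫ f = 0 := hf
  exact (P.extMk_eq_zero_iff f (j + 2) rfl hf' j rfl).1
    (Abelian.Ext.eq_zero_of_hasProjectiveDimensionLT _ n hi)

/-- A two-term projective resolution of a torsionfree module stays a resolution modulo `r`. -/
theorem ModuleCat.hasProjectiveDimensionLT_quotient.{u} {R : Type u} [CommRing R] [IsDomain R]
    (r : R) {A B M : Type u} [AddCommGroup A] [Module R A]
    [AddCommGroup B] [Module R B] [AddCommGroup M] [Module R M] [Module.IsTorsionFree R M]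
    [Module.Projective R A] [Module.Projective R B]
    (f : A →ₗ[R] B) (g : B →ₗ[R] M) (hf : Function.Injective f) (hfg : Function.Exact f g)
    (hg : Function.Surjective g) :
    HasProjectiveDimensionLT (ModuleCat.of (R ⧸ Ideal.span {r})
      (M ⧸ (Ideal.span {r} • ⊤ : Submodule R M))) 2 := by
  have proj (L : Type u) [AddCommGroup L] [Module R L] [Module.Projective R L] :
      Module.Projective (R ⧸ Ideal.span {r}) (L ⧸ (Ideal.span {r} • ⊤ : Submodule R L)) :=
    .of_equiv ((TensorProduct.quotTensorEquivQuotSMul L (Ideal.span {r})).extendScalarsOfSurjective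
      (S := R ⧸ Ideal.span {r}) Ideal.Quotient.mk_surjective)
  have := proj A
  have := proj B
  have mem (L : Type u) [AddCommGroup L] [Module R L] (x : L) :
      x ∈ (Ideal.span {r} • ⊤ : Submodule R L) ↔ ∃ y, r • y = x := by
    simp [Submodule.ideal_span_singleton_smul, Submodule.mem_smul_pointwise_iff_exists]
  have hle {L L' : Type u} [AddCommGroup L] [Module R L] [AddCommGroup L'] [Module R L']
      (u : L →ₗ[R] L') : (Ideal.span {r} • ⊤ : Submodule R L) ≤
        (Ideal.span {r} • ⊤ : Submodule R L').comap u := by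
    intro x hx
    obtain ⟨y, rfl⟩ := (mem L x).1 hx
    exact (mem L' _).2 ⟨u y, (map_smul u r y).symm⟩
  let F := (Submodule.mapQ _ _ f (hle f)).extendScalarsOfSurjective
    (S := R ⧸ Ideal.span {r}) Ideal.Quotient.mk_surjective
  let G := (Submodule.mapQ _ _ g (hle g)).extendScalarsOfSurjective
    (S := R ⧸ Ideal.span {r}) Ideal.Quotient.mk_surjective
  have hF : Function.Injective F := by
    rw [injective_iff_map_eq_zero]
    intro a ha
    obtain ⟨a, rfl⟩ := Submodule.mkQ_surjective _ a
    obtain ⟨b, hb⟩ := (mem _ _).1 ((Submodule.Quotient.mk_eq_zero _).1 ha)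
    refine (Submodule.Quotient.mk_eq_zero _).2 ((mem _ _).2 ?_)
    have hgb : r • g b = 0 := by rw [← map_smul, hb, hfg.apply_apply_eq_zero]
    rcases smul_eq_zero.1 hgb with rfl | h
    · exact ⟨0, hf (by rw [← hb, zero_smul, zero_smul, map_zero])⟩
    · obtain ⟨a', rfl⟩ := (hfg b).1 h
      exact ⟨a', hf (by rw [map_smul, hb])⟩
  have hG : Function.Surjective G := by
    intro m
    obtain ⟨m, rfl⟩ := Submodule.mkQ_surjective _ m
    obtain ⟨b, rfl⟩ := hg m
    exact ⟨Submodule.mkQ _ b, rfl⟩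
  have hFG : Function.Exact F G := by
    intro b
    obtain ⟨b, rfl⟩ := Submodule.mkQ_surjective _ b
    constructor
    · intro h
      obtain ⟨m, hm⟩ := (mem _ _).1 ((Submodule.Quotient.mk_eq_zero _).1 h)
      obtain ⟨b', rfl⟩ := hg m
      obtain ⟨a, ha⟩ := (hfg (b - r • b')).1 (by rw [map_sub, map_smul, hm, sub_self])
      refine ⟨Submodule.mkQ _ a, (Submodule.Quotient.eq _).2 ((mem _ _).2 ⟨-b', ?_⟩)⟩
      rw [ha]
      simp
    · rintro ⟨a, ha⟩
      obtain ⟨a, rfl⟩ := Submodule.mkQ_surjective _ a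
      rw [← ha]
      exact (Submodule.Quotient.mk_eq_zero _).2 (by rw [hfg.apply_apply_eq_zero]; exact zero_mem _)
  let S : ShortComplex (ModuleCat (R ⧸ Ideal.span {r})) :=
    .mk (ModuleCat.ofHom F) (ModuleCat.ofHom G) (by
      rw [← ModuleCat.ofHom_comp, hFG.linearMap_comp_eq_zero]; rfl)
  have hS : S.ShortExact :=
    { exact := (ShortComplex.ShortExact.moduleCat_exact_iff_function_exact S).2 hFG
      mono_f := (ModuleCat.mono_iff_injective _).2 hF
      epi_g := (ModuleCat.epi_iff_surjective _).2 hG }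
  have p1 : Projective S.X₁ := (IsProjective.iff_projective _).1 (proj A)
  have p2 : Projective S.X₂ := (IsProjective.iff_projective _).1 (proj B)
  exact hS.hasProjectiveDimensionLT_X₃ 1 inferInstance inferInstance

/-- Last part of **Lemma 4.9**: if `E⁺` is a finite rank valuation ring with fraction field
`E = K` and `M` is a torsionfree `E⁺`-module with finite-dimensional generic fibre, then the
`E⁺/pE⁺`-module `M/pM` has projective dimension at most `1`: all its `Ext` groups in degrees
`≥ 2` vanish. -/
theorem valuation_ring_mod_p_projective_dimension_le_one
    (p : ℕ) (hp : p.Prime)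
    (E : Type) [CommRing E] [IsDomain E] [ValuationRing E]
    (hrank : {P : Ideal E | P.IsPrime ∧ P ≠ ⊥}.Finite)
    (K : Type) [Field K] [Algebra E K] [IsFractionRing E K]
    (M : Type) [AddCommGroup M] [Module E M]
    (htf : ∀ c : E, c ≠ 0 → Function.Injective fun m : M => c • m)
    [FiniteDimensional K (TensorProduct E K M)] :
    ∀ (Q : ModuleCat (E ⧸ Ideal.span {(p : E)})) (i : ℕ), 2 ≤ i →
      Limits.IsZero
        (((Ext (E ⧸ Ideal.span {(p : E)}) (ModuleCat (E ⧸ Ideal.span {(p : E)})) i).obj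
          (Opposite.op (ModuleCat.of (E ⧸ Ideal.span {(p : E)})
            (M ⧸ ((Ideal.span {(p : E)}) • ⊤ : Submodule E M))))).obj Q) := by
  intro Q i hi
  have : Module.IsTorsionFree E M := ⟨fun c hc => htf c hc.ne_zero⟩
  obtain ⟨s, hs, hs'⟩ := ValuationRing.exists_countable_span_eq_top hrank K M
  obtain ⟨F, hF, hFM⟩ := Submodule.exists_monotone_fg_of_countable_span hs hs'
  have hfree (n : ℕ) : Module.Projective E (F n) := by
    have : Module.Finite E (F n) := Module.Finite.iff_fg.2 (hF n)
    have : Module.Flat E (F n) := ValuationRing.flat_of_isTorsionFree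
    have : Module.Free E (F n) := Module.free_of_flat_of_isLocalRing
    infer_instance
  have := ModuleCat.hasProjectiveDimensionLT_quotient (p : E) (DirectSum.telescope F)
    (DirectSum.coeLinearMap fun n => F n) (DirectSum.telescope_injective F)
    (DirectSum.telescope_exact F) (DirectSum.coeLinearMap_surjective_of_exists_mem F hFM)
  exact HasProjectiveDimensionLT.isZero_Ext _ Q 2 i hi (by omega)
end

section
/- Let p be a prime number and let C⁺ be a valuation ring in which p is neither zero nor a unit, such that the Frobenius endomorphism x ↦ x^p of C⁺/pC⁺ is surjective and C⁺/pC⁺ contains a nonzero nilpotent element. Let E⁺ be a valuation ring extension of C⁺. Then the E⁺-module Ω¹_{E⁺/C⁺} of Kähler differentials is p-torsionfree, and its reduction Ω¹_{E⁺/C⁺}/p·Ω¹_{E⁺/C⁺} (which is isomorphic to Ω¹_{(E⁺/pE⁺)/(C⁺/pC⁺)}) is a flat E⁺/pE⁺-module. -/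
section
open scoped TensorProduct

theorem Module.Flat.of_isBezout {R M : Type*} [CommRing R] [IsBezout R] [AddCommGroup M]
    [Module R M] (h : ∀ (a : R) (m : M), a • m = 0 → ∃ (b : R) (n : M), a * b = 0 ∧ m = b • n) :
    Module.Flat R M := by
  rw [Module.Flat.iff_lift_lsmul_comp_subtype_injective]
  intro I hI
  obtain ⟨a, rfl⟩ := (IsBezout.isPrincipal_of_FG I hI).principal
  rw [injective_iff_map_eq_zero]
  let a' : Submodule.span R {a} := ⟨a, Submodule.mem_span_singleton_self a⟩
  have key (x : Submodule.span R {a} ⊗[R] M) : ∃ m : M, x = a' ⊗ₜ m := by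
    induction x with
    | zero => exact ⟨0, by simp⟩
    | add x y hx hy =>
      obtain ⟨m, rfl⟩ := hx
      obtain ⟨n, rfl⟩ := hy
      exact ⟨m + n, by rw [TensorProduct.tmul_add]⟩
    | tmul x m =>
      obtain ⟨x, hx⟩ := x
      obtain ⟨r, rfl⟩ := Submodule.mem_span_singleton.mp hx
      exact ⟨r • m, by rw [TensorProduct.tmul_smul]; rfl⟩
  intro x hx
  obtain ⟨m, rfl⟩ := key x
  obtain ⟨b, n, hab, rfl⟩ := h a m (by simpa [a'] using hx)
  rw [← TensorProduct.smul_tmul]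
  have : b • a' = 0 := Subtype.ext (by simpa [a', mul_comm] using hab)
  rw [this, TensorProduct.zero_tmul]

theorem Module.Flat.quotient_of_valuationRing {E M : Type*} [CommRing E] [IsDomain E]
    [ValuationRing E] [AddCommGroup M] [Module E M] {r : E}
    (hM : Function.Injective fun m : M => r • m) :
    Module.Flat (E ⧸ Ideal.span {r}) (M ⧸ (Ideal.span {r} • ⊤ : Submodule E M)) := by
  have hB : IsBezout (E ⧸ Ideal.span {r}) :=
    Function.Surjective.isBezout (Ideal.Quotient.mk _) Ideal.Quotient.mk_surjective
  have hmem (m : M) : m ∈ (Ideal.span {r} • ⊤ : Submodule E M) ↔ ∃ n, r • n = m := by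
    rw [Submodule.ideal_span_singleton_smul, Submodule.mem_smul_pointwise_iff_exists]
    simp
  apply Module.Flat.of_isBezout
  intro a m ham
  obtain ⟨a, rfl⟩ := Ideal.Quotient.mk_surjective a
  obtain ⟨m, rfl⟩ := Submodule.Quotient.mk_surjective _ m
  have ham' : a • m ∈ (Ideal.span {r} • ⊤ : Submodule E M) := by
    rw [← Submodule.Quotient.mk_eq_zero]; exact ham
  obtain ⟨n, hn⟩ := (hmem _).mp ham'
  rcases ValuationRing.dvd_total a r with ⟨b, rfl⟩ | ⟨b, rfl⟩
  · refine ⟨Ideal.Quotient.mk _ b, Submodule.Quotient.mk n, ?_, ?_⟩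
    · rw [← map_mul, Ideal.Quotient.eq_zero_iff_mem]
      exact Ideal.mem_span_singleton_self _
    · have : m = b • n := by
        apply hM
        simp only
        rw [mul_comm, mul_smul, ← hn, smul_smul, smul_smul]
        congr 1
        ring
      rw [this]; rfl
  · refine ⟨1, Submodule.Quotient.mk m, ?_, (one_smul _ _).symm⟩
    rw [mul_one, Ideal.Quotient.eq_zero_iff_mem]
    exact Ideal.mul_mem_right _ _ (Ideal.mem_span_singleton_self _)
end
section
open KaehlerDifferential

/-- The polynomial `((x + y) ^ p - x ^ p - y ^ p) / p`. -/
noncomputable def frobDefect {R : Type*} [CommRing R] (p : ℕ) (x y : R) : R :=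
  x * y * ∑ k ∈ Finset.Ioo 0 p, x ^ (k - 1) * y ^ (p - k - 1) * ((p.choose k / p : ℕ) : R)

theorem add_pow_eq_frobDefect {R : Type*} [CommRing R] {p : ℕ} (hp : p.Prime) (x y : R) :
    (x + y) ^ p = x ^ p + y ^ p + p * frobDefect p x y := by
  rw [add_pow_prime_eq hp x y, frobDefect]
  ring

theorem map_frobDefect {R S : Type*} [CommRing R] [CommRing S] (f : R →+* S) (p : ℕ) (x y : R) :
    f (frobDefect p x y) = frobDefect p (f x) (f y) := by
  simp [frobDefect]

theorem D_frobDefect_mvPolynomial {p : ℕ} (hp : p.Prime) (x y : MvPolynomial (Fin 2) ℤ) :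
    D ℤ _ (frobDefect p x y) =
      (x + y) ^ (p - 1) • D ℤ _ (x + y) - x ^ (p - 1) • D ℤ _ x - y ^ (p - 1) • D ℤ _ y := by
  have hp0 : (p : MvPolynomial (Fin 2) ℤ) ≠ 0 := by exact_mod_cast hp.ne_zero
  have : Module.Free (MvPolynomial (Fin 2) ℤ) (Ω[MvPolynomial (Fin 2) ℤ⁄ℤ]) :=
    Module.Free.of_basis (mvPolynomialBasis ℤ (Fin 2))
  apply smul_right_injective _ hp0
  have h := congr_arg (D ℤ _) (add_pow_eq_frobDefect hp x y)
  simp only [map_add, Derivation.leibniz_pow, Derivation.leibniz, Derivation.map_natCast, smul_zero,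
    add_zero] at h ⊢
  simp only [smul_sub, Nat.cast_smul_eq_nsmul] at h ⊢
  rw [h]
  abel

theorem Derivation.map_frobDefect {R A M : Type*} [CommRing R] [CommRing A] [Algebra R A]
    [AddCommGroup M] [Module A M] [Module R M] (d : Derivation R A M) {p : ℕ} (hp : p.Prime)
    (x y : A) :
    d (frobDefect p x y) =
      (x + y) ^ (p - 1) • d (x + y) - x ^ (p - 1) • d x - y ^ (p - 1) • d y := by
  let φ : MvPolynomial (Fin 2) ℤ →ₐ[ℤ] A := MvPolynomial.aeval ![x, y]
  let _ := φ.toRingHom.toAlgebra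
  let _ : Module (MvPolynomial (Fin 2) ℤ) M := Module.compHom M φ.toRingHom
  have : IsScalarTower (MvPolynomial (Fin 2) ℤ) A M := ⟨fun a b m => mul_smul (φ a) b m⟩
  let d' := (d.restrictScalars ℤ).compAlgebraMap (MvPolynomial (Fin 2) ℤ)
  have hd' (q) : d'.liftKaehlerDifferential (D ℤ _ q) = d (φ q) := by
    rw [Derivation.liftKaehlerDifferential_comp_D]; rfl
  have h := congr_arg d'.liftKaehlerDifferential
    (D_frobDefect_mvPolynomial hp (.X 0) (.X 1))
  have hl (q : MvPolynomial (Fin 2) ℤ) (ω : Ω[MvPolynomial (Fin 2) ℤ⁄ℤ]) :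
      d'.liftKaehlerDifferential (q • ω) = φ q • d'.liftKaehlerDifferential ω := by
    rw [LinearMap.map_smul]; rfl
  simp only [map_sub, hl, hd', map_pow] at h
  have e := _root_.map_frobDefect φ.toRingHom p (.X 0) (.X 1)
  have h0 : φ (.X 0) = x := by simp [φ]
  have h1 : φ (.X 1) = y := by simp [φ]
  simp only [AlgHom.toRingHom_eq_coe, RingHom.coe_coe, h0, h1] at e
  simpa only [e, map_add φ, h0, h1] using h

section Frobenius

variable {C W : Type*} [CommRing C] [CommRing W] [Algebra C W] {p : ℕ}

theorem D_pow_add_mul_congr [IsDomain W] (hp : p.Prime) (hp0 : (p : W) ≠ 0) {π u : C}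
    (hπ : π ^ p = p * u) (hroot : ∀ y : W, (p : W) ∣ y ^ p → algebraMap C W π ∣ y)
    {y₁ z₁ y₂ z₂ : W} (h : y₁ ^ p + p * z₁ = y₂ ^ p + p * z₂) :
    y₁ ^ (p - 1) • D C W y₁ + D C W z₁ = y₂ ^ (p - 1) • D C W y₂ + D C W z₂ := by
  obtain ⟨w, hw⟩ : algebraMap C W π ∣ y₁ - y₂ := by
    apply hroot
    have := add_pow_eq_frobDefect hp (y₁ - y₂) y₂
    rw [sub_add_cancel] at this
    exact ⟨z₂ - z₁ - frobDefect p (y₁ - y₂) y₂, by linear_combination h - this⟩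
  obtain rfl : y₁ = y₂ + algebraMap C W π * w := by linear_combination hw
  have hπ' : algebraMap C W π ^ p = p * algebraMap C W u := by
    rw [← map_pow, hπ, map_mul, map_natCast]
  obtain rfl : z₂ = z₁ + (algebraMap C W u * w ^ p + frobDefect p y₂ (algebraMap C W π * w)) := by
    apply mul_left_cancel₀ hp0
    rw [add_pow_eq_frobDefect hp, mul_pow, hπ'] at h
    linear_combination -h
  have e : (algebraMap C W π * w) ^ (p - 1) * algebraMap C W π =
      algebraMap C W u * (p * w ^ (p - 1)) := by
    rw [mul_pow, mul_right_comm, ← pow_succ, Nat.sub_add_cancel hp.one_le, hπ']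
    ring
  simp only [map_add, Derivation.map_frobDefect _ hp, Derivation.leibniz, Derivation.leibniz_pow,
    Derivation.map_algebraMap, smul_zero, add_zero, smul_add, ← Nat.cast_smul_eq_nsmul W, smul_smul,
    e]
  module

theorem KaehlerDifferential.eq_zero_of_frobenius_surjective [IsDomain W] (hp : p.Prime)
    (hp0 : (p : W) ≠ 0) {π u : C}
    (hπ : π ^ p = p * u) (hroot : ∀ y : W, (p : W) ∣ y ^ p → algebraMap C W π ∣ y)
    (hC : ∀ x : C, ∃ y z, x = y ^ p + p * z) (hW : ∀ x : W, ∃ y z, x = y ^ p + p * z)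
    {ω : Ω[W⁄C]} (hω : (p : W) • ω = 0) : ω = 0 := by
  choose Y Z hYZ using hW
  let F (x : W) : Ω[W⁄C] := Y x ^ (p - 1) • D C W (Y x) + D C W (Z x)
  have hF (y z : W) : F (y ^ p + p * z) = y ^ (p - 1) • D C W y + D C W z :=
    D_pow_add_mul_congr hp hp0 hπ hroot (hYZ _).symm
  have hadd (a b : W) : F (a + b) = F a + F b := by
    have e : a + b = (Y a + Y b) ^ p + p * (Z a + Z b - frobDefect p (Y a) (Y b)) := by
      rw [add_pow_eq_frobDefect hp]
      linear_combination hYZ a + hYZ b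
    rw [e, hF, map_sub, Derivation.map_frobDefect _ hp, map_add, map_add]
    simp only [F]
    abel
  have hpow (y : W) : y ^ p = y ^ (p - 1) * y := by
    rw [← pow_succ, Nat.sub_add_cancel hp.one_le]
  have hmul (a b : W) : F (a * b) = a • F b + b • F a := by
    have e : a * b = (Y a * Y b) ^ p + p * (Y a ^ p * Z b + Z a * Y b ^ p + p * (Z a * Z b)) := by
      rw [mul_pow]
      nth_rw 1 [hYZ a, hYZ b]
      ring
    have ea : a • F b = (Y a ^ p + p * Z a) • F b := by rw [← hYZ]
    have eb : b • F a = (Y b ^ p + p * Z b) • F a := by rw [← hYZ]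
    rw [e, hF, ea, eb]
    simp only [F, map_add, Derivation.leibniz, Derivation.leibniz_pow, Derivation.map_natCast,
      smul_zero, add_zero, smul_add, ← Nat.cast_smul_eq_nsmul W, smul_smul, mul_pow]
    simp only [hpow]
    module
  have halg (c : C) : F (algebraMap C W c) = 0 := by
    obtain ⟨y, z, rfl⟩ := hC c
    rw [map_add, map_mul, map_pow, map_natCast, hF]
    simp
  let d : Derivation C W (Ω[W⁄C]) := Derivation.mk'
    { toFun := F
      map_add' := hadd
      map_smul' c x := by
        rw [Algebra.smul_def, hmul, halg, smul_zero, add_zero, algebraMap_smul, RingHom.id_apply] }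
    hmul
  have key (η : Ω[W⁄C]) : (p : W) • d.liftKaehlerDifferential η = η := by
    rw [← map_smul]
    have : d.liftKaehlerDifferential ∘ₗ LinearMap.lsmul W _ (p : W) = LinearMap.id := by
      apply Derivation.liftKaehlerDifferential_unique
      ext x
      have h := hF 0 x
      rw [zero_pow hp.ne_zero, zero_add, map_zero, smul_zero, zero_add] at h
      have h2 : d.liftKaehlerDifferential (D C W (p * x)) = D C W x := by
        rw [Derivation.liftKaehlerDifferential_comp_D]; exact h
      simpa [Derivation.leibniz] using h2
    exact LinearMap.congr_fun this η
  rw [← key ω, ← map_smul, hω, map_zero]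

end Frobenius
end
section
open KaehlerDifferential

namespace KaehlerDifferential

variable {R A B T : Type*} [CommRing R] [CommRing A] [CommRing B] [CommRing T]
  [Algebra R A] [Algebra R B] [Algebra R T]

/-- The additive map `Ω[A⁄R] → Ω[B⁄R]` induced by an `R`-algebra homomorphism `A → B`. -/
noncomputable def mapAlgHom (f : A →ₐ[R] B) : Ω[A⁄R] →+ Ω[B⁄R] :=
  letI := f.toAlgebra
  (KaehlerDifferential.map R R A B).toAddMonoidHom

theorem mapAlgHom_smul (f : A →ₐ[R] B) (a : A) (ω : Ω[A⁄R]) :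
    mapAlgHom f (a • ω) = f a • mapAlgHom f ω := by
  let _ := f.toAlgebra
  exact (KaehlerDifferential.map R R A B).map_smul a ω

theorem mapAlgHom_D (f : A →ₐ[R] B) (a : A) : mapAlgHom f (D R A a) = D R B (f a) := by
  let _ := f.toAlgebra
  exact KaehlerDifferential.map_D R R A B a

theorem mapAlgHom_eq_map [Algebra A B] [IsScalarTower R A B] (ω : Ω[A⁄R]) :
    mapAlgHom (IsScalarTower.toAlgHom R A B) ω = KaehlerDifferential.map R R A B ω := by
  obtain ⟨m, rfl⟩ := linearCombination_surjective R A ω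
  induction m using Finsupp.induction_linear with
  | zero => simp
  | add m n hm hn => simp only [map_add, hm, hn]
  | single a b => simp [mapAlgHom_smul, mapAlgHom_D, algebraMap_smul]

theorem mapAlgHom_linearCombination (f : A →ₐ[R] B) (m : A →₀ A) :
    mapAlgHom f (Finsupp.linearCombination A (D R A) m) =
      Finsupp.linearCombination B (D R B)
        (Finsupp.mapRange f (map_zero f) (Finsupp.mapDomain f m)) := by
  induction m using Finsupp.induction_linear with
  | zero => simp
  | add m n hm hn =>
    rw [Finsupp.mapDomain_add, Finsupp.mapRange_add (map_add f)]
    simp only [map_add, hm, hn]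
  | single a b =>
    simp [Finsupp.mapDomain_single, mapAlgHom_smul, mapAlgHom_D]

theorem mapAlgHom_comp (g : B →ₐ[R] T) (f : A →ₐ[R] B) (ω : Ω[A⁄R]) :
    mapAlgHom (g.comp f) ω = mapAlgHom g (mapAlgHom f ω) := by
  obtain ⟨m, rfl⟩ := linearCombination_surjective R A ω
  induction m using Finsupp.induction_linear with
  | zero => simp
  | add m n hm hn => simp only [map_add, hm, hn]
  | single a b => simp [mapAlgHom_smul, mapAlgHom_D]

theorem mapAlgHom_id (ω : Ω[A⁄R]) : mapAlgHom (AlgHom.id R A) ω = ω := by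
  obtain ⟨m, rfl⟩ := linearCombination_surjective R A ω
  induction m using Finsupp.induction_linear with
  | zero => simp
  | add m n hm hn => simp only [map_add, hm, hn]
  | single a b => simp [mapAlgHom_smul, mapAlgHom_D]

theorem mapAlgHom_injective_of_bijective {f : A →ₐ[R] B} (hf : Function.Bijective f) :
    Function.Injective (mapAlgHom f) := by
  let e := AlgEquiv.ofBijective f hf
  refine Function.LeftInverse.injective (g := mapAlgHom e.symm.toAlgHom) fun ω => ?_
  rw [← mapAlgHom_comp, show e.symm.toAlgHom.comp f = AlgHom.id R A from
    AlgHom.ext e.symm_apply_apply, mapAlgHom_id]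

theorem exists_finset_forall_mem_kerTotal {n : T →₀ T} (hn : n ∈ kerTotal R T) :
    ∃ F : Finset T, ∀ (B : Type _) [CommRing B] [Algebra R B] (h : B →ₐ[R] T),
      Function.Injective h → (F : Set T) ⊆ Set.range h →
      ∃ n' ∈ kerTotal R B, Finsupp.mapRange h (map_zero h) (Finsupp.mapDomain h n') = n := by
  classical
  rw [kerTotal] at hn
  induction hn using Submodule.span_induction with
  | mem x hx =>
    rcases hx with (⟨⟨x, y⟩, rfl⟩ | ⟨⟨x, y⟩, rfl⟩) | ⟨x, rfl⟩
    · refine ⟨{x, y}, fun B _ _ h hh hF => ?_⟩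
      simp only [Finset.coe_insert, Finset.coe_singleton, Set.insert_subset_iff,
        Set.singleton_subset_iff] at hF
      obtain ⟨⟨x, rfl⟩, ⟨y, rfl⟩⟩ := hF
      refine ⟨_, Submodule.subset_span (.inl (.inl ⟨⟨x, y⟩, rfl⟩)), ?_⟩
      simp [sub_eq_add_neg, Finsupp.mapDomain_add, Finsupp.mapRange_add,
        Finsupp.mapDomain_single, ← Finsupp.single_neg]
    · refine ⟨{x, y}, fun B _ _ h hh hF => ?_⟩
      simp only [Finset.coe_insert, Finset.coe_singleton, Set.insert_subset_iff,
        Set.singleton_subset_iff] at hF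
      obtain ⟨⟨x, rfl⟩, ⟨y, rfl⟩⟩ := hF
      refine ⟨_, Submodule.subset_span (.inl (.inr ⟨⟨x, y⟩, rfl⟩)), ?_⟩
      simp [sub_eq_add_neg, Finsupp.mapDomain_add, Finsupp.mapRange_add,
        Finsupp.mapDomain_single, ← Finsupp.single_neg]
    · refine ⟨∅, fun B _ _ h hh hF => ?_⟩
      refine ⟨_, Submodule.subset_span (.inr ⟨x, rfl⟩), ?_⟩
      simp [Finsupp.mapDomain_single]
  | zero => exact ⟨∅, fun B _ _ h _ _ => ⟨0, zero_mem _, by simp⟩⟩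
  | add x y _ _ hx hy =>
    obtain ⟨F, hF⟩ := hx
    obtain ⟨G, hG⟩ := hy
    refine ⟨F ∪ G, fun B _ _ h hh hFG => ?_⟩
    rw [Finset.coe_union, Set.union_subset_iff] at hFG
    obtain ⟨x', hx', rfl⟩ := hF B h hh hFG.1
    obtain ⟨y', hy', rfl⟩ := hG B h hh hFG.2
    exact ⟨x' + y', add_mem hx' hy', by rw [Finsupp.mapDomain_add, Finsupp.mapRange_add (map_add h)]⟩
  | smul t x _ hx =>
    obtain ⟨F, hF⟩ := hx
    refine ⟨insert t F, fun B _ _ h hh hFG => ?_⟩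
    rw [Finset.coe_insert, Set.insert_subset_iff] at hFG
    obtain ⟨x', hx', rfl⟩ := hF B h hh hFG.2
    obtain ⟨t', rfl⟩ := hFG.1
    refine ⟨t' • x', Submodule.smul_mem _ _ hx', ?_⟩
    rw [Finsupp.mapDomain_smul,
      Finsupp.mapRange_smul' (c := t') (d := h t') (hsmul := fun x => by simp)]

/-- If a differential form vanishes in `Ω[T⁄R]`, then it vanishes in `Ω[B⁄R]` for every subalgebra
`B` of `T` containing a suitable finite set. -/
theorem exists_finset_forall_mapAlgHom_eq_zero (f : A →ₐ[R] T) {ω : Ω[A⁄R]}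
    (hω : mapAlgHom f ω = 0) :
    ∃ F : Finset T, ∀ (B : Type _) [CommRing B] [Algebra R B] (h : B →ₐ[R] T),
      Function.Injective h → (F : Set T) ⊆ Set.range h → ∀ g : A →ₐ[R] B, h.comp g = f →
      mapAlgHom g ω = 0 := by
  obtain ⟨m, rfl⟩ := linearCombination_surjective R A ω
  rw [mapAlgHom_linearCombination, ← LinearMap.mem_ker, kerTotal_eq] at hω
  obtain ⟨F, hF⟩ := exists_finset_forall_mem_kerTotal hω
  refine ⟨F, fun B _ _ h hh hFB g hg => ?_⟩
  obtain ⟨n, hn, hnm⟩ := hF B h hh hFB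
  rw [mapAlgHom_linearCombination, ← LinearMap.mem_ker, kerTotal_eq]
  convert! hn
  apply Finsupp.mapDomain_injective hh
  apply Finsupp.mapRange_injective h (map_zero h) hh
  rw [hnm, ← hg]
  clear hω hF hnm
  induction m using Finsupp.induction_linear with
  | zero => simp
  | add m n hm hn => simp only [Finsupp.mapDomain_add, Finsupp.mapRange_add (map_add _), hm, hn]
  | single a b => simp [Finsupp.mapDomain_single]

end KaehlerDifferential
open KaehlerDifferential Polynomial
open scoped TensorProduct

theorem Algebra.H1Cotangent.subsingleton_of_ker_aeval {W B : Type*} [CommRing W] [CommRing B]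
    [IsDomain B] [Algebra W B] {b : B} (hb : Function.Surjective (aeval (R := W) b)) {f : W[X]}
    (hf0 : aeval b f = 0) (hf : ∀ g : W[X], aeval b g = 0 → f ∣ g)
    (hf' : aeval b (derivative f) ≠ 0) : Subsingleton (Algebra.H1Cotangent W B) := by
  let _ : Algebra W[X] B := (aeval b).toAlgebra
  have halg (q : W[X]) : algebraMap W[X] B q = aeval b q := rfl
  have : IsScalarTower W W[X] B := IsScalarTower.of_algebraMap_eq' (aeval b).comp_algebraMap.symm
  rw [← Algebra.FormallySmooth.kerCotangentToTensor_injective_iff (R := W) (P := W[X]) hb]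
  rw [injective_iff_map_eq_zero]
  intro x hx
  obtain ⟨⟨x, hxk⟩, rfl⟩ := Ideal.toCotangent_surjective _ x
  obtain ⟨g, rfl⟩ := hf x hxk
  rw [kerCotangentToTensor_toCotangent] at hx
  let φ := (_root_.TensorProduct.rid W[X] B).toLinearMap ∘ₗ
    LinearMap.lTensor B (polynomialEquiv W).toLinearMap
  have h := congr_arg φ hx
  have hg : aeval b g = 0 := by
    simpa [φ, polynomialEquiv_D, Algebra.smul_def, halg, hf0, hf'] using h
  rw [Ideal.toCotangent_eq_zero]
  rw [pow_two]
  exact Ideal.mul_mem_mul hf0 hg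

theorem KaehlerDifferential.tmul_eq_zero_of_isIntegral {C W W' : Type*} [CommRing C] [CommRing W]
    [IsDomain W] [IsIntegrallyClosed W] [CharZero W] [CommRing W'] [IsDomain W'] [Algebra C W]
    [Algebra C W'] [Algebra W W'] [IsScalarTower C W W'] [FaithfulSMul W W'] {t : W'}
    (ht : IsIntegral W t) {ω : Ω[W⁄C]}
    (hω : KaehlerDifferential.map C C W (Algebra.adjoin W {t}) ω = 0) :
    (1 : Algebra.adjoin W {t}) ⊗ₜ[W] ω = 0 := by
  have hmin (g : W[X]) (hg : aeval t g = 0) : minpoly W t ∣ g :=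
    minpoly.isIntegrallyClosed_dvd ht hg
  let b : Algebra.adjoin W {t} := ⟨t, Algebra.self_mem_adjoin_singleton W t⟩
  have hab (g : W[X]) : ((aeval b g : Algebra.adjoin W {t}) : W') = aeval t g := by
    rw [← Subalgebra.coe_val, ← aeval_algHom_apply]; rfl
  have hinj : Function.Injective ((↑) : Algebra.adjoin W {t} → W') := Subtype.val_injective
  have hsub : Subsingleton (Algebra.H1Cotangent W (Algebra.adjoin W {t})) := by
    apply Algebra.H1Cotangent.subsingleton_of_ker_aeval (b := b) (f := minpoly W t)
    · rintro ⟨x, hx⟩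
      rw [Algebra.adjoin_singleton_eq_range_aeval] at hx
      obtain ⟨q, rfl⟩ := hx
      exact ⟨q, hinj (hab q)⟩
    · apply hinj
      rw [hab, minpoly.aeval]; rfl
    · intro g hg
      apply hmin
      rw [← hab, hg]; rfl
    · intro h
      have h1 : aeval t (derivative (minpoly W t)) = 0 := by rw [← hab, h]; rfl
      have h2 := hmin _ h1
      have hpos := minpoly.natDegree_pos ht
      have hne : derivative (minpoly W t) ≠ 0 := by
        rwa [Ne, Polynomial.derivative_eq_zero, ← Ne, ← Nat.pos_iff_ne_zero]
      have := Polynomial.natDegree_le_of_dvd h2 hne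
      have := Polynomial.natDegree_derivative_lt hpos.ne'
      omega
  have hex := Algebra.H1Cotangent.exact_δ_mapBaseChange C W (Algebra.adjoin W {t})
  obtain ⟨y, hy⟩ := (hex (1 ⊗ₜ ω)).mp (by rw [mapBaseChange_tmul, hω, smul_zero])
  rw [← hy, Subsingleton.elim y 0, map_zero]

theorem KaehlerDifferential.eq_zero_of_map_adjoin_eq_zero {C W W' : Type*} [CommRing C]
    [CommRing W] [IsDomain W] [ValuationRing W] [CharZero W] [CommRing W'] [IsDomain W']
    [IsLocalRing W'] [Algebra C W] [Algebra C W'] [Algebra W W'] [IsScalarTower C W W']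
    [FaithfulSMul W W'] [IsLocalHom (algebraMap W W')] {t : W'} (ht : IsIntegral W t)
    {ω : Ω[W⁄C]} (hω : KaehlerDifferential.map C C W (Algebra.adjoin W {t}) ω = 0) : ω = 0 := by
  have h0 := tmul_eq_zero_of_isIntegral ht hω
  have : Module.Flat W W' := by
    rw [Module.Flat.flat_iff_torsion_eq_bot_of_isBezout,
      ← Submodule.isTorsionFree_iff_torsion_eq_bot]
    infer_instance
  have : Module.FaithfullyFlat W W' := Module.FaithfullyFlat.of_flat_of_isLocalHom
  apply Module.FaithfullyFlat.tensorProduct_mk_injective (A := W) (B := W') (Ω[W⁄C])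
  have := congr_arg (LinearMap.rTensor (Ω[W⁄C]) (Algebra.adjoin W {t}).val.toLinearMap) h0
  simpa using this

/-- An injective local homomorphism from a valuation ring of characteristic zero, through which the
target is a filtered union of monogenic integral extensions, induces an injection on
differentials. -/
theorem KaehlerDifferential.mapAlgHom_injective_of_monogenic {C W W' : Type*} [CommRing C]
    [CommRing W] [IsDomain W] [ValuationRing W] [CharZero W] [CommRing W'] [IsDomain W']
    [IsLocalRing W'] [Algebra C W] [Algebra C W'] (j : W →ₐ[C] W') (hj : Function.Injective j)
    (hloc : ∀ x : W, IsUnit (j x) → IsUnit x)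
    (hfin : ∀ F : Finset W', ∃ t : W', j.toRingHom.IsIntegralElem t ∧
      ∀ x ∈ F, ∃ q : W[X], x = q.eval₂ j.toRingHom t) :
    Function.Injective (mapAlgHom j) := by
  let _ := j.toAlgebra
  have : IsScalarTower C W W' := IsScalarTower.of_algebraMap_eq' j.comp_algebraMap.symm
  have : FaithfulSMul W W' := (faithfulSMul_iff_algebraMap_injective W W').mpr hj
  have : IsLocalHom (algebraMap W W') := ⟨hloc⟩
  rw [injective_iff_map_eq_zero]
  intro ω hω
  obtain ⟨F, hF⟩ := exists_finset_forall_mapAlgHom_eq_zero j hω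
  obtain ⟨t, ht, hFt⟩ := hfin F
  apply KaehlerDifferential.eq_zero_of_map_adjoin_eq_zero (t := t) ht
  rw [← mapAlgHom_eq_map]
  refine hF (Algebra.adjoin W {t}) ((Algebra.adjoin W {t}).val.restrictScalars C)
    Subtype.val_injective ?_ _ rfl
  intro x hx
  obtain ⟨q, rfl⟩ := hFt x hx
  refine ⟨⟨_, ?_⟩, rfl⟩
  rw [Algebra.adjoin_singleton_eq_range_aeval]
  exact ⟨q, rfl⟩
end
section
open Polynomial

/-- In a group with an order-preserving grading by `ZMod p` whose elements of nonzero degree have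
nontrivial value, finitely many small elements of nonzero degree are multiples, by small elements of
degree zero, of powers of a single small element. -/
theorem exists_forall_le_pow_of_zmod_grading {G Γ : Type*} [CommGroup G] [CommGroup Γ]
    [LinearOrder Γ] [IsOrderedMonoid Γ] {p : ℕ} [Fact p.Prime] (v : G →* Γ)
    (κ : Additive G →+ ZMod p) (hκ : ∀ g : G, v g = 1 → κ (.ofMul g) = 0)
    (S : Finset G) (hS : S.Nonempty) (hS1 : ∀ s ∈ S, v s < 1) (hS0 : ∀ s ∈ S, κ (.ofMul s) ≠ 0) :
    ∃ δ : G, v δ < 1 ∧ κ (.ofMul δ) ≠ 0 ∧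
      ∀ s ∈ S, ∃ i : ℕ, κ (.ofMul s) = i * κ (.ofMul δ) ∧ v s ≤ v δ ^ i := by
  have key : ∃ k : ZMod p, k ≠ 0 ∧ ∀ s : G, v s < 1 → κ (.ofMul s) ≠ 0 →
      ∃ δ : G, v δ < 1 ∧ κ (.ofMul δ) = k ∧
        ∃ i : ℕ, κ (.ofMul s) = i * k ∧ v s ≤ v δ ^ i := by
    by_contra! hbad
    have hex (k : ZMod p) (hk : k ≠ 0) : ∃ n : ℕ, n < p ∧ ∃ s : G, v s < 1 ∧
        κ (.ofMul s) ≠ 0 ∧ κ (.ofMul s) = n * k ∧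
          ∀ δ : G, v δ < 1 → κ (.ofMul δ) = k → v δ ^ n < v s := by
      obtain ⟨s, hs1, hs0, hs⟩ := hbad k hk
      refine ⟨(κ (.ofMul s) / k).val, ZMod.val_lt _, s, hs1, hs0, ?_, fun δ hδ hδk => ?_⟩
      · rw [ZMod.natCast_zmod_val, div_mul_cancel₀ _ hk]
      · exact hs δ hδ hδk _ (by rw [ZMod.natCast_zmod_val, div_mul_cancel₀ _ hk])
    classical
    have hmin (k : ZMod p) : ∃ (n : ℕ) (s : G), k ≠ 0 → n < p ∧ v s < 1 ∧
        κ (.ofMul s) ≠ 0 ∧ κ (.ofMul s) = n * k ∧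
          (∀ δ : G, v δ < 1 → κ (.ofMul δ) = k → v δ ^ n < v s) ∧
          ∀ m < n, ∀ s' : G, v s' < 1 → κ (.ofMul s') ≠ 0 → κ (.ofMul s') = m * k →
            ∃ δ : G, v δ < 1 ∧ κ (.ofMul δ) = k ∧ v s' ≤ v δ ^ m := by
      by_cases hk : k = 0
      · exact ⟨0, 1, fun h => (h hk).elim⟩
      · obtain ⟨hn, s, hs1, hs0, hsn, hs⟩ := Nat.find_spec (hex k hk)
        refine ⟨Nat.find (hex k hk), s, fun _ => ⟨hn, hs1, hs0, hsn, hs, ?_⟩⟩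
        intro m hm s' hs1' hs0' hsm'
        by_contra! h
        exact Nat.find_min (hex k hk) hm ⟨hm.trans hn, s', hs1', hs0', hsm', h⟩
    choose n s hns using hmin
    obtain ⟨k, hk, hkmax⟩ := Finset.exists_max_image (Finset.univ.filter fun k : ZMod p => k ≠ 0)
      (fun k => v (s k)) ⟨1, by simp⟩
    replace hk : k ≠ 0 := by simpa using hk
    replace hkmax (k' : ZMod p) (hk' : k' ≠ 0) : v (s k') ≤ v (s k) := hkmax k' (by simpa using hk')
    obtain ⟨-, hsk1, hsk0, -, -, -⟩ := hns k hk
    set k' := κ (.ofMul (s k)) with hk'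
    obtain ⟨hn, hs1, hs0, hsn, hs, hsmin⟩ := hns k' hsk0
    have hle := hkmax k' hsk0
    have hlt := hs (s k) hsk1 hk'.symm
    have hn2 : 2 ≤ n k' := by
      by_contra! h
      interval_cases hh : n k'
      · simp at hsn
        exact hs0 hsn
      · rw [pow_one] at hlt
        exact absurd hlt hle.not_gt
    obtain ⟨m, hm⟩ : ∃ m, n k' = m + 1 := ⟨n k' - 1, by omega⟩
    have hκm : κ (.ofMul (s k' / s k)) = m * k' := by
      rw [ofMul_div, map_sub, hsn, ← hk', hm]
      push_cast
      ring
    have hκ0 : κ (.ofMul (s k' / s k)) ≠ 0 := by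
      rw [hκm]
      refine mul_ne_zero ?_ hsk0
      rw [Ne, ZMod.natCast_eq_zero_iff]
      exact Nat.not_dvd_of_pos_of_lt (by omega) (by omega)
    have hv1 : v (s k' / s k) < 1 := by
      refine lt_of_le_of_ne ?_ fun h => hκ0 (hκ _ h)
      rw [_root_.map_div]
      exact div_le_one'.mpr hle
    obtain ⟨δ, hδ1, hδk, hδ⟩ := hsmin m (by omega) _ hv1 hκ0 hκm
    rw [_root_.map_div, div_le_iff_le_mul] at hδ
    have h1 := hs δ hδ1 hδk
    rw [hm, pow_succ] at h1 hlt
    rcases le_total (v (s k)) (v δ) with h | h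
    · exact absurd (hδ.trans (mul_le_mul_right h _)) h1.not_ge
    · exact absurd (hδ.trans (mul_le_mul_left (pow_le_pow_left' h m) _)) hlt.not_ge
  obtain ⟨k, hk, hkey⟩ := key
  have hkey' (s : G) : ∃ (δ : G) (i : ℕ), s ∈ S → v δ < 1 ∧ κ (.ofMul δ) = k ∧
      κ (.ofMul s) = i * k ∧ v s ≤ v δ ^ i := by
    by_cases hs : s ∈ S
    · obtain ⟨δ, h1, h2, i, h3, h4⟩ := hkey s (hS1 s hs) (hS0 s hs)
      exact ⟨δ, i, fun _ => ⟨h1, h2, h3, h4⟩⟩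
    · exact ⟨1, 0, fun h => (hs h).elim⟩
  choose δ i hδ using hkey'
  obtain ⟨s₀, hs₀, hmax⟩ := Finset.exists_max_image S (fun s => v (δ s)) hS
  obtain ⟨h1, h2, -, -⟩ := hδ s₀ hs₀
  refine ⟨δ s₀, h1, h2 ▸ hk, fun s hs => ⟨i s, ?_, ?_⟩⟩
  · rw [h2]; exact (hδ s hs).2.2.1
  · exact (hδ s hs).2.2.2.trans (pow_le_pow_left' (hmax s hs) _)

section Ramified

variable {M K Γ₀ : Type*} [Field M] [Field K] [Algebra M K] [LinearOrderedCommGroupWithZero Γ₀]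
  {v : Valuation K Γ₀} {p : ℕ} {y : K} {b : M}

theorem Valuation.dvd_of_map_mul_zpow_eq_one (hp : p.Prime) (hy : y ^ p = algebraMap M K b)
    (hb0 : b ≠ 0) (hb : ∀ m : M, v (algebraMap M K m) ^ p ≠ v (algebraMap M K b)) {h : M}
    {j : ℤ} (hj : v (algebraMap M K h * y ^ j) = 1) : (p : ℤ) ∣ j := by
  have hy0 : y ≠ 0 := by
    rintro rfl
    rw [zero_pow hp.ne_zero] at hy
    exact hb0 ((map_eq_zero _).mp hy.symm)
  by_contra hpj
  have hcop : IsCoprime j (p : ℤ) :=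
    ((Nat.prime_iff_prime_int.mp hp).coprime_iff_not_dvd.mpr hpj).symm
  obtain ⟨r, s, hrs⟩ := hcop
  apply hb (h ^ (-r) * b ^ s)
  have e : y = (algebraMap M K h * y ^ j) ^ r * algebraMap M K (h ^ (-r) * b ^ s) := by
    have hh : algebraMap M K h ≠ 0 := by
      intro h0
      rw [h0, zero_mul, map_zero] at hj
      exact zero_ne_one hj
    rw [mul_zpow, map_mul, map_zpow₀, map_zpow₀, ← hy, ← zpow_mul, ← zpow_natCast, ← zpow_mul]
    have : y = y ^ (j * r + p * s) := by rw [mul_comm j, mul_comm (p : ℤ), hrs, zpow_one]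
    rw [zpow_add₀ hy0] at this
    rw [zpow_neg]
    field_simp
    exact this
  have e' := congr_arg v e
  rw [map_mul, map_zpow₀, hj, one_zpow, one_mul] at e'
  rw [← hy, map_pow v y, ← e']

theorem Valuation.map_coeff_mul_pow_le_one (hp : p.Prime) (hy : y ^ p = algebraMap M K b)
    (hb0 : b ≠ 0) (hb : ∀ m : M, v (algebraMap M K m) ^ p ≠ v (algebraMap M K b)) {g : M[X]}
    (hg : g.natDegree < p) (hv : v (aeval y g) ≤ 1) (j : ℕ) :
    v (algebraMap M K (g.coeff j) * y ^ j) ≤ 1 := by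
  have hy0 : y ≠ 0 := by
    rintro rfl
    rw [zero_pow hp.ne_zero] at hy
    exact hb0 ((map_eq_zero _).mp hy.symm)
  have hsum : aeval y g = ∑ j ∈ Finset.range p, algebraMap M K (g.coeff j) * y ^ j := by
    rw [aeval_eq_sum_range' hg]
    simp [Algebra.smul_def]
  rcases lt_or_ge j p with hjp | hjp
  · obtain ⟨k, hk, hmax⟩ := Finset.exists_max_image (Finset.range p)
      (fun j => v (algebraMap M K (g.coeff j) * y ^ j)) ⟨j, Finset.mem_range.mpr hjp⟩
    refine (hmax j (Finset.mem_range.mpr hjp)).trans ?_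
    by_cases hk0 : v (algebraMap M K (g.coeff k) * y ^ k) = 0
    · rw [hk0]; exact zero_le_one
    rw [hsum, v.map_sum_eq_of_lt hk] at hv
    · exact hv
    intro i hi
    rw [Finset.mem_sdiff, Finset.mem_singleton] at hi
    refine lt_of_le_of_ne (hmax i hi.1) fun heq => ?_
    have hdvd := Valuation.dvd_of_map_mul_zpow_eq_one (v := v) (j := (i : ℤ) - k)
      (h := g.coeff i / g.coeff k) hp hy hb0 hb (by
        rw [map_div₀, zpow_sub₀ hy0, zpow_natCast, zpow_natCast, div_mul_div_comm, map_div₀, heq,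
          div_self hk0])
    have h1 := Finset.mem_range.mp hi.1
    have h2 := Finset.mem_range.mp hk
    have := Int.eq_zero_of_abs_lt_dvd hdvd (by rw [abs_lt]; omega)
    omega
  · rw [coeff_eq_zero_of_natDegree_lt (hg.trans_le hjp)]
    simp

theorem exists_natDegree_lt_aeval_eq (hp : p.Prime) (hy : y ^ p = algebraMap M K b) (g : M[X]) :
    ∃ g' : M[X], g'.natDegree < p ∧ aeval y g' = aeval y g := by
  refine ⟨g %ₘ (X ^ p - C b), ?_, ?_⟩
  · have := natDegree_modByMonic_lt g (monic_X_pow_sub_C b hp.ne_zero) (by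
      intro h
      have := congr_arg natDegree h
      rw [natDegree_X_pow_sub_C, natDegree_one] at this
      exact hp.ne_zero this)
    rwa [natDegree_X_pow_sub_C] at this
  · conv_rhs => rw [← modByMonic_add_div g (X ^ p - C b)]
    simp [hy]

/-- Extracting a `p`-th root of an element whose value is not a `p`-th power gives a valuation ring
that is a filtered union of monogenic integral extensions. -/
theorem Valuation.exists_adjoin_of_forall_pow_ne (hp : p.Prime)
    (hy : y ^ p = algebraMap M K b) (hb0 : b ≠ 0)
    (hb : ∀ m : M, v (algebraMap M K m) ^ p ≠ v (algebraMap M K b))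
    {A : Type*} [CommRing A] [Algebra A K] {W : Subalgebra A K}
    (hW : ∀ m : M, v (algebraMap M K m) ≤ 1 → algebraMap M K m ∈ W) (F : Finset K)
    (hF : ∀ x ∈ F, v x ≤ 1 ∧ ∃ g : M[X], x = aeval y g) :
    ∃ t : K, v t ≤ 1 ∧ (∃ g : M[X], t = aeval y g) ∧ IsIntegral W t ∧
      ∀ x ∈ F, x ∈ Algebra.adjoin W {t} := by
  classical
  have hy0 : y ≠ 0 := by
    rintro rfl
    rw [zero_pow hp.ne_zero] at hy
    exact hb0 ((map_eq_zero _).mp hy.symm)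
  have : Fact p.Prime := ⟨hp⟩
  have hg' (x : K) : ∃ g : M[X], x ∈ F → g.natDegree < p ∧ aeval y g = x := by
    by_cases hx : x ∈ F
    · obtain ⟨-, g, rfl⟩ := hF x hx
      obtain ⟨g', hg'⟩ := exists_natDegree_lt_aeval_eq hp hy g
      exact ⟨g', fun _ => hg'⟩
    · exact ⟨0, fun h => (hx h).elim⟩
  choose g hg using hg'
  let val : Mˣ × Multiplicative ℤ →* Γ₀ˣ :=
    (Units.map ((v : K →* Γ₀).comp (algebraMap M K : M →* K))).coprod
      (zpowersHom _ (Units.map (v : K →* Γ₀) (Units.mk0 y hy0)))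
  have hval (h : Mˣ) (j : ℤ) : ((val (h, .ofAdd j) : Γ₀ˣ) : Γ₀) =
      v (algebraMap M K h * y ^ j) := by
    simp [val, zpowersHom_apply]
  let κ : Additive (Mˣ × Multiplicative ℤ) →+ ZMod p :=
    (Int.castAddHom (ZMod p)).comp (MonoidHom.toAdditive (MonoidHom.snd Mˣ (Multiplicative ℤ)))
  have hκ (h : Mˣ) (j : ℤ) : κ (.ofMul (h, .ofAdd j)) = j := rfl
  let P : Finset (K × ℕ) := (F ×ˢ Finset.Ico 1 p).filter fun q => (g q.1).coeff q.2 ≠ 0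
  let e (q : K × ℕ) : Mˣ × Multiplicative ℤ :=
    if h : (g q.1).coeff q.2 ≠ 0 then (Units.mk0 _ h, .ofAdd (q.2 : ℤ)) else 1
  have hmemP (x : K) (j : ℕ) : (x, j) ∈ P ↔ (x ∈ F ∧ 1 ≤ j ∧ j < p) ∧ (g x).coeff j ≠ 0 := by
    simp [P]
  have hκP (q) (hq : q ∈ P) : κ (.ofMul (e q)) ≠ 0 := by
    obtain ⟨⟨_, h1, h2⟩, h3⟩ := (hmemP q.1 q.2).mp hq
    simp only [e, dif_pos h3, hκ]
    rw [Int.cast_natCast, Ne, ZMod.natCast_eq_zero_iff]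
    exact Nat.not_dvd_of_pos_of_lt h1 h2
  have hκ1 (s : Mˣ × Multiplicative ℤ) (hs : val s = 1) : κ (.ofMul s) = 0 := by
    obtain ⟨h, j⟩ := s
    have := hval h j
    rw [show ((h, Multiplicative.ofAdd j) : Mˣ × Multiplicative ℤ) = (h, j) from rfl, hs,
      Units.val_one] at this
    exact (ZMod.intCast_zmod_eq_zero_iff_dvd _ p).mpr
      (Valuation.dvd_of_map_mul_zpow_eq_one hp hy hb0 hb this.symm)
  have hcoef (x) (hx : x ∈ F) (j : ℕ) : v (algebraMap M K ((g x).coeff j) * y ^ j) ≤ 1 :=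
    Valuation.map_coeff_mul_pow_le_one hp hy hb0 hb (hg x hx).1
      (by rw [(hg x hx).2]; exact (hF x hx).1) j
  have hvP (q) (hq : q ∈ P) : val (e q) < 1 := by
    refine lt_of_le_of_ne ?_ fun h => hκP q hq (hκ1 _ h)
    obtain ⟨⟨h0, h1, h2⟩, h3⟩ := (hmemP q.1 q.2).mp hq
    rw [← Units.val_le_val, Units.val_one]
    simp only [e, dif_pos h3, hval]
    rw [Units.val_mk0, zpow_natCast]
    exact hcoef _ h0 _
  have hxsum (x) (hx : x ∈ F) :
      x = ∑ j ∈ Finset.range p, algebraMap M K ((g x).coeff j) * y ^ j := by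
    conv_lhs => rw [← (hg x hx).2, aeval_eq_sum_range' (hg x hx).1]
    simp [Algebra.smul_def]
  have hWmem (m : M) (hm : v (algebraMap M K m) ≤ 1) (t : K) :
      algebraMap M K m ∈ Algebra.adjoin W {t} :=
    (Algebra.adjoin W {t}).algebraMap_mem ⟨_, hW m hm⟩
  have hsuff (t : K) (ht : ∀ q ∈ P, ∃ i : ℕ, ∃ m : M, v (algebraMap M K m) ≤ 1 ∧
      algebraMap M K ((g q.1).coeff q.2) * y ^ q.2 = algebraMap M K m * t ^ i) (x) (hx : x ∈ F) :
      x ∈ Algebra.adjoin W {t} := by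
    rw [hxsum x hx]
    refine sum_mem fun j hj => ?_
    rw [Finset.mem_range] at hj
    by_cases h0 : (g x).coeff j = 0
    · rw [h0, map_zero, zero_mul]; exact zero_mem _
    rcases Nat.eq_zero_or_pos j with rfl | hj0
    · have := hcoef x hx 0
      rw [pow_zero, mul_one] at this ⊢
      exact hWmem _ this t
    · obtain ⟨i, m, hm, h⟩ := ht (x, j) ((hmemP x j).mpr ⟨⟨hx, hj0, hj⟩, h0⟩)
      rw [h]
      exact mul_mem (hWmem m hm t) (pow_mem (Algebra.self_mem_adjoin_singleton W t) _)
  rcases P.eq_empty_or_nonempty with hP | hP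
  · refine ⟨0, by simp, ⟨0, by simp⟩, isIntegral_zero, hsuff 0 fun q hq => ?_⟩
    rw [hP] at hq
    simp at hq
  obtain ⟨⟨h', k⟩, hδ1, -, hδ⟩ := exists_forall_le_pow_of_zmod_grading val κ hκ1 (P.image e)
    (hP.image e) (Finset.forall_mem_image.mpr hvP) (Finset.forall_mem_image.mpr hκP)
  replace hδ := Finset.forall_mem_image.mp hδ
  rw [← Units.val_lt_val, Units.val_one] at hδ1
  have hvt : v (algebraMap M K h' * y ^ (k.toAdd)) < 1 := by rwa [← hval]
  set t := algebraMap M K h' * y ^ (k.toAdd) with ht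
  have ht0 : t ≠ 0 := mul_ne_zero (by simp) (zpow_ne_zero _ hy0)
  have htp : t ^ p = algebraMap M K (h' ^ p * b ^ (k.toAdd)) := by
    rw [ht, mul_pow, ← zpow_natCast, ← zpow_natCast, zpow_comm, zpow_natCast y, hy]
    simp
  refine ⟨t, hvt.le, ?_, ?_, hsuff t ?_⟩
  · refine ⟨Polynomial.C (h' * b ^ (k.toAdd / p)) * X ^ (k.toAdd % p).toNat, ?_⟩
    have hmod := Int.emod_nonneg k.toAdd (by exact_mod_cast hp.ne_zero : (p : ℤ) ≠ 0)
    rw [map_mul, aeval_C, map_pow, aeval_X, map_mul, map_zpow₀, ← hy, ht, mul_assoc,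
      ← zpow_natCast y p, ← zpow_mul, ← zpow_natCast y (Int.toNat _), Int.toNat_of_nonneg hmod,
      ← zpow_add₀ hy0, Int.mul_ediv_add_emod]
  · refine IsIntegral.of_pow hp.pos ?_
    rw [htp]
    refine isIntegral_algebraMap (R := W) (x := ⟨_, hW _ ?_⟩)
    rw [← htp, map_pow]
    exact pow_le_one₀ zero_le hvt.le
  · intro q hq
    obtain ⟨⟨h0, h1, h2⟩, h3⟩ := (hmemP q.1 q.2).mp hq
    obtain ⟨i, hi1, hi2⟩ := hδ hq
    rw [← Units.val_le_val, Units.val_pow_eq_pow_val] at hi2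
    simp only [e, dif_pos h3, hκ, hval, Units.val_mk0] at hi1 hi2
    rw [show val (h', k) = val (h', .ofAdd k.toAdd) from rfl, hval, ← ht, zpow_natCast] at hi2
    replace hi1 : ((q.2 : ℤ) : ZMod p) = i * ((k.toAdd : ℤ) : ZMod p) := hi1
    obtain ⟨r, hr⟩ : (p : ℤ) ∣ (q.2 : ℤ) - i * k.toAdd := by
      rw [← ZMod.intCast_zmod_eq_zero_iff_dvd]
      push_cast at hi1 ⊢
      rw [hi1, sub_self]
    have heq : algebraMap M K ((g q.1).coeff q.2) * y ^ q.2 =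
        algebraMap M K ((g q.1).coeff q.2 / h' ^ i * b ^ r) * t ^ i := by
      have : y ^ q.2 = algebraMap M K b ^ r * (y ^ k.toAdd) ^ i := by
        rw [← hy, ← zpow_natCast y p, ← zpow_mul, ← zpow_natCast _ i, ← zpow_mul,
          ← zpow_add₀ hy0, ← hr, ← zpow_natCast]
        congr 1
        ring
      rw [this, ht, mul_pow, map_mul, map_div₀, map_zpow₀, map_pow]
      have : algebraMap M K h' ≠ 0 := by simp
      field_simp
    refine ⟨i, _, ?_, heq⟩
    rw [heq, map_mul, map_pow] at hi2
    have hpos : 0 < v t ^ i := pow_pos (zero_lt_iff.mpr ((v.ne_zero_iff).mpr ht0)) _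
    exact le_of_mul_le_mul_right (hi2.trans (one_mul _).ge) hpos

end Ramified

theorem Valuation.exists_dominant_coeff_mul_add {K Γ₀ : Type*} [Field K]
    [LinearOrderedCommGroupWithZero Γ₀] {v : Valuation K Γ₀} {q g r : K[X]} {k : ℕ}
    (hq : ∃ j ≤ k, ∀ i, v (q.coeff i) ≤ v (q.coeff j))
    (hg0 : v (g.coeff 0) < v (g.coeff 1)) (hg : ∀ i, v (g.coeff i) ≤ v (g.coeff 1))
    (hr : ∀ i, v (r.coeff i) ≤ v (r.coeff 0)) :
    ∃ j ≤ k + 1, ∀ i, v ((q * g + r).coeff i) ≤ v ((q * g + r).coeff j) := by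
  classical
  obtain ⟨j, ⟨hjk, hj⟩, hmin⟩ : ∃ j, (j ≤ k ∧ ∀ i, v (q.coeff i) ≤ v (q.coeff j)) ∧
      ∀ i < j, ¬ (i ≤ k ∧ ∀ l, v (q.coeff l) ≤ v (q.coeff i)) :=
    ⟨Nat.find hq, Nat.find_spec hq, fun _ => Nat.find_min hq⟩
  have hlt (i) (hi : i < j) : v (q.coeff i) < v (q.coeff j) := by
    refine lt_of_not_ge fun h => hmin i hi ⟨hi.le.trans hjk, fun l => (hj l).trans h⟩
  have hg1 : 0 < v (g.coeff 1) := zero_le.trans_lt hg0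
  by_cases hqj : v (q.coeff j) = 0
  · have : q = 0 := by
      ext i
      simpa [hqj] using hj i
    exact ⟨0, Nat.zero_le _, by simpa [this] using hr⟩
  replace hqj : 0 < v (q.coeff j) := zero_lt_iff.mpr hqj
  have hle (i) : v ((q * g).coeff i) ≤ v (q.coeff j) * v (g.coeff 1) := by
    rw [coeff_mul]
    refine v.map_sum_le fun x _ => ?_
    rw [map_mul]
    exact mul_le_mul' (hj _) (hg _)
  have heq : v ((q * g).coeff (j + 1)) = v (q.coeff j) * v (g.coeff 1) := by
    rw [coeff_mul, v.map_sum_eq_of_lt (j := (j, 1)) (by simp), map_mul]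
    rintro ⟨a, c⟩ hac
    rw [Finset.mem_sdiff, Finset.HasAntidiagonal.mem_antidiagonal, Finset.mem_singleton,
      Prod.mk.injEq] at hac
    simp only at hac
    rw [map_mul, map_mul]
    rcases lt_or_ge a j with h | h
    · exact mul_lt_mul_of_lt_of_le_of_nonneg_of_pos (hlt a h) (hg c) zero_le hg1
    · obtain rfl : c = 0 := by omega
      exact mul_lt_mul_of_le_of_lt_of_nonneg_of_pos (hj a) hg0 zero_le hqj
  have hz : v ((q * g).coeff 0) < v (q.coeff j) * v (g.coeff 1) := by
    rw [mul_coeff_zero, map_mul]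
    exact mul_lt_mul_of_le_of_lt_of_nonneg_of_pos (hj 0) hg0 zero_le hqj
  rcases lt_or_ge (v (r.coeff 0)) (v (q.coeff j) * v (g.coeff 1)) with h | h
  · refine ⟨j + 1, by omega, fun i => ?_⟩
    have : v ((q * g + r).coeff (j + 1)) = v (q.coeff j) * v (g.coeff 1) := by
      rw [coeff_add, v.map_add_eq_of_lt_left, heq]
      rw [heq]
      exact (hr _).trans_lt h
    rw [this, coeff_add]
    exact v.map_add_le (hle i) ((hr i).trans h.le)
  · refine ⟨0, Nat.zero_le _, fun i => ?_⟩
    have : v ((q * g + r).coeff 0) = v (r.coeff 0) := by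
      rw [coeff_add, v.map_add_eq_of_lt_right (hz.trans_le h)]
    rw [this, coeff_add]
    exact v.map_add_le ((hle i).trans h) (hr i)

theorem Valuation.map_natCast_eq_one_of_lt {K Γ₀ : Type*} [Field K]
    [LinearOrderedCommGroupWithZero Γ₀] {v : Valuation K Γ₀} {p n : ℕ} (hp : p.Prime)
    (hvp : v p < 1) (hn0 : 0 < n) (hn : n < p) : v (n : K) = 1 := by
  have hcop : IsCoprime (n : ℤ) (p : ℤ) :=
    (Nat.isCoprime_iff_coprime).mpr
      (hp.coprime_iff_not_dvd.mpr (Nat.not_dvd_of_pos_of_lt hn0 hn)).symm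
  obtain ⟨r, s, h⟩ := hcop
  have hle (m : ℤ) : v (m : K) ≤ 1 := (v.mem_integer_iff _).mp (intCast_mem v.integer m)
  have h' := congr_arg (Int.cast : ℤ → K) h
  push_cast at h'
  have hs : v ((s : K) * p) < 1 := by
    rw [map_mul]
    exact (mul_le_of_le_one_left zero_le (hle s)).trans_lt hvp
  have h1 : v ((r : K) * n) = 1 := by
    rw [eq_sub_of_add_eq h', v.map_sub_eq_of_lt_left, map_one]
    rwa [map_one]
  refine le_antisymm (by simpa using hle n) ?_
  rw [← h1, map_mul]
  exact mul_le_of_le_one_left zero_le (hle r)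

theorem Valuation.map_pow_sub_pow_lt {K Γ₀ : Type*} [Field K]
    [LinearOrderedCommGroupWithZero Γ₀] {v : Valuation K Γ₀} {p : ℕ} (hp : p.Prime) {x y : K}
    (hx : v x ≤ 1) (hy : v y ≤ 1) (h : v p < v (x ^ p - y ^ p)) :
    v (x ^ p - y ^ p) = v (x - y) ^ p := by
  obtain ⟨r, hr⟩ := exists_add_pow_prime_eq hp (⟨x - y, v.map_sub_le hx hy⟩ : v.integer) ⟨y, hy⟩
  replace hr : (x - y + y) ^ p = (x - y) ^ p + y ^ p + p * (x - y) * y * r := by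
    simpa only [Subring.coe_add, Subring.coe_mul, Subring.coe_pow, Subring.coe_natCast] using
      congr_arg Subtype.val hr
  rw [sub_add_cancel] at hr
  have hr' : v ((p : K) * (x - y) * y * r) < v (x ^ p - y ^ p) := by
    refine lt_of_le_of_lt ?_ h
    rw [mul_assoc, mul_assoc, map_mul]
    refine mul_le_of_le_one_right zero_le ?_
    rw [map_mul, map_mul]
    exact mul_le_one' (v.map_sub_le hx hy) (mul_le_one' hy r.2)
  rw [← map_pow, ← v.map_sub_eq_of_lt_left hr', hr]
  ring_nf

section Immediate

variable {M K Γ₀ : Type*} [Field M] [Field K] [Algebra M K] [LinearOrderedCommGroupWithZero Γ₀]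

/-- The filter on `M` of approximations to `y : K` that are at least as good as a given one. -/
def Valuation.approxFilter (M : Type*) [Field M] [Algebra M K] (v : Valuation K Γ₀) (y : K) :
    Filter M :=
  ⨅ a₀ : M, Filter.principal {a | v (y - algebraMap M K a) ≤ v (y - algebraMap M K a₀)}

variable {v : Valuation K Γ₀} {p : ℕ} {y : K} {b : M}

theorem Valuation.eventually_approxFilter {P : M → Prop} :
    (∀ᶠ a in v.approxFilter M y, P a) ↔
      ∃ a₀, ∀ a, v (y - algebraMap M K a) ≤ v (y - algebraMap M K a₀) → P a := by
  rw [Filter.Eventually, approxFilter, Filter.mem_iInf_of_directed]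
  · simp [Set.subset_def]
  · intro a₁ a₂
    rcases le_total (v (y - algebraMap M K a₁)) (v (y - algebraMap M K a₂)) with h | h
    · exact ⟨a₁, by simp, by simpa using fun a ha => ha.trans h⟩
    · exact ⟨a₂, by simpa using fun a ha => ha.trans h, by simp⟩

theorem Valuation.eventually_approxFilter_le (a₀ : M) :
    ∀ᶠ a in v.approxFilter M y, v (y - algebraMap M K a) ≤ v (y - algebraMap M K a₀) :=
  Valuation.eventually_approxFilter.mpr ⟨a₀, fun _ h => h⟩

instance : (v.approxFilter M y).NeBot := by
  rw [← Filter.empty_mem_iff_bot.not.trans Filter.neBot_iff.symm]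
  intro h
  obtain ⟨a₀, ha₀⟩ := Valuation.eventually_approxFilter.mp (show ∀ᶠ a in _, a ∈ (∅ : Set M) from h)
  exact ha₀ a₀ le_rfl

/-- The polynomial `g (y + (y - a) X)`. -/
noncomputable def lineExpansion (y : K) (a : M) : M[X] →ₐ[M] K[X] :=
  aeval (C y + C (y - algebraMap M K a) * X)

theorem lineExpansion_coeff_zero (a : M) (g : M[X]) :
    (lineExpansion y a g).coeff 0 = aeval y g := by
  have := aeval_algHom_apply ((aeval (0 : K) : K[X] →ₐ[K] K).restrictScalars M)
    (C y + C (y - algebraMap M K a) * X) g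
  simp only [AlgHom.restrictScalars_apply] at this
  rw [coeff_zero_eq_aeval_zero, lineExpansion, ← this]
  simp

theorem lineExpansion_coeff_succ (a : M) (g : M[X]) (n : ℕ) :
    (lineExpansion y a g).coeff (n + 1) * (n + 1) =
      (y - algebraMap M K a) * (lineExpansion y a (derivative g)).coeff n := by
  have h (g : M[X]) : lineExpansion y a g =
      (g.map (algebraMap M K)).comp (C y + C (y - algebraMap M K a) * X) := by
    rw [lineExpansion, comp, eval₂_map, aeval_def]
    rfl
  rw [← coeff_derivative, h, h, derivative_comp]
  rw [derivative_add, derivative_C, zero_add, derivative_C_mul, derivative_X, mul_one, coeff_C_mul,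
    derivative_map]

theorem natDegree_lineExpansion_le (a : M) (g : M[X]) :
    (lineExpansion y a g).natDegree ≤ g.natDegree := by
  rw [lineExpansion, aeval_def]
  have h : (C y + C (y - algebraMap M K a) * X).natDegree ≤ 1 := by compute_degree
  have := natDegree_comp_le (p := g.map (algebraMap M K)) (q := C y + C (y - algebraMap M K a) * X)
  rw [comp, eval₂_map] at this
  refine (this.trans (Nat.mul_le_mul natDegree_map_le h)).trans (by simp)

theorem Valuation.map_lineExpansion_coeff_succ (hp : p.Prime) (hvp : v p < 1) {a : M} {g : M[X]}
    {i : ℕ} (hi : i + 1 < p) :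
    v ((lineExpansion y a g).coeff (i + 1)) =
      v (y - algebraMap M K a) * v ((lineExpansion y a (derivative g)).coeff i) := by
  rw [← map_mul, ← lineExpansion_coeff_succ, map_mul]
  have := Valuation.map_natCast_eq_one_of_lt (v := v) hp hvp (Nat.succ_pos i) hi
  push_cast at this
  rw [this, mul_one]

theorem Valuation.eventually_dominant_or (hp : p.Prime) (hvp : v p < 1) {g : M[X]}
    (hg : g.natDegree < p)
    (hg' : ∀ᶠ a in v.approxFilter M y, ∀ i,
      v ((lineExpansion y a (derivative g)).coeff i) ≤ v (aeval y (derivative g))) :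
    (∀ᶠ a in v.approxFilter M y, ∀ i, v ((lineExpansion y a g).coeff i) ≤ v (aeval y g)) ∨
    ∀ᶠ a in v.approxFilter M y, v (aeval y g) < v ((lineExpansion y a g).coeff 1) ∧
      ∀ i, v ((lineExpansion y a g).coeff i) ≤ v ((lineExpansion y a g).coeff 1) := by
  have hone (a : M) : v ((lineExpansion y a g).coeff 1) =
      v (y - algebraMap M K a) * v (aeval y (derivative g)) := by
    rw [← lineExpansion_coeff_zero a]
    exact Valuation.map_lineExpansion_coeff_succ hp hvp hp.one_lt
  have hle : ∀ᶠ a in v.approxFilter M y, ∀ i,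
      v ((lineExpansion y a g).coeff (i + 1)) ≤ v ((lineExpansion y a g).coeff 1) := by
    filter_upwards [hg'] with a ha i
    rcases lt_or_ge (i + 1) p with hi | hi
    · rw [Valuation.map_lineExpansion_coeff_succ hp hvp hi, hone]
      exact mul_le_mul_right (ha i) _
    · rw [coeff_eq_zero_of_natDegree_lt
        ((natDegree_lineExpansion_le a g).trans_lt (hg.trans_le hi))]
      simp
  by_cases h : ∃ a₀ : M, v (y - algebraMap M K a₀) * v (aeval y (derivative g)) ≤ v (aeval y g)
  · obtain ⟨a₀, h⟩ := h
    left
    filter_upwards [hle, Valuation.eventually_approxFilter_le a₀] with a h1 h2 i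
    rcases i with - | i
    · rw [lineExpansion_coeff_zero]
    · refine (h1 i).trans ?_
      rw [hone]
      exact (mul_le_mul_left h2 _).trans h
  · push Not at h
    right
    filter_upwards [hle] with a h1
    have h0 : v (aeval y g) < v ((lineExpansion y a g).coeff 1) := by rw [hone]; exact h a
    refine ⟨h0, fun i => ?_⟩
    rcases i with - | i
    · rw [lineExpansion_coeff_zero]; exact h0.le
    · exact h1 i

theorem Valuation.eventually_dominant_le {d : ℕ} (hd : 0 < d) {g : M[X]} (hgd : g.natDegree = d)
    (hlow : ∀ f : M[X], f.natDegree < d →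
      ∀ᶠ a in v.approxFilter M y, ∀ i, v ((lineExpansion y a f).coeff i) ≤ v (aeval y f))
    (hg : ∀ᶠ a in v.approxFilter M y, v (aeval y g) < v ((lineExpansion y a g).coeff 1) ∧
      ∀ i, v ((lineExpansion y a g).coeff i) ≤ v ((lineExpansion y a g).coeff 1))
    (k : ℕ) {f : M[X]} (hf : f.natDegree < d * (k + 1)) :
    ∀ᶠ a in v.approxFilter M y, ∃ j ≤ k, ∀ i,
      v ((lineExpansion y a f).coeff i) ≤ v ((lineExpansion y a f).coeff j) := by
  induction k generalizing f with
  | zero =>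
    filter_upwards [hlow f (by simpa using hf)] with a ha
    exact ⟨0, le_rfl, by simpa [lineExpansion_coeff_zero] using ha⟩
  | succ k ih =>
    have hg0 : g ≠ 0 := by rintro rfl; simp at hgd; omega
    have hmod : (f % g).natDegree < d := hgd ▸ natDegree_mod_lt f (by omega)
    have hfeq : f = f / g * g + f % g := by rw [mul_comm, EuclideanDomain.div_add_mod]
    have hdiv : (f / g).natDegree < d * (k + 1) := by
      by_cases h0 : f / g = 0
      · rw [h0, natDegree_zero]; positivity
      have h1 := natDegree_mul h0 hg0
      rw [eq_sub_of_add_eq hfeq.symm] at h1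
      have h2 := natDegree_sub_le f (f % g)
      have h3 : max f.natDegree (f % g).natDegree < d * (k + 1 + 1) :=
        max_lt hf (hmod.trans_le (Nat.le_mul_of_pos_right _ (by omega)))
      rw [mul_add d (k + 1)] at h3
      omega
    filter_upwards [ih hdiv, hg, hlow _ hmod] with a h1 h2 h3
    rw [hfeq, map_add, map_mul]
    refine Valuation.exists_dominant_coeff_mul_add h1 ?_ h2.2 ?_
    · rw [lineExpansion_coeff_zero]; exact h2.1
    · rw [lineExpansion_coeff_zero]; exact h3

theorem Valuation.eventually_le_one (hy : v y ≤ 1) :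
    ∀ᶠ a in v.approxFilter M y, v (algebraMap M K a) ≤ 1 := by
  filter_upwards [Valuation.eventually_approxFilter_le (0 : M)] with a ha
  rw [map_zero, sub_zero] at ha
  rw [← sub_sub_cancel y (algebraMap M K a)]
  exact v.map_sub_le hy (ha.trans hy)

theorem Valuation.eventually_map_pow_eq (hp : p.Prime) (hy : y ^ p = algebraMap M K b)
    (hvy : v y ≤ 1) (hb : ∀ a : M, v p < v (algebraMap M K b - algebraMap M K a ^ p)) :
    ∀ᶠ a in v.approxFilter M y,
      v (algebraMap M K b - algebraMap M K a ^ p) = v (y - algebraMap M K a) ^ p := by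
  filter_upwards [Valuation.eventually_le_one hvy] with a ha
  rw [← hy]
  exact Valuation.map_pow_sub_pow_lt hp hvy ha (by rw [hy]; exact hb a)

theorem Valuation.eventually_not_dominant (hp : p.Prime) (hy : y ^ p = algebraMap M K b)
    (hvy : v y ≤ 1) (hb : ∀ a : M, v p < v (algebraMap M K b - algebraMap M K a ^ p)) :
    ∀ᶠ a in v.approxFilter M y, ¬ ∃ j < p, ∀ i,
      v ((lineExpansion y a (X ^ p - C b)).coeff i) ≤
        v ((lineExpansion y a (X ^ p - C b)).coeff j) := by
  filter_upwards [Valuation.eventually_map_pow_eq hp hy hvy hb,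
    Valuation.eventually_le_one hvy] with a h1 ha
  rintro ⟨j, hj, h⟩
  have hz := hb a
  rw [h1] at hz
  have hvz : v (y - algebraMap M K a) ≤ 1 := v.map_sub_le hvy ha
  have hcoeff (i : ℕ) (hi : 0 < i) : (lineExpansion y a (X ^ p - C b)).coeff i =
      (y - algebraMap M K a) ^ i * (y ^ (p - i) * p.choose i) := by
    have : lineExpansion y a (X ^ p - C b) =
        ((X + C y) ^ p).comp (C (y - algebraMap M K a) * X) - C (algebraMap M K b) := by
      simp [lineExpansion, add_comm]
    rw [this, coeff_sub, comp_C_mul_X_coeff, coeff_X_add_C_pow, coeff_C, if_neg hi.ne', sub_zero,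
      mul_comm]
  have hpp := h p
  rw [hcoeff p hp.pos, Nat.sub_self, pow_zero, Nat.choose_self, Nat.cast_one, mul_one, mul_one,
    map_pow] at hpp
  refine absurd (hz.trans_le hpp) (not_lt_of_ge ?_)
  rcases Nat.eq_zero_or_pos j with rfl | hj0
  · rw [lineExpansion_coeff_zero]
    simp [hy]
  · obtain ⟨c, hc⟩ := hp.dvd_choose_self hj0.ne' hj
    rw [hcoeff j hj0, hc, Nat.cast_mul, map_mul, map_mul, map_mul, map_pow, map_pow]
    have hc1 : v (c : K) ≤ 1 := (v.mem_integer_iff _).mp (natCast_mem v.integer c)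
    calc v (y - algebraMap M K a) ^ j * (v y ^ (p - j) * (v p * v c))
        ≤ 1 * (1 * (v p * 1)) := by
          gcongr
          · exact pow_le_one₀ zero_le hvz
          · exact pow_le_one₀ zero_le hvy
      _ = v p := by simp

theorem Valuation.eventually_dominant (hp : p.Prime) (hvp : v p < 1)
    (hy : y ^ p = algebraMap M K b)
    (hvy : v y ≤ 1) (hb : ∀ a : M, v p < v (algebraMap M K b - algebraMap M K a ^ p))
    {g : M[X]} (hg : g.natDegree < p) :
    ∀ᶠ a in v.approxFilter M y, ∀ i, v ((lineExpansion y a g).coeff i) ≤ v (aeval y g) := by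
  induction hd : g.natDegree using Nat.strong_induction_on generalizing g with
  | _ d ih =>
  rcases lt_or_ge d 2 with hd2 | hd2
  · obtain ⟨c, e, rfl⟩ := exists_eq_X_add_C_of_natDegree_le_one (by omega : g.natDegree ≤ 1)
    by_cases hc : c = 0
    · subst hc
      refine .of_forall fun a i => ?_
      simp only [lineExpansion, map_zero, zero_mul, zero_add, aeval_C,
        Polynomial.algebraMap_apply, coeff_C]
      split_ifs <;> simp
    · filter_upwards [Valuation.eventually_approxFilter_le (-e / c)] with a ha i
      have h1 : algebraMap M K c ≠ 0 := by simpa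
      rcases i with - | - | i
      · rw [lineExpansion_coeff_zero]
      · have : (lineExpansion y a (C c * X + C e)).coeff 1 =
            algebraMap M K c * (y - algebraMap M K a) := by
          simp [lineExpansion, mul_add, Polynomial.algebraMap_apply, coeff_C]
        rw [zero_add, this, map_mul]
        refine (mul_le_mul_right ha _).trans (le_of_eq ?_)
        rw [← map_mul]
        congr 1
        simp
        field_simp
        ring
      · rw [coeff_eq_zero_of_natDegree_lt]
        · simp
        · exact (natDegree_lineExpansion_le _ _).trans_lt (by omega)
  · have hlow (f : M[X]) (hf : f.natDegree < d) := ih _ hf (hf.trans (hd ▸ hg)) rfl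
    refine (Valuation.eventually_dominant_or hp hvp hg
      (hlow _ (hd ▸ natDegree_derivative_lt (by omega)))).resolve_right fun h => ?_
    have h1 := Valuation.eventually_dominant_le (by omega : 0 < d) hd hlow h (p / d)
      (f := X ^ p - C b) (by
        rw [natDegree_X_pow_sub_C]
        exact Nat.lt_mul_div_succ p (by omega))
    obtain ⟨a, ⟨j, hj, h2⟩, h3⟩ :=
      (h1.and (Valuation.eventually_not_dominant hp hy hvy hb)).exists
    exact h3 ⟨j, hj.trans_lt (Nat.div_lt_self hp.pos hd2), h2⟩

theorem Valuation.map_coeff_taylor_mul_pow_le_one {g : M[X]} {a : M}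
    (h : ∀ i, v ((lineExpansion y a g).coeff i) ≤ 1) (j : ℕ) :
    v (algebraMap M K ((taylor a g).coeff j) * (y - algebraMap M K a) ^ j) ≤ 1 := by
  obtain ⟨q, hq⟩ : lineExpansion y a g ∈ lifts v.integer.subtype := by
    rw [lifts_iff_coeff_lifts]
    exact fun n => ⟨⟨_, h n⟩, rfl⟩
  have h1 : (lineExpansion y a g).comp (X - 1) =
      ((taylor a g).map (algebraMap M K)).comp (C (y - algebraMap M K a) * X) := by
    have h2 := aeval_algHom_apply ((aeval (X - 1 : K[X]) : K[X] →ₐ[K] K[X]).restrictScalars M)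
      (C y + C (y - algebraMap M K a) * X) g
    rw [AlgHom.restrictScalars_apply, AlgHom.restrictScalars_apply] at h2
    change aeval (X - 1) (aeval (C y + C (y - algebraMap M K a) * X) g) = _
    rw [← h2, taylor_apply, Polynomial.map_comp, comp_assoc, comp, eval₂_map, aeval_def]
    congr 1
    simp
    ring
  have h3 : ((lineExpansion y a g).comp (X - 1)).coeff j =
      v.integer.subtype ((q.comp (X - 1)).coeff j) := by
    rw [← hq, ← coeff_map, Polynomial.map_comp]
    simp
  rw [h1, comp_C_mul_X_coeff, coeff_map] at h3
  rw [h3]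
  exact ((q.comp (X - 1)).coeff j).2

/-- Extracting a `p`-th root of an element that is not a `p`-th power modulo `p`, over a field whose
value group is `p`-divisible, gives a valuation ring that is a filtered union of monogenic integral
extensions. -/
theorem Valuation.exists_adjoin_of_forall_lt_sub_pow (hp : p.Prime) (hvp : v p < 1)
    (hy : y ^ p = algebraMap M K b) (hvy : v y ≤ 1)
    (hb : ∀ a : M, v p < v (algebraMap M K b - algebraMap M K a ^ p))
    (hdiv : ∀ m : M, m ≠ 0 → ∃ γ : M, v (algebraMap M K γ) ^ p = v (algebraMap M K m))
    {A : Type*} [CommRing A] [Algebra A K] {W : Subalgebra A K}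
    (hW : ∀ m : M, v (algebraMap M K m) ≤ 1 → algebraMap M K m ∈ W) (F : Finset K)
    (hF : ∀ x ∈ F, v x ≤ 1 ∧ ∃ g : M[X], x = aeval y g) :
    ∃ t : K, v t ≤ 1 ∧ (∃ g : M[X], t = aeval y g) ∧ IsIntegral W t ∧
      ∀ x ∈ F, x ∈ Algebra.adjoin W {t} := by
  have hg' (x : K) : ∃ g : M[X], x ∈ F → g.natDegree < p ∧ aeval y g = x := by
    by_cases hx : x ∈ F
    · obtain ⟨-, g, rfl⟩ := hF x hx
      obtain ⟨g', hg'⟩ := exists_natDegree_lt_aeval_eq hp hy g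
      exact ⟨g', fun _ => hg'⟩
    · exact ⟨0, fun h => (hx h).elim⟩
  choose g hg using hg'
  obtain ⟨a, hgood, hpow, ha⟩ : ∃ a : M, (∀ x ∈ F, ∀ i, v ((lineExpansion y a (g x)).coeff i) ≤
      v (aeval y (g x))) ∧ v (algebraMap M K b - algebraMap M K a ^ p) =
        v (y - algebraMap M K a) ^ p ∧ v (algebraMap M K a) ≤ 1 :=
    (((Filter.eventually_all_finset F).mpr fun x hx =>
      Valuation.eventually_dominant hp hvp hy hvy hb (hg x hx).1).and
      ((Valuation.eventually_map_pow_eq hp hy hvy hb).and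
        (Valuation.eventually_le_one hvy))).exists
  have hba : b - a ^ p ≠ 0 := by
    intro h
    have := hb a
    rw [← map_pow, ← _root_.map_sub, h, map_zero, map_zero] at this
    exact not_lt_zero this
  obtain ⟨γ, hγ⟩ := hdiv _ hba
  have hγp := hb a
  rw [_root_.map_sub, map_pow] at hγ
  rw [← hγ] at hγp
  have hγz : v (algebraMap M K γ) = v (y - algebraMap M K a) :=
    (pow_left_inj₀ zero_le zero_le hp.ne_zero).mp (hγ.trans hpow)
  have hγ0 : algebraMap M K γ ≠ 0 := by
    intro h
    rw [h, map_zero, zero_pow hp.ne_zero] at hγp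
    exact not_lt_zero hγp
  have hvγ : 0 < v (algebraMap M K γ) := zero_lt_iff.mpr ((v.ne_zero_iff).mpr hγ0)
  set t := (y - algebraMap M K a) / algebraMap M K γ with ht
  have hvt : v t = 1 := by rw [ht, map_div₀, ← hγz, div_self hvγ.ne']
  refine ⟨t, hvt.le, ⟨C γ⁻¹ * (X - C a), ?_⟩, ?_, fun x hx => ?_⟩
  · rw [ht, map_mul, aeval_C, map_inv₀, _root_.map_sub, aeval_X, aeval_C, div_eq_inv_mul]
  · let f : M[X] := (taylor a (X ^ p - C b)).scaleRoots γ⁻¹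
    have hfmonic : f.Monic := by
      rw [monic_scaleRoots_iff, Monic, leadingCoeff_taylor]
      exact monic_X_pow_sub_C b hp.ne_zero
    have hdeg : (taylor a (X ^ p - C b)).natDegree = p := by
      rw [natDegree_taylor, natDegree_X_pow_sub_C]
    have hroot : aeval t f = 0 := by
      rw [ht, div_eq_inv_mul, ← map_inv₀]
      apply scaleRoots_aeval_eq_zero
      rw [taylor_apply, aeval_comp]
      simp [hy]
    have hcoeff (i : ℕ) : v (algebraMap M K (f.coeff i)) ≤ 1 := by
      rw [coeff_scaleRoots, hdeg, map_mul, map_mul, map_pow, map_inv₀, map_pow, map_inv₀,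
        inv_pow, ← div_eq_mul_inv]
      refine div_le_one_of_le₀ ?_ zero_le
      have hco : (taylor a (X ^ p - C b)).coeff i =
          a ^ (p - i) * p.choose i - (C b : M[X]).coeff i := by
        rw [_root_.map_sub, taylor_pow, taylor_X, taylor_C, coeff_sub, coeff_X_add_C_pow]
      have hγ1 : v (algebraMap M K γ) ≤ 1 := hγz ▸ v.map_sub_le hvy ha
      rcases Nat.eq_zero_or_pos i with rfl | hi0
      · rw [hco, Nat.sub_zero, hγ, Nat.choose_zero_right, coeff_C_zero, v.map_sub_swap]
        simp
      rw [hco, coeff_C, if_neg hi0.ne', sub_zero, map_mul, map_pow, map_natCast, map_mul, map_pow]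
      have hnat (n : ℕ) : v (n : K) ≤ 1 := (v.mem_integer_iff _).mp (natCast_mem v.integer n)
      refine (mul_le_of_le_one_left zero_le (pow_le_one₀ zero_le ha)).trans ?_
      rcases lt_or_ge i p with hip | hip
      · obtain ⟨c, hc⟩ := hp.dvd_choose_self hi0.ne' hip
        rw [hc, Nat.cast_mul, map_mul]
        exact (mul_le_of_le_one_right zero_le (hnat c)).trans
          (hγp.le.trans (pow_le_pow_of_le_one zero_le hγ1 (Nat.sub_le p i)))
      · rw [Nat.sub_eq_zero_of_le hip, pow_zero]
        exact hnat _
    have hlift : f.map (algebraMap M K) ∈ lifts (algebraMap W K) := by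
      rw [lifts_iff_coeff_lifts]
      intro n
      rw [coeff_map]
      exact ⟨⟨_, hW _ (hcoeff n)⟩, rfl⟩
    obtain ⟨q, hq, -, hqm⟩ := lifts_and_natDegree_eq_and_monic hlift (hfmonic.map _)
    refine ⟨q, hqm, ?_⟩
    rw [← eval_map, hq, eval_map_algebraMap, hroot]
  · have hsum : x = ∑ j ∈ Finset.range ((taylor a (g x)).natDegree + 1),
        algebraMap M K ((taylor a (g x)).coeff j * γ ^ j) * t ^ j := by
      have h1 : aeval (y - algebraMap M K a) (taylor a (g x)) = aeval y (g x) := by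
        rw [taylor_apply, aeval_comp]
        simp
      conv_lhs => rw [← (hg x hx).2, ← h1, aeval_eq_sum_range]
      refine Finset.sum_congr rfl fun j _ => ?_
      rw [Algebra.smul_def, map_mul, map_pow, mul_assoc, ← mul_pow, ht, mul_div_cancel₀ _ hγ0]
    rw [hsum]
    refine sum_mem fun j _ => mul_mem ?_ (pow_mem (Algebra.self_mem_adjoin_singleton W t) _)
    refine (Algebra.adjoin W {t}).algebraMap_mem ⟨_, hW _ ?_⟩
    rw [map_mul, map_mul, map_pow, map_pow, hγz, ← map_pow, ← map_mul]
    refine Valuation.map_coeff_taylor_mul_pow_le_one (fun i => (hgood x hx i).trans ?_) j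
    rw [(hg x hx).2]
    exact (hF x hx).1

end Immediate
end

section RootExtensions

open KaehlerDifferential Polynomial
open scoped IntermediateField

variable {C L K Γ₀ : Type*} [CommRing C] [Field L] [Field K] [Algebra C L] [Algebra C K]
  [Algebra L K] [IsScalarTower C L K] [LinearOrderedCommGroupWithZero Γ₀]

/-- The valuation ring of an intermediate field of `K/L`, as a `C`-subalgebra of `K`. -/
def IntermediateField.integerSubalgebra (M : IntermediateField L K) {v : Valuation K Γ₀}
    (hC : ∀ c : C, v (algebraMap C K c) ≤ 1) : Subalgebra C K where
  carrier := {x | x ∈ M ∧ v x ≤ 1}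
  mul_mem' hx hy := ⟨M.mul_mem hx.1 hy.1, by rw [map_mul]; exact mul_le_one' hx.2 hy.2⟩
  add_mem' hx hy := ⟨M.add_mem hx.1 hy.1, v.map_add_le hx.2 hy.2⟩
  algebraMap_mem' c :=
    ⟨by rw [IsScalarTower.algebraMap_apply C L K]; exact M.algebraMap_mem _, hC c⟩

variable {v : Valuation K Γ₀} {hC : ∀ c : C, v (algebraMap C K c) ≤ 1}
  {M M' : IntermediateField L K}

theorem IntermediateField.integerSubalgebra_mono (h : M ≤ M') :
    M.integerSubalgebra hC ≤ M'.integerSubalgebra hC := fun _ hx => ⟨h hx.1, hx.2⟩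

theorem IntermediateField.dvd_of_map_le {x y : M.integerSubalgebra hC}
    (h : v (x : K) ≤ v (y : K)) : y ∣ x := by
  by_cases hy : (y : K) = 0
  · rw [hy, map_zero, le_zero_iff, map_eq_zero] at h
    rw [show x = 0 from Subtype.ext h]
    exact dvd_zero y
  · refine ⟨⟨x / y, M.div_mem x.2.1 y.2.1, ?_⟩, Subtype.ext (mul_div_cancel₀ _ hy).symm⟩
    rw [map_div₀]
    exact div_le_one_of_le₀ h zero_le

instance : ValuationRing (M.integerSubalgebra hC) :=
  ValuationRing.iff_dvd_total.mpr ⟨fun x y =>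
    (le_total (v (y : K)) (v (x : K))).imp IntermediateField.dvd_of_map_le
      IntermediateField.dvd_of_map_le⟩

instance [CharZero K] : CharZero (M.integerSubalgebra hC) :=
  (M.integerSubalgebra hC).subtype.charZero

theorem IntermediateField.isUnit_of_isUnit_inclusion (h : M ≤ M') {x : M.integerSubalgebra hC}
    (hx : IsUnit (Subalgebra.inclusion (integerSubalgebra_mono h) x)) : IsUnit x := by
  obtain ⟨u, hu⟩ := hx.exists_right_inv
  refine isUnit_of_dvd_one (dvd_of_map_le ?_)
  replace hu : (x : K) * u = 1 := congr_arg Subtype.val hu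
  rw [OneMemClass.coe_one, ← hu, map_mul]
  exact mul_le_of_le_one_right zero_le u.2.2

theorem IntermediateField.mapAlgHom_inclusion_adjoin_injective [CharZero K] {y : K}
    (hy : IsAlgebraic M y)
    (hfin : ∀ F : Finset K, (∀ x ∈ F, v x ≤ 1 ∧ ∃ g : M[X], x = aeval y g) →
      ∃ t : K, v t ≤ 1 ∧ (∃ g : M[X], t = aeval y g) ∧ IsIntegral (M.integerSubalgebra hC) t ∧
        ∀ x ∈ F, x ∈ Algebra.adjoin (M.integerSubalgebra hC) {t})
    (h : M ≤ M⟮y⟯.restrictScalars L) :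
    Function.Injective
      (KaehlerDifferential.mapAlgHom
        (Subalgebra.inclusion (integerSubalgebra_mono (hC := hC) h))) := by
  classical
  have hmem (x : K) (hx : x ∈ M⟮y⟯) : ∃ g : M[X], x = aeval y g := by
    rw [← mem_toSubalgebra, adjoin_simple_toSubalgebra_of_isAlgebraic hy,
      Algebra.adjoin_singleton_eq_range_aeval] at hx
    obtain ⟨g, hg⟩ := hx
    exact ⟨g, hg.symm⟩
  refine mapAlgHom_injective_of_monogenic _ (Subalgebra.inclusion_injective _)
    (fun x hx => isUnit_of_isUnit_inclusion h hx) fun F => ?_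
  obtain ⟨t, hvt, ⟨g, hg⟩, htint, htF⟩ := hfin (F.image Subtype.val) (by
    intro x hx
    obtain ⟨x, -, rfl⟩ := Finset.mem_image.mp hx
    exact ⟨x.2.2, hmem _ x.2.1⟩)
  have htM : t ∈ M⟮y⟯ := by
    rw [hg]
    exact algebra_adjoin_le_adjoin M {y} (aeval_mem_adjoin_singleton M y)
  let t' : (M⟮y⟯.restrictScalars L).integerSubalgebra hC := ⟨t, htM, hvt⟩
  have heval (q : (M.integerSubalgebra hC)[X]) : ((q.eval₂
      (Subalgebra.inclusion (integerSubalgebra_mono (hC := hC) h)).toRingHom t' :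
      (M⟮y⟯.restrictScalars L).integerSubalgebra hC) : K) = aeval t q := by
    rw [aeval_def]
    exact hom_eval₂ q _ ((M⟮y⟯.restrictScalars L).integerSubalgebra hC).subtype t'
  refine ⟨t', ?_, fun x hx => ?_⟩
  · obtain ⟨q, hqm, hq⟩ := htint
    exact ⟨q, hqm, Subtype.ext ((heval q).trans hq)⟩
  · have := htF x (Finset.mem_image_of_mem _ hx)
    rw [Algebra.adjoin_singleton_eq_range_aeval] at this
    obtain ⟨q, hq⟩ := this
    exact ⟨q, Subtype.ext (hq.symm.trans (heval q).symm)⟩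

theorem IntermediateField.exists_eq_pow_add_mul_or_exists_root [CharZero K] [IsAlgClosed K]
    {p : ℕ} (hp : p.Prime) (hvp : v p < 1) :
    (∀ x : M.integerSubalgebra hC, ∃ y z, x = y ^ p + p * z) ∨
    ∃ y : K, y ∉ M ∧ IsAlgebraic M y ∧
      ∀ F : Finset K, (∀ x ∈ F, v x ≤ 1 ∧ ∃ g : M[X], x = aeval y g) →
      ∃ t : K, v t ≤ 1 ∧ (∃ g : M[X], t = aeval y g) ∧ IsIntegral (M.integerSubalgebra hC) t ∧
        ∀ x ∈ F, x ∈ Algebra.adjoin (M.integerSubalgebra hC) {t} := by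
  have hW (m : M) (hm : v (algebraMap M K m) ≤ 1) : algebraMap M K m ∈ M.integerSubalgebra hC :=
    ⟨m.2, hm⟩
  have halg {y : K} {b : M} (hy : y ^ p = algebraMap M K b) : IsAlgebraic M y := by
    refine IsIntegral.isAlgebraic (IsIntegral.of_pow hp.pos ?_)
    rw [hy]
    exact isIntegral_algebraMap
  refine or_iff_not_imp_left.mpr fun hx => ?_
  push Not at hx
  obtain ⟨x, hx⟩ := hx
  have hxp (a : M) : v p < v (algebraMap M K ⟨x, x.2.1⟩ - algebraMap M K a ^ p) := by
    refine lt_of_not_ge fun h => ?_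
    change v ((x : K) - (a : K) ^ p) ≤ v p at h
    have ha : v (a : K) ≤ 1 := by
      rw [← pow_le_one_iff_of_nonneg zero_le hp.ne_zero, ← map_pow,
        ← sub_sub_cancel (x : K) ((a : K) ^ p)]
      exact v.map_sub_le x.2.2 (h.trans hvp.le)
    obtain ⟨z, hz⟩ := dvd_of_map_le (hC := hC) (M := M) (x := x - ⟨a, a.2, ha⟩ ^ p) (y := p)
      (by simpa using h)
    exact hx _ z (eq_add_of_sub_eq' hz)
  by_cases hdiv : ∀ m : M, m ≠ 0 → ∃ γ : M, v (algebraMap M K γ) ^ p = v (algebraMap M K m)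
  · obtain ⟨y, hy⟩ := IsAlgClosed.exists_pow_nat_eq (x : K) hp.pos
    have hy' : y ^ p = algebraMap M K ⟨x, x.2.1⟩ := hy
    refine ⟨y, fun hyM => ?_, halg hy', fun F hF => ?_⟩
    · have := hxp ⟨y, hyM⟩
      rw [← hy'] at this
      change v p < v (y ^ p - y ^ p) at this
      rw [sub_self, map_zero] at this
      exact not_lt_zero this
    · refine Valuation.exists_adjoin_of_forall_lt_sub_pow hp hvp hy' ?_ hxp hdiv hW F hF
      rw [← pow_le_one_iff_of_nonneg zero_le hp.ne_zero, ← map_pow, hy]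
      exact x.2.2
  · push Not at hdiv
    obtain ⟨m, hm0, hm⟩ := hdiv
    obtain ⟨y, hy⟩ := IsAlgClosed.exists_pow_nat_eq (algebraMap M K m) hp.pos
    refine ⟨y, fun hyM => ?_, halg hy, fun F hF => ?_⟩
    · apply hm ⟨y, hyM⟩
      rw [← map_pow, ← hy]
      rfl
    · exact Valuation.exists_adjoin_of_forall_pow_ne hp hy hm0 hm hW F hF

variable {E : Type*} [CommRing E] [Algebra C E]

/-- A `C`-algebra map from `E` to the valuation ring of `L`, viewed in an intermediate field. -/
def IntermediateField.toIntegerSubalgebra (hC : ∀ c : C, v (algebraMap C K c) ≤ 1) (φ : E →ₐ[C] L)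
    (hφ : ∀ e, v (algebraMap L K (φ e)) ≤ 1) (M : IntermediateField L K) :
    E →ₐ[C] M.integerSubalgebra hC :=
  ((IsScalarTower.toAlgHom C L K).comp φ).codRestrict _ fun e => ⟨M.algebraMap_mem (φ e), hφ e⟩

theorem KaehlerDifferential.mapAlgHom_toIntegerSubalgebra_eq_zero [CharZero K] [IsAlgClosed K]
    {p : ℕ} (hp : p.Prime) (hvp : v p < 1) {π u : C} (hu : IsUnit u) (hπ : π ^ p = p * u)
    (hfrob : ∀ x : C, ∃ y z, x = y ^ p + p * z) (φ : E →ₐ[C] L)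
    (hφ : ∀ e, v (algebraMap L K (φ e)) ≤ 1) {ω : Ω[E⁄C]} (hω : (p : E) • ω = 0) :
    mapAlgHom (IntermediateField.toIntegerSubalgebra hC φ hφ ⊥) ω = 0 := by
  by_contra hne
  let f (M : IntermediateField L K) : E →ₐ[C] M.integerSubalgebra hC :=
    IntermediateField.toIntegerSubalgebra hC φ hφ M
  obtain ⟨M, hM⟩ := zorn_le₀ {M : IntermediateField L K | mapAlgHom (f M) ω ≠ 0} (by
    intro S hS hchain
    rcases S.eq_empty_or_nonempty with rfl | hSne
    · exact ⟨⊥, hne, by simp⟩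
    refine ⟨sSup S, fun h0 => ?_, fun M hM => le_sSup hM⟩
    obtain ⟨F, hF⟩ := exists_finset_forall_mapAlgHom_eq_zero _ h0
    have := hSne.to_subtype
    have hmem (x : K) : x ∈ sSup S ↔ ∃ M ∈ S, x ∈ M := by
      rw [← SetLike.mem_coe, sSup_eq_iSup', IntermediateField.coe_iSup_of_directed
        hchain.directedOn.directed_val]
      simp
    obtain ⟨M, hMS, hMF⟩ : ∃ M ∈ S, ∀ x ∈ F, (x : K) ∈ M := by
      classical
      clear hF
      induction F using Finset.induction_on with
      | empty => exact ⟨hSne.some, hSne.some_mem, by simp⟩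
      | insert x F _ ih =>
        obtain ⟨M₁, h₁, hF₁⟩ := ih
        obtain ⟨M₂, h₂, hx⟩ := (hmem x).mp x.2.1
        rcases hchain.total h₁ h₂ with h | h
        · exact ⟨M₂, h₂, Finset.forall_mem_insert .. |>.mpr ⟨hx, fun z hz => h (hF₁ z hz)⟩⟩
        · exact ⟨M₁, h₁, Finset.forall_mem_insert .. |>.mpr ⟨h hx, hF₁⟩⟩
    refine hS hMS (hF _ (Subalgebra.inclusion (IntermediateField.integerSubalgebra_mono
      (le_sSup hMS))) (Subalgebra.inclusion_injective _) (fun x hx => ?_) (f M) rfl)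
    exact ⟨⟨x, hMF x hx, x.2.2⟩, rfl⟩)
  have hvu : v (algebraMap C K u) = 1 := by
    obtain ⟨w, hw⟩ := hu.exists_right_inv
    refine le_antisymm (hC u) ?_
    rw [← map_one v, ← map_one (algebraMap C K), ← hw, map_mul, map_mul]
    exact mul_le_of_le_one_right zero_le (hC w)
  have hvπ : v (algebraMap C K π) ^ p = v p := by
    rw [← map_pow, ← map_pow, hπ, map_mul, map_mul, hvu, mul_one, map_natCast]
  rcases M.exists_eq_pow_add_mul_or_exists_root (hC := hC) hp hvp with hW | ⟨y, hyM, hy, hfin⟩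
  · refine hM.prop (eq_zero_of_frobenius_surjective hp (Nat.cast_ne_zero.mpr hp.ne_zero) hπ
      (fun y hy => IntermediateField.dvd_of_map_le ?_) hfrob hW ?_)
    · obtain ⟨z, hz⟩ := hy
      rw [← pow_le_pow_iff_left₀ zero_le zero_le hp.ne_zero]
      change _ ≤ v (algebraMap C K π) ^ p
      rw [hvπ, ← map_pow]
      have := congr_arg Subtype.val hz
      change (y : K) ^ p = (p : K) * z at this
      rw [this, map_mul]
      exact mul_le_of_le_one_right zero_le z.2.2
    · have := mapAlgHom_smul (f M) (p : E) ω
      rw [hω, map_zero, map_natCast] at this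
      exact this.symm
  · have hle : M ≤ M⟮y⟯.restrictScalars L := fun x hx => M⟮y⟯.algebraMap_mem ⟨x, hx⟩
    have hinj := M.mapAlgHom_inclusion_adjoin_injective hy hfin hle
    refine hyM (hM.le_of_ge (y := M⟮y⟯.restrictScalars L) ?_ hle
      (IntermediateField.mem_adjoin_simple_self M y))
    intro h0
    refine hM.prop (hinj ?_)
    rw [_root_.map_zero, ← KaehlerDifferential.mapAlgHom_comp]
    exact h0

end RootExtensions

theorem ValuationRing.exists_pow_eq_prime_mul_isUnit {p : ℕ} {C : Type*} [CommRing C] [IsDomain C]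
    [ValuationRing C] (hpu : ¬ IsUnit (p : C)) (hC : ∀ x : C, ∃ y z, x = y ^ p + p * z)
    {a : C} {n : ℕ} (ha : ¬ (p : C) ∣ a) (han : (p : C) ∣ a ^ n) :
    ∃ π u : C, IsUnit u ∧ π ^ p = p * u := by
  have ha' : ¬ IsUnit a := fun h => hpu (isUnit_of_dvd_unit han (h.pow n))
  obtain ⟨c, hc⟩ := (ValuationRing.dvd_total (p : C) a).resolve_left ha
  have hc' : ¬ IsUnit c := fun h => ha (by rw [hc]; exact (h.dvd_mul_right.mp (dvd_refl _)) )
  have hunit {x : C} (hx : ¬ IsUnit x) (z : C) : IsUnit (1 - x * z) :=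
    IsLocalRing.isUnit_one_sub_self_of_mem_nonunits _ fun h => hx (isUnit_of_mul_isUnit_left h)
  obtain ⟨y, z, hy⟩ := hC a
  obtain ⟨y', z', hy'⟩ := hC c
  refine ⟨y * y', _, (hunit hc' z).mul (hunit ha' z'), ?_⟩
  have h1 : y ^ p = a * (1 - c * z) := by rw [hc] at hy; linear_combination -hy
  have h2 : y' ^ p = c * (1 - a * z') := by rw [hc] at hy'; linear_combination -hy'
  rw [mul_pow, h1, h2, hc]
  ring

open KaehlerDifferential in
theorem KaehlerDifferential.eq_zero_of_prime_smul_eq_zero {p : ℕ} (hp : p.Prime)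
    {C E : Type*} [CommRing C] [CommRing E] [IsDomain E] [ValuationRing E] [CharZero E]
    [Algebra C E] (hpE : ¬ IsUnit (p : E)) {π u : C} (hu : IsUnit u) (hπ : π ^ p = p * u)
    (hfrob : ∀ x : C, ∃ y z, x = y ^ p + p * z) {ω : Ω[E⁄C]} (hω : (p : E) • ω = 0) : ω = 0 := by
  let L := FractionRing E
  let K := AlgebraicClosure L

  have : CharZero L := charZero_of_injective_algebraMap (IsFractionRing.injective E L)
  have : CharZero K := charZero_of_injective_algebraMap (algebraMap L K).injective
  obtain ⟨V, hV, hloc⟩ := IsLocalRing.exists_factor_valuationRing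
    ((algebraMap L K).comp (algebraMap E L))
  let v := V.valuation
  have hE (e : E) : v (algebraMap L K (algebraMap E L e)) ≤ 1 :=
    (V.valuation_le_one_iff _).mpr (hV e)
  have hunit (e : E) (he : v (algebraMap L K (algebraMap E L e)) = 1) : IsUnit e := by
    exact hloc.map_nonunit e ((V.valuation_eq_one_iff ⟨_, hV e⟩).mpr he)
  have hC (c : C) : v (algebraMap C K c) ≤ 1 := by
    rw [IsScalarTower.algebraMap_apply C L K, IsScalarTower.algebraMap_apply C E L]
    exact hE _
  have hvp : v (p : K) < 1 := by
    have h := hE p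
    simp only [map_natCast] at h
    refine lt_of_le_of_ne h fun h1 => hpE (hunit p ?_)
    simpa only [map_natCast] using h1
  let φ : E →ₐ[C] L := IsScalarTower.toAlgHom C E L
  have hφ (e : E) : v (algebraMap L K (φ e)) ≤ 1 := hE e
  have hinj := mapAlgHom_injective_of_bijective
    (f := IntermediateField.toIntegerSubalgebra hC φ hφ ⊥) ⟨fun x y hxy => ?_, fun x => ?_⟩
  · apply hinj
    rw [map_zero]
    exact mapAlgHom_toIntegerSubalgebra_eq_zero hp hvp hu hπ hfrob φ hφ hω
  · exact IsFractionRing.injective E L ((algebraMap L K).injective (congr_arg Subtype.val hxy))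
  · obtain ⟨l, hl⟩ := IntermediateField.mem_bot.mp x.2.1
    suffices h : ∃ e : E, algebraMap E L e = l by
      obtain ⟨e, rfl⟩ := h
      exact ⟨e, Subtype.ext hl⟩
    rcases ValuationRing.isInteger_or_isInteger E l with h | ⟨e, he⟩
    · exact h
    · by_cases hl0 : l = 0
      · exact ⟨0, by rw [hl0, map_zero]⟩
      have hmul : algebraMap L K (algebraMap E L e) * x = 1 := by
        rw [← hl, he, ← map_mul, inv_mul_cancel₀ hl0, map_one]
      obtain ⟨w, hw⟩ := (hunit e (le_antisymm (hE e) (by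
        rw [← map_one v, ← hmul, map_mul]
        exact mul_le_of_le_one_right zero_le x.2.2))).exists_right_inv
      refine ⟨w, ?_⟩
      have hw' : algebraMap E L e * algebraMap E L w = 1 := by rw [← map_mul, hw, map_one]
      rw [he] at hw'
      exact (eq_of_inv_mul_eq_one hw').symm

theorem charZero_of_natCast_not_isUnit {p : ℕ} {E : Type*} [CommRing E] [IsDomain E]
    (hp0 : (p : E) ≠ 0) (hpE : ¬ IsUnit (p : E)) : CharZero E := by
  obtain ⟨q, hq⟩ := CharP.exists E
  rcases CharP.char_is_prime_or_zero E q with hq' | rfl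
  · exfalso
    refine hpE ((CharP.isUnit_natCast_iff hq').mpr fun h => hp0 ?_)
    rw [(CharP.cast_eq_zero_iff E q p).mpr h]
  · exact CharP.charP_to_charZero E

/-- **Proposition 4.8** (cotangent smoothness of `C⁺/p → E⁺/p`, module-of-differentials
content): let `C` be a valuation ring in which `p` is neither zero nor a unit, whose
reduction `C/pC` has surjective Frobenius and a nonzero nilpotent element, and let `E` be a
valuation ring extension of `C`. Then `Ω¹_{E/C}` is `p`-torsionfree and its reduction
modulo `p` is a flat `E/pE`-module. -/
theorem differentials_p_torsionfree_and_mod_p_flat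
    (p : ℕ) (hp : p.Prime)
    (C : Type) [CommRing C] [IsDomain C] [ValuationRing C]
    (hp0 : (p : C) ≠ 0) (hpu : ¬ IsUnit (p : C))
    (hfrob : ∀ y : C ⧸ Ideal.span {(p : C)}, ∃ x, x ^ p = y)
    (hnilp : ∃ x : C ⧸ Ideal.span {(p : C)}, x ≠ 0 ∧ IsNilpotent x)
    (E : Type) [CommRing E] [IsDomain E] [ValuationRing E]
    [Algebra C E] (hinj : Function.Injective (algebraMap C E)) :
    (Function.Injective fun ω : KaehlerDifferential C E => (p : E) • ω) ∧
      Module.Flat (E ⧸ Ideal.span {(p : E)})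
        ((KaehlerDifferential C E) ⧸
          ((Ideal.span {(p : E)}) • ⊤ : Submodule E (KaehlerDifferential C E))) := by

  have hC (x : C) : ∃ y z : C, x = y ^ p + p * z := by
    obtain ⟨y, hy⟩ := hfrob (Ideal.Quotient.mk _ x)
    obtain ⟨y, rfl⟩ := Ideal.Quotient.mk_surjective y
    rw [← map_pow, eq_comm, Ideal.Quotient.mk_eq_mk_iff_sub_mem, Ideal.mem_span_singleton] at hy
    obtain ⟨z, hz⟩ := hy
    exact ⟨y, z, by rw [← hz, add_sub_cancel]⟩
  have hE0 : (p : E) ≠ 0 := by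
    rw [← map_natCast (algebraMap C E)]
    exact (map_ne_zero_iff _ hinj).mpr hp0
  have htf : Function.Injective fun ω : KaehlerDifferential C E => (p : E) • ω := by
    by_cases hpE : IsUnit (p : E)
    · exact fun x y hxy => hpE.smul_left_cancel.mp hxy
    · have := charZero_of_natCast_not_isUnit hE0 hpE
      obtain ⟨a, ha0, n, han⟩ := hnilp
      obtain ⟨a, rfl⟩ := Ideal.Quotient.mk_surjective a
      rw [Ne, Ideal.Quotient.eq_zero_iff_mem, Ideal.mem_span_singleton] at ha0
      rw [← map_pow, Ideal.Quotient.eq_zero_iff_mem, Ideal.mem_span_singleton] at han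
      obtain ⟨π, u, hu, hπ⟩ := ValuationRing.exists_pow_eq_prime_mul_isUnit hpu hC ha0 han
      intro x y hxy
      refine sub_eq_zero.mp (KaehlerDifferential.eq_zero_of_prime_smul_eq_zero hp hpE hu hπ hC ?_)
      rw [smul_sub]
      exact sub_eq_zero.mpr hxy
  exact ⟨htf, Module.Flat.quotient_of_valuationRing htf⟩
end

section
/- Let p be a prime number and let C⁺ be a nonzero valuation ring in which p is neither zero nor a unit, which is p-adically complete and separated (the canonical map C⁺ → lim_n C⁺/pⁿC⁺ is an isomorphism), and such that the Frobenius endomorphism x ↦ x^p of C⁺/pC⁺ is surjective. Then the following are equivalent: (i) C⁺/pC⁺ contains a nonzero nilpotent element; (ii) there exist a unit u ∈ C⁺ and a sequence (x_n)_{n ≥ 0} of elements of C⁺ with x₀ = u·p and x_{n+1}^p = x_n for all n ≥ 0 (a compatible system of p-power roots of u·p). -/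
/-- In a valuation domain, elements congruent modulo `q` are associated unless `q` divides them. -/
theorem ValuationRing.associated_of_dvd_sub {R : Type*} [CommRing R] [IsDomain R]
    [ValuationRing R] {q a b : R} (hab : q ∣ b - a) (ha : ¬ q ∣ a) : Associated a b := by
  obtain ⟨c, hc⟩ := hab
  obtain ⟨d, rfl⟩ := (ValuationRing.dvd_total q a).resolve_left ha
  have hd : ¬ IsUnit d := fun hd ↦ ha (hd.mul_right_dvd.mpr dvd_rfl)
  have hu : IsUnit (1 + d * c) := by
    by_contra h
    refine (IsLocalRing.nonunits_add (a := 1 + d * c) (b := -(d * c)) h ?_) (by simp)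
    simpa [mem_nonunits_iff] using fun h2 ↦ absurd h2 hd
  exact ⟨hu.unit, by rw [IsUnit.unit_spec]; linear_combination -hc⟩

/-- A root of a nonzero nonunit `q`, up to units and of exponent at least two, is not divisible
by `q`. -/
theorem not_dvd_of_associated_pow {R : Type*} [CommRing R] [IsDomain R] {q x : R} {n : ℕ}
    (hq0 : q ≠ 0) (hq : ¬ IsUnit q) (hn : 1 < n) (hx : Associated (x ^ n) q) : ¬ q ∣ x := by
  intro h
  have h2 : q ^ n ∣ q ^ 1 := by simpa using (pow_dvd_pow_of_dvd h n).trans hx.dvd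
  exact absurd ((pow_dvd_pow_iff hq0 hq).mp h2) (by lia)

/-- If Frobenius is surjective modulo `p`, every element of a `p`-adically complete ring is
congruent modulo `p` to one with a compatible system of `p`-power roots. -/
theorem exists_compatible_roots {R : Type*} [CommRing R] {p : ℕ} (hp : p.Prime)
    (hpu : ¬ IsUnit (p : R)) [IsAdicComplete (Ideal.span {(p : R)}) R]
    (hfrob : ∀ y : R ⧸ Ideal.span {(p : R)}, ∃ x, x ^ p = y) (a : R) :
    ∃ x : ℕ → R, (p : R) ∣ x 0 - a ∧ ∀ n, x (n + 1) ^ p = x n := by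
  have : Fact p.Prime := ⟨hp⟩
  have : Fact (¬ IsUnit (p : R)) := ⟨hpu⟩
  obtain ⟨f, hf⟩ : ∃ f : PreTilt R p, PreTilt.coeff 0 f = Ideal.Quotient.mk _ a :=
    Perfection.coeff_surjective (R := ModP R p) (p := p) (fun y ↦ hfrob y) 0 _
  refine ⟨fun n ↦ PreTilt.untilt ((frobeniusEquiv (PreTilt R p) p).symm^[n] f), ?_, fun n ↦ ?_⟩
  · rw [← Ideal.mem_span_singleton, ← Ideal.Quotient.mk_eq_mk_iff_sub_mem]
    exact (PreTilt.mk_untilt_eq_coeff_zero f).trans hf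
  · rw [← map_pow, Function.iterate_succ_apply', frobeniusEquiv_symm_pow_p]

/-- If Frobenius is surjective modulo `p` on a valuation domain, elements not divisible by `p`
are `p`-th powers up to units. -/
theorem ValuationRing.exists_associated_pow {R : Type*} [CommRing R] [IsDomain R]
    [ValuationRing R] {p : ℕ} (hfrob : ∀ y : R ⧸ Ideal.span {(p : R)}, ∃ x, x ^ p = y)
    {y : R} (hy : ¬ (p : R) ∣ y) : ∃ w : R, Associated (w ^ p) y := by
  obtain ⟨x, hx⟩ := hfrob (Ideal.Quotient.mk _ y)
  obtain ⟨w, rfl⟩ := Ideal.Quotient.mk_surjective x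
  rw [← map_pow, Ideal.Quotient.mk_eq_mk_iff_sub_mem, Ideal.mem_span_singleton] at hx
  exact ⟨w, (ValuationRing.associated_of_dvd_sub hx hy).symm⟩


/-- **Lemma 4.4** (characterisation of mixed-characteristic valuation rings with perfectoid
`p`-adic completion): let `C` be a nonzero `p`-adically complete and separated valuation
ring in which `p` is neither zero nor a unit, with surjective Frobenius modulo `p`. Then
`C/pC` has a nonzero nilpotent element if and only if some unit multiple of `p` admits a
compatible system of `p`-power roots in `C`. -/
theorem perfectoid_valuation_ring_characterisation
    (p : ℕ) (hp : p.Prime)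
    (C : Type) [CommRing C] [IsDomain C] [ValuationRing C]
    (hp0 : (p : C) ≠ 0) (hpu : ¬ IsUnit (p : C))
    (hcomplete : IsAdicComplete (Ideal.span {(p : C)}) C)
    (hfrob : ∀ y : C ⧸ Ideal.span {(p : C)}, ∃ x, x ^ p = y) :
    (∃ x : C ⧸ Ideal.span {(p : C)}, x ≠ 0 ∧ IsNilpotent x) ↔
      (∃ (u : Cˣ) (x : ℕ → C), x 0 = (u : C) * p ∧ ∀ n, (x (n + 1)) ^ p = x n) := by
  constructor
  · rintro ⟨y, hy0, n, hyn⟩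
    obtain ⟨y, rfl⟩ := Ideal.Quotient.mk_surjective y
    rw [Ne, Ideal.Quotient.eq_zero_iff_dvd] at hy0
    rw [← map_pow, Ideal.Quotient.eq_zero_iff_dvd] at hyn
    have hyu : ¬ IsUnit y := fun h ↦ hpu (isUnit_of_dvd_unit hyn (h.pow n))
    obtain ⟨z, hz⟩ := (ValuationRing.dvd_total (p : C) y).resolve_left hy0
    have hz0 : ¬ (p : C) ∣ z := by
      rintro ⟨k, hk⟩
      have h0 : z ≠ 0 := by
        rintro rfl
        exact hp0 (by simpa using hz)
      refine hyu (IsUnit.of_mul_eq_one k (mul_left_cancel₀ h0 ?_))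
      linear_combination -hk - k * hz
    obtain ⟨w, hw⟩ := ValuationRing.exists_associated_pow hfrob hy0
    obtain ⟨t, ht⟩ := ValuationRing.exists_associated_pow hfrob hz0
    have hroot : Associated ((w * t) ^ p) (p : C) := by
      have := hw.mul_mul ht
      rwa [← mul_pow, ← hz] at this
    obtain ⟨x, hx0, hx⟩ := exists_compatible_roots hp hpu hfrob (w * t)
    have hxp : Associated (p : C) (x 0 ^ p) := hroot.symm.trans
      ((ValuationRing.associated_of_dvd_sub hx0
        (not_dvd_of_associated_pow hp0 hpu hp.one_lt hroot)).pow_pow)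
    obtain ⟨u, hu⟩ := hxp
    refine ⟨u, fun n ↦ n.casesOn (x 0 ^ p) x, ?_, ?_⟩
    · rw [mul_comm]
      exact hu.symm
    · rintro (_ | n)
      · rfl
      · exact hx n
  · rintro ⟨u, x, hx0, hx⟩
    have h1 : x 1 ^ p = u * p := (hx 0).trans hx0
    refine ⟨Ideal.Quotient.mk _ (x 1), ?_, p, ?_⟩
    · rw [Ne, Ideal.Quotient.eq_zero_iff_dvd]
      exact not_dvd_of_associated_pow hp0 hpu hp.one_lt
        (h1 ▸ associated_unit_mul_left _ _ u.isUnit)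
    · rw [← map_pow, Ideal.Quotient.eq_zero_iff_dvd, h1]
      exact dvd_mul_left _ _
end
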